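/- Let F be an algebraically closed field and G ⊆ GL_n(F) a closed subgroup acting irreducibly on F^n with G/Z(G) connected. Let G^der denote the derived group of the identity component G°. If the weight zero occurs in the restriction to G^der of the tautological representation (i.e., the zero weight multiplicity n₀ is positive), then G^der ∩ 𝔾_m = {1} and G is the internal direct product G = G^der × (G ∩ 𝔾_m). -/

import Mathlib

open Matrix

noncomputable section

variable {F : Type*} [Field F] {n : ℕ}

/-- Zariski-closed subsets of the space of `n × n` matrices: common zero loci of
families of polynomials in the matrix entries. -/
def MatZClosed (S : Set (Matrix (Fin n) (Fin n) F)) : Prop :=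
  ∃ I : Set (MvPolynomial (Fin n × Fin n) F),
    S = {A | ∀ p ∈ I, MvPolynomial.eval (fun q => A q.1 q.2) p = 0}

/-- Zariski-closed subsets of `GL_n(F)`: traces on `GL_n` of Zariski-closed sets
of matrices. -/
def GLZClosed (S : Set (GL (Fin n) F)) : Prop :=
  ∃ C : Set (Matrix (Fin n) (Fin n) F), MatZClosed C ∧
    S = {g : GL (Fin n) F | (g : Matrix (Fin n) (Fin n) F) ∈ C}

/-- A subset of `GL_n(F)` is connected for the Zariski topology:
it cannot be split by two relatively closed sets. -/
def GLZConnected (S : Set (GL (Fin n) F)) : Prop :=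
  S.Nonempty ∧ ∀ U V : Set (GL (Fin n) F), GLZClosed U → GLZClosed V →
    S ⊆ U ∪ V → (S ∩ U).Nonempty → (S ∩ V).Nonempty → (S ∩ (U ∩ V)).Nonempty

/-- Zariski closure of a subset of `GL_n(F)`. -/
def glZClosure (S : Set (GL (Fin n) F)) : Set (GL (Fin n) F) :=
  ⋂₀ {C : Set (GL (Fin n) F) | GLZClosed C ∧ S ⊆ C}

/-- The scalar matrix `c • 1` as an element of `GL_n(F)`. -/
def scalarGL (n : ℕ) (c : Fˣ) : GL (Fin n) F :=
  Units.map (Matrix.scalar (Fin n)).toMonoidHom c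

/-- The group `𝔾_m` of scalar matrices inside `GL_n(F)`. -/
def IsScalarGL (g : GL (Fin n) F) : Prop := ∃ c : Fˣ, g = scalarGL n c

/-- The tautological action of a subgroup `G ⊆ GL_n(F)` on `F^n` is irreducible. -/
def IrredOn (G : Subgroup (GL (Fin n) F)) : Prop :=
  0 < n ∧ ∀ W : Submodule F (Fin n → F),
    (∀ g ∈ G, ∀ v ∈ W, Matrix.mulVec (g : Matrix (Fin n) (Fin n) F) v ∈ W) → W = ⊥ ∨ W = ⊤

/-- The center of a subset of `GL_n(F)`. -/
def centerSet (S : Set (GL (Fin n) F)) : Set (GL (Fin n) F) :=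
  {z ∈ S | ∀ g ∈ S, z * g = g * z}

/-- The saturation of a subset of `GL_n(F)` by the scalar matrices `𝔾_m`.  For a
subgroup `G` whose tautological representation is irreducible (so that
`Z(G) = G ∩ 𝔾_m`), connectedness of this set is equivalent to connectedness of
`G/Z(G)` (the image of `G` in `PGL_n`), since the fibres `g·𝔾_m` are connected. -/
def scalarSaturation (S : Set (GL (Fin n) F)) : Set (GL (Fin n) F) :=
  {x | ∃ g ∈ S, ∃ c : Fˣ, x = scalarGL n c * g}

/-- The identity component of a subgroup `G ⊆ GL_n(F)` for the Zariski topology: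
the union of all Zariski-connected subsets of `G` containing `1`. -/
def identityComponent (G : Subgroup (GL (Fin n) F)) : Set (GL (Fin n) F) :=
  ⋃₀ {S : Set (GL (Fin n) F) | S ⊆ G ∧ GLZConnected S ∧ (1 : GL (Fin n) F) ∈ S}

/-- The identity component of `G`, as a subgroup (the subgroup it generates). -/
def idCompSubgroup (G : Subgroup (GL (Fin n) F)) : Subgroup (GL (Fin n) F) :=
  Subgroup.closure (identityComponent G)

/-- The derived group `G^der` of the identity component of `G`. -/
def derSubgroup (G : Subgroup (GL (Fin n) F)) : Subgroup (GL (Fin n) F) :=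
  ⁅idCompSubgroup G, idCompSubgroup G⁆

/-- A subset of `GL_n(F)` is (linearly) reductive: its tautological representation on
`F^n` is completely reducible. -/
def LinearlyReductiveOn (S : Set (GL (Fin n) F)) : Prop :=
  ∀ W : Submodule F (Fin n → F),
    (∀ g ∈ S, ∀ v ∈ W, Matrix.mulVec (g : Matrix (Fin n) (Fin n) F) v ∈ W) →
    ∃ W' : Submodule F (Fin n → F),
      (∀ g ∈ S, ∀ v ∈ W', Matrix.mulVec (g : Matrix (Fin n) (Fin n) F) v ∈ W') ∧ IsCompl W W'

/-- A subset of `GL_n(F)` is semisimple: reductive with finite center. -/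
def IsSemisimpleOn (S : Set (GL (Fin n) F)) : Prop :=
  LinearlyReductiveOn S ∧ (centerSet S).Finite

end

namespace DPD

universe u

/-- An affine variety given by its set of points and its algebra of regular functions. -/
class AV (F : outParam (Type u)) [Field F] (α : Type u) where
  R : Subalgebra F (α → F)
  fg : R.FG
  ev : ∀ φ : R →ₐ[F] F, ∃ a : α, ∀ f : R, φ f = f.1 a
  sep : ∀ a b : α, (∀ f ∈ R, f a = f b) → a = b

section basic
variable {F : Type u} [Field F] {α β γ : Type u} [AV F α] [AV F β] [AV F γ]

/-- Regular functions. -/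
def Reg (f : α → F) : Prop := f ∈ (AV.R (F := F) (α := α))

theorem Reg.add {f g : α → F} (hf : Reg f) (hg : Reg g) : Reg (fun a => f a + g a) :=
  Subalgebra.add_mem _ hf hg
theorem Reg.sub {f g : α → F} (hf : Reg f) (hg : Reg g) : Reg (fun a => f a - g a) :=
  Subalgebra.sub_mem _ hf hg
theorem Reg.neg {f : α → F} (hf : Reg f) : Reg (fun a => - f a) :=
  Subalgebra.neg_mem _ hf
theorem Reg.mul {f g : α → F} (hf : Reg f) (hg : Reg g) : Reg (fun a => f a * g a) :=
  Subalgebra.mul_mem _ hf hg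
theorem Reg.const (c : F) : Reg (fun _ : α => c) :=
  Subalgebra.algebraMap_mem _ c
theorem Reg.pow {f : α → F} (hf : Reg f) (k : ℕ) : Reg (fun a => f a ^ k) :=
  Subalgebra.pow_mem _ hf k
theorem Reg.sum {ι : Type*} (s : Finset ι) {f : ι → α → F} (hf : ∀ i ∈ s, Reg (f i)) :
    Reg (fun a => ∑ i ∈ s, f i a) := by
  have := Subalgebra.sum_mem (AV.R (F := F) (α := α)) (t := s) (f := f) hf
  have h2 : ∀ g : α → F, g ∈ (AV.R (F := F) (α := α)) → Reg g := fun _ h => h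
  convert h2 _ this using 1
  ext a; simp
theorem Reg.prod {ι : Type*} (s : Finset ι) {f : ι → α → F} (hf : ∀ i ∈ s, Reg (f i)) :
    Reg (fun a => ∏ i ∈ s, f i a) := by
  have := Subalgebra.prod_mem (AV.R (F := F) (α := α)) (t := s) (f := f) hf
  have h2 : ∀ g : α → F, g ∈ (AV.R (F := F) (α := α)) → Reg g := fun _ h => h
  convert h2 _ this using 1
  ext a; simp

theorem Reg.mvPoly {σ : Type*} {y : σ → α → F} (hy : ∀ i, Reg (y i)) (P : MvPolynomial σ F) :
    Reg (fun a => MvPolynomial.eval (fun i => y i a) P) := by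
  induction P using MvPolynomial.induction_on with
  | C c => simpa using Reg.const c
  | add p q hp hq => simpa using hp.add hq
  | mul_X p i hp => simpa using hp.mul (hy i)

theorem Reg.matMul {l m o : Type*} [Fintype m] {A : α → Matrix l m F} {B : α → Matrix m o F}
    (hA : ∀ i j, Reg (fun a => A a i j)) (hB : ∀ i j, Reg (fun a => B a i j)) :
    ∀ i j, Reg (fun a => (A a * B a) i j) := by
  intro i j
  simp only [Matrix.mul_apply]
  exact Reg.sum _ fun k _ => (hA i k).mul (hB k j)

theorem Reg.det {m : Type*} [Fintype m] [DecidableEq m] {A : α → Matrix m m F}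
    (hA : ∀ i j, Reg (fun a => A a i j)) : Reg (fun a => (A a).det) := by
  simp only [Matrix.det_apply']
  exact Reg.sum _ fun σ _ => (Reg.const _).mul (Reg.prod _ fun i _ => hA _ _)

/-- Evaluation at a point. -/
def evAt (a : α) : (AV.R (F := F) (α := α)) →ₐ[F] F :=
  (Pi.evalAlgHom F (fun _ : α => F) a).comp (AV.R (F := F) (α := α)).val

@[simp] theorem evAt_apply (a : α) (f : AV.R (F := F) (α := α)) : evAt a f = f.1 a := rfl

instance : IsNoetherianRing (AV.R (F := F) (α := α)) :=
  let _ : Algebra.FiniteType F (AV.R (F := F) (α := α)) := ⟨(AV.R (F := F) (α := α)).fg_top.2 AV.fg⟩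
  Algebra.FiniteType.isNoetherianRing F _

/-- The point of the prime spectrum. -/
def toSpec (a : α) : PrimeSpectrum (AV.R (F := F) (α := α)) :=
  ⟨RingHom.ker (evAt a), RingHom.ker_isPrime _⟩

/-- The Zariski topology. -/
instance zariski : TopologicalSpace α :=
  TopologicalSpace.induced (toSpec (F := F) (α := α)) inferInstance

instance : TopologicalSpace.NoetherianSpace α :=
  Topology.IsInducing.noetherianSpace (i := toSpec (F := F) (α := α)) ⟨rfl⟩

theorem isClosed_iff {S : Set α} :
    IsClosed S ↔ ∀ a, a ∉ S → ∃ f : α → F, Reg f ∧ (∀ x ∈ S, f x = 0) ∧ f a ≠ 0 := by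
  constructor
  · intro h a ha
    obtain ⟨T, hT, rfl⟩ := isClosed_induced_iff.1 h
    obtain ⟨s, rfl⟩ := (PrimeSpectrum.isClosed_iff_zeroLocus _).1 hT
    simp only [Set.mem_preimage, PrimeSpectrum.mem_zeroLocus, Set.not_subset] at ha
    obtain ⟨f, hf, hfa⟩ := ha
    refine ⟨f.1, f.2, ?_, ?_⟩
    · intro x hx
      have := hx hf
      simpa [toSpec, RingHom.mem_ker] using this
    · simpa [toSpec, RingHom.mem_ker] using hfa
  · intro h
    refine isClosed_induced_iff.2 ⟨PrimeSpectrum.zeroLocus {f | ∀ x ∈ S, f.1 x = 0},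
      PrimeSpectrum.isClosed_zeroLocus _, ?_⟩
    ext a
    constructor
    · intro ha
      by_contra hS
      obtain ⟨f, hf, hfS, hfa⟩ := h a hS
      exact hfa (by simpa [toSpec, RingHom.mem_ker] using ha (show (⟨f, hf⟩ : AV.R (F := F) (α := α)) ∈ _ from hfS))
    · intro ha f hf
      simpa [toSpec, RingHom.mem_ker] using hf a ha

theorem isClosed_zero {f : α → F} (hf : Reg f) : IsClosed {a | f a = 0} :=
  isClosed_iff.2 fun _ ha => ⟨f, hf, fun _ h => h, ha⟩

theorem isClosed_eq' {f g : α → F} (hf : Reg f) (hg : Reg g) : IsClosed {a | f a = g a} := by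
  have := isClosed_zero (hf.sub hg)
  simpa [sub_eq_zero] using this

theorem isOpen_ne {f : α → F} (hf : Reg f) : IsOpen {a | f a ≠ 0} :=
  (isClosed_zero hf).isOpen_compl

theorem vanish_closure {S : Set α} {f : α → F} (hf : Reg f) (h : ∀ x ∈ S, f x = 0) :
    ∀ x ∈ closure S, f x = 0 := fun _ hx =>
  closure_minimal (s := S) (t := {a | f a = 0}) h (isClosed_zero hf) hx

theorem mem_closure_of_vanish {S : Set α} {a : α}
    (h : ∀ f : α → F, Reg f → (∀ x ∈ S, f x = 0) → f a = 0) : a ∈ closure S := by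
  by_contra ha
  obtain ⟨f, hf, hS, hfa⟩ := isClosed_iff.1 (isClosed_closure (s := S)) a ha
  exact hfa (h f hf fun x hx => hS x (subset_closure hx))

/-- Basic open sets. -/
theorem exists_basic {U : Set α} (hU : IsOpen U) {a : α} (ha : a ∈ U) :
    ∃ f : α → F, Reg f ∧ f a ≠ 0 ∧ ∀ x, f x ≠ 0 → x ∈ U := by
  obtain ⟨f, hf, hS, hfa⟩ := isClosed_iff.1 hU.isClosed_compl a (by simpa using ha)
  exact ⟨f, hf, hfa, fun x hx => by by_contra h; exact hx (hS x h)⟩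

theorem irr_iff {S : Set α} : IsIrreducible S ↔ S.Nonempty ∧ ∀ f g : α → F, Reg f → Reg g →
    (∀ x ∈ S, f x * g x = 0) → (∀ x ∈ S, f x = 0) ∨ (∀ x ∈ S, g x = 0) := by
  constructor
  · rintro ⟨h1, h2⟩
    refine ⟨h1, fun f g hf hg h => ?_⟩
    by_contra! hc
    obtain ⟨⟨x, hx, hfx⟩, ⟨y, hy, hgy⟩⟩ := hc
    obtain ⟨z, hz, hz1, hz2⟩ := h2 _ _ (isOpen_ne hf) (isOpen_ne hg) ⟨x, hx, hfx⟩ ⟨y, hy, hgy⟩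
    exact mul_ne_zero hz1 hz2 (h z hz)
  · rintro ⟨h1, h2⟩
    refine ⟨h1, ?_⟩
    rintro U V hU hV ⟨x, hx, hxU⟩ ⟨y, hy, hyV⟩
    obtain ⟨f, hf, hfx, hfU⟩ := exists_basic hU hxU
    obtain ⟨g, hg, hgy, hgV⟩ := exists_basic hV hyV
    by_contra hc
    rcases h2 f g hf hg (fun z hz => by
      by_contra hn
      exact hc ⟨z, hz, hfU z (left_ne_zero_of_mul hn), hgV z (right_ne_zero_of_mul hn)⟩) with h | h
    · exact hfx (h x hx)
    · exact hgy (h y hy)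

/-- Irreducible sets lie in one member of any finite closed cover. -/
theorem irr_cover {S : Set α} (hS : IsIrreducible S) {ι : Type*} [Finite ι] {Z : ι → Set α}
    (hZ : ∀ i, IsClosed (Z i)) (h : ∀ x ∈ S, ∃ i, x ∈ Z i) : ∃ i, S ⊆ Z i := by
  classical
  cases nonempty_fintype ι
  obtain ⟨z, hz, hzS⟩ := isIrreducible_iff_sUnion_isClosed.1 hS (Finset.univ.image Z)
    (by simpa using hZ) (by
      intro x hx
      obtain ⟨i, hi⟩ := h x hx
      exact ⟨Z i, by simp, hi⟩)
  obtain ⟨i, -, rfl⟩ := Finset.mem_image.1 hz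
  exact ⟨i, hzS⟩

/-- Maps which are regular on a set. -/
def RegOn (S : Set α) (φ : α → β) : Prop :=
  ∀ f : β → F, Reg f → ∃ g : α → F, Reg g ∧ ∀ x ∈ S, f (φ x) = g x

/-- Globally regular maps. -/
def RegMap (φ : α → β) : Prop := ∀ f : β → F, Reg f → Reg (fun a => f (φ a))

theorem RegMap.regOn {φ : α → β} (h : RegMap φ) (S : Set α) : RegOn S φ :=
  fun f hf => ⟨_, h f hf, fun _ _ => rfl⟩

theorem RegMap.comp {ψ : β → γ} {φ : α → β} (h : RegMap ψ) (h' : RegMap φ) :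
    RegMap (fun a => ψ (φ a)) := fun f hf => h' _ (h f hf)

theorem RegMap.id : RegMap (fun a : α => a) := fun _ hf => hf

theorem RegMap.continuous {φ : α → β} (h : RegMap φ) : Continuous φ := by
  rw [continuous_iff_isClosed]
  intro s hs
  rw [isClosed_iff] at hs ⊢
  intro a ha
  obtain ⟨f, hf, h1, h2⟩ := hs (φ a) ha
  exact ⟨_, h f hf, fun x hx => h1 _ hx, h2⟩

theorem RegOn.irr_image {S : Set α} {φ : α → β} (h : RegOn S φ) (hS : IsIrreducible S) :
    IsIrreducible (φ '' S) := by
  rw [irr_iff] at hS ⊢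
  refine ⟨hS.1.image _, fun f g hf hg hfg => ?_⟩
  obtain ⟨f', hf', hff'⟩ := h f hf
  obtain ⟨g', hg', hgg'⟩ := h g hg
  rcases hS.2 f' g' hf' hg' (fun x hx => by
    rw [← hff' x hx, ← hgg' x hx]; exact hfg _ ⟨x, hx, rfl⟩) with h | h
  · left; rintro _ ⟨x, hx, rfl⟩; rw [hff' x hx, h x hx]
  · right; rintro _ ⟨x, hx, rfl⟩; rw [hgg' x hx, h x hx]

/-- If the generators pull back to regular functions, the map is regular on `S`. -/
theorem RegOn.of_gens {S : Set α} {φ : α → β} {X : Set (β → F)}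
    (hX : AV.R (F := F) (α := β) = Algebra.adjoin F X)
    (h : ∀ f ∈ X, ∃ g : α → F, Reg g ∧ ∀ x ∈ S, f (φ x) = g x) : RegOn S φ := by
  intro f hf
  unfold Reg at hf
  rw [hX] at hf
  induction hf using Algebra.adjoin_induction with
  | mem f hf => exact h f hf
  | algebraMap c => exact ⟨_, Reg.const c, fun _ _ => rfl⟩
  | add f g _ _ hf hg =>
    obtain ⟨f', h1, h2⟩ := hf
    obtain ⟨g', h3, h4⟩ := hg
    exact ⟨_, h1.add h3, fun x hx => by simp [h2 x hx, h4 x hx]⟩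
  | mul f g _ _ hf hg =>
    obtain ⟨f', h1, h2⟩ := hf
    obtain ⟨g', h3, h4⟩ := hg
    exact ⟨_, h1.mul h3, fun x hx => by simp [h2 x hx, h4 x hx]⟩

theorem RegMap.of_gens {φ : α → β} {X : Set (β → F)}
    (hX : AV.R (F := F) (α := β) = Algebra.adjoin F X)
    (h : ∀ f ∈ X, Reg (fun a => f (φ a))) : RegMap φ := by
  intro f hf
  obtain ⟨g, hg, hfg⟩ := RegOn.of_gens (S := Set.univ) (φ := φ) hX
    (fun f hf => ⟨_, h f hf, fun _ _ => rfl⟩) f hf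
  convert hg using 1
  ext x; exact hfg x trivial

end basic

section instances
variable {F : Type u} [Field F]

/-- Constructor for varieties from finitely many coordinate functions. -/
theorem ev_of_gens {α : Type u} {X : Set (α → F)}
    (h : ∀ φ : Algebra.adjoin F X →ₐ[F] F, ∃ a : α, ∀ f (hf : f ∈ X),
      φ ⟨f, Algebra.subset_adjoin hf⟩ = f a) :
    ∀ φ : Algebra.adjoin F X →ₐ[F] F, ∃ a : α, ∀ f, φ f = f.1 a := by
  intro φ
  obtain ⟨a, ha⟩ := h φ
  refine ⟨a, ?_⟩
  rintro ⟨f, hf⟩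
  induction hf using Algebra.adjoin_induction with
  | mem f hf => exact ha f hf
  | algebraMap c => exact φ.commutes c
  | add f g hf hg h1 h2 => 
    have := map_add φ ⟨f, hf⟩ ⟨g, hg⟩
    rw [h1, h2] at this; exact this
  | mul f g hf hg h1 h2 => 
    have := map_mul φ ⟨f, hf⟩ ⟨g, hg⟩
    rw [h1, h2] at this; exact this

/-- Affine space. -/
instance avPi {κ : Type} [Finite κ] : AV F (κ → F) where
  R := Algebra.adjoin F (Set.range fun (i : κ) (v : κ → F) => v i)
  fg := Subalgebra.fg_def.2 ⟨_, Set.finite_range _, rfl⟩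
  ev := ev_of_gens fun φ =>
    ⟨fun i => φ ⟨fun v => v i, Algebra.subset_adjoin ⟨i, rfl⟩⟩, by rintro _ ⟨i, rfl⟩; rfl⟩
  sep := fun _ _ h => funext fun i => h _ (Algebra.subset_adjoin ⟨i, rfl⟩)

theorem reg_coord {κ : Type} [Finite κ] (i : κ) : Reg (fun v : κ → F => v i) :=
  Algebra.subset_adjoin ⟨i, rfl⟩

theorem RegOn.pi {α : Type u} [AV F α] {κ : Type} [Finite κ] {S : Set α} {φ : α → κ → F}
    (h : ∀ i, ∃ g : α → F, Reg g ∧ ∀ x ∈ S, φ x i = g x) : RegOn S φ :=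
  RegOn.of_gens rfl (by rintro _ ⟨i, rfl⟩; exact h i)

theorem RegMap.pi {α : Type u} [AV F α] {κ : Type} [Finite κ] {φ : α → κ → F}
    (h : ∀ i, Reg (fun a => φ a i)) : RegMap φ :=
  RegMap.of_gens rfl (by rintro _ ⟨i, rfl⟩; exact h i)

theorem reg_iff_poly {κ : Type} [Finite κ] {f : (κ → F) → F} :
    Reg f ↔ ∃ P : MvPolynomial κ F, ∀ v, f v = MvPolynomial.eval v P := by
  constructor
  · intro hf
    change f ∈ Algebra.adjoin F _ at hf
    induction hf using Algebra.adjoin_induction with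
    | mem f hf => obtain ⟨i, rfl⟩ := hf; exact ⟨MvPolynomial.X i, by simp⟩
    | algebraMap c => exact ⟨MvPolynomial.C c, by simp⟩
    | add f g _ _ hf hg =>
      obtain ⟨P, hP⟩ := hf
      obtain ⟨Q, hQ⟩ := hg
      exact ⟨P + Q, by simp [hP, hQ]⟩
    | mul f g _ _ hf hg =>
      obtain ⟨P, hP⟩ := hf
      obtain ⟨Q, hQ⟩ := hg
      exact ⟨P * Q, by simp [hP, hQ]⟩
  · rintro ⟨P, hP⟩
    have := Reg.mvPoly (α := κ → F) (y := fun i v => v i) reg_coord P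
    convert this using 1
    ext v; exact hP v

/-- Coordinate functions on `GL_n`: the entries of `g` and of the inverse of `g`. -/
def glCoord {n : ℕ} : (Fin n × Fin n) ⊕ (Fin n × Fin n) → GL (Fin n) F → F
  | .inl q, g => (g : Matrix (Fin n) (Fin n) F) q.1 q.2
  | .inr q, g => ((g⁻¹ : GL (Fin n) F) : Matrix (Fin n) (Fin n) F) q.1 q.2

instance avGL {n : ℕ} : AV F (GL (Fin n) F) where
  R := Algebra.adjoin F (Set.range glCoord)
  fg := Subalgebra.fg_def.2 ⟨_, Set.finite_range _, rfl⟩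
  ev := by
    apply ev_of_gens
    intro φ
    let x : (Fin n × Fin n) ⊕ (Fin n × Fin n) → Algebra.adjoin F (Set.range (glCoord (F := F) (n := n))) :=
      fun q => ⟨glCoord q, Algebra.subset_adjoin ⟨q, rfl⟩⟩
    let A : Matrix (Fin n) (Fin n) F := fun i j => φ (x (.inl (i, j)))
    let B : Matrix (Fin n) (Fin n) F := fun i j => φ (x (.inr (i, j)))
    have key : ∀ i j, ∑ k, x (.inl (i, k)) * x (.inr (k, j)) =
        algebraMap F _ ((1 : Matrix (Fin n) (Fin n) F) i j) := by
      intro i j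
      apply Subtype.ext
      ext g
      have : ((g : Matrix (Fin n) (Fin n) F) * ((g⁻¹ : GL (Fin n) F) : Matrix (Fin n) (Fin n) F)) i j
        = (1 : Matrix (Fin n) (Fin n) F) i j := by rw [← Units.val_mul, mul_inv_cancel]; rfl
      rw [Matrix.mul_apply] at this
      simpa [x, glCoord] using this
    have hAB : A * B = 1 := by
      ext i j
      rw [Matrix.mul_apply]
      have := congrArg φ (key i j)
      rw [map_sum, AlgHom.commutes] at this
      simpa [A, B] using this
    refine ⟨⟨A, B, hAB, mul_eq_one_comm.1 hAB⟩, ?_⟩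
    rintro _ ⟨(⟨i, j⟩ | ⟨i, j⟩), rfl⟩
    · rfl
    · rfl
  sep := fun _ _ h => Units.ext (Matrix.ext fun i j =>
    h _ (Algebra.subset_adjoin ⟨.inl (i, j), rfl⟩))

variable {n : ℕ}

theorem reg_entry (i j : Fin n) : Reg (fun g : GL (Fin n) F => (g : Matrix (Fin n) (Fin n) F) i j) :=
  Algebra.subset_adjoin ⟨.inl (i, j), rfl⟩

theorem reg_inv_entry (i j : Fin n) :
    Reg (fun g : GL (Fin n) F => ((g⁻¹ : GL (Fin n) F) : Matrix (Fin n) (Fin n) F) i j) :=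
  Algebra.subset_adjoin ⟨.inr (i, j), rfl⟩

theorem RegOn.gl {α : Type u} [AV F α] {S : Set α} {φ : α → GL (Fin n) F}
    (h : ∀ i j, ∃ g : α → F, Reg g ∧ ∀ x ∈ S, (φ x : Matrix (Fin n) (Fin n) F) i j = g x)
    (h' : ∀ i j, ∃ g : α → F, Reg g ∧
      ∀ x ∈ S, (((φ x)⁻¹ : GL (Fin n) F) : Matrix (Fin n) (Fin n) F) i j = g x) : RegOn S φ :=
  RegOn.of_gens rfl (by
    rintro _ ⟨(⟨i, j⟩ | ⟨i, j⟩), rfl⟩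
    · exact h i j
    · exact h' i j)

theorem RegMap.gl {α : Type u} [AV F α] {φ : α → GL (Fin n) F}
    (h : ∀ i j, Reg (fun x => (φ x : Matrix (Fin n) (Fin n) F) i j))
    (h' : ∀ i j, Reg (fun x => (((φ x)⁻¹ : GL (Fin n) F) : Matrix (Fin n) (Fin n) F) i j)) :
    RegMap φ :=
  RegMap.of_gens rfl (by
    rintro _ ⟨(⟨i, j⟩ | ⟨i, j⟩), rfl⟩
    · exact h i j
    · exact h' i j)

theorem RegMap.entry {α : Type u} [AV F α] {φ : α → GL (Fin n) F} (h : RegMap φ) (i j : Fin n) :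
    Reg (fun x => (φ x : Matrix (Fin n) (Fin n) F) i j) := h _ (reg_entry i j)

theorem RegMap.inv_entry {α : Type u} [AV F α] {φ : α → GL (Fin n) F} (h : RegMap φ) (i j : Fin n) :
    Reg (fun x => (((φ x)⁻¹ : GL (Fin n) F) : Matrix (Fin n) (Fin n) F) i j) := h _ (reg_inv_entry i j)

theorem RegMap.mul {α : Type u} [AV F α] {φ ψ : α → GL (Fin n) F} (h : RegMap φ) (h' : RegMap ψ) :
    RegMap (fun a => φ a * ψ a) := by
  apply RegMap.gl
  · intro i j
    simp only [Units.val_mul]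
    exact Reg.matMul (fun i j => h.entry i j) (fun i j => h'.entry i j) i j
  · intro i j
    simp only [_root_.mul_inv_rev, Units.val_mul]
    exact Reg.matMul (fun i j => h'.inv_entry i j) (fun i j => h.inv_entry i j) i j

theorem RegMap.inv {α : Type u} [AV F α] {φ : α → GL (Fin n) F} (h : RegMap φ) :
    RegMap (fun a => (φ a)⁻¹) := by
  apply RegMap.gl
  · exact h.inv_entry
  · simpa using h.entry

theorem RegMap.constGL {α : Type u} [AV F α] (g : GL (Fin n) F) : RegMap (fun _ : α => g) :=
  fun _ _ => Reg.const _

/-- Products with the Zariski topology. -/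
@[ext] structure ZProd (α β : Type u) : Type u where
  fst : α
  snd : β

instance avProd {α β : Type u} [AV F α] [AV F β] : AV F (ZProd α β) where
  R := Algebra.adjoin F ({f | ∃ g : α → F, Reg g ∧ f = fun x => g x.fst} ∪
    {f | ∃ g : β → F, Reg g ∧ f = fun x => g x.snd})
  fg := by
    let p1 : (α → F) →ₐ[F] (ZProd α β → F) :=
      { toFun := fun g x => g x.fst, map_one' := rfl, map_mul' := fun _ _ => rfl,
        map_zero' := rfl, map_add' := fun _ _ => rfl, commutes' := fun _ => rfl }
    let p2 : (β → F) →ₐ[F] (ZProd α β → F) :=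
      { toFun := fun g x => g x.snd, map_one' := rfl, map_mul' := fun _ _ => rfl,
        map_zero' := rfl, map_add' := fun _ _ => rfl, commutes' := fun _ => rfl }
    have h1 : Algebra.adjoin F ({f | ∃ g : α → F, Reg g ∧ f = fun x : ZProd α β => g x.fst} ∪
      {f | ∃ g : β → F, Reg g ∧ f = fun x => g x.snd}) =
      (AV.R (F := F) (α := α)).map p1 ⊔ (AV.R (F := F) (α := β)).map p2 := by
      rw [Algebra.adjoin_union]
      congr 1
      · rw [← Algebra.adjoin_eq ((AV.R (F := F) (α := α)).map p1)]
        congr 1; ext f; constructor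
        · rintro ⟨g, hg, rfl⟩; exact ⟨g, hg, rfl⟩
        · rintro ⟨g, hg, rfl⟩; exact ⟨g, hg, rfl⟩
      · rw [← Algebra.adjoin_eq ((AV.R (F := F) (α := β)).map p2)]
        congr 1; ext f; constructor
        · rintro ⟨g, hg, rfl⟩; exact ⟨g, hg, rfl⟩
        · rintro ⟨g, hg, rfl⟩; exact ⟨g, hg, rfl⟩
    rw [h1]
    exact (AV.fg.map p1).sup (AV.fg.map p2)
  ev := by
    apply ev_of_gens
    intro φ
    obtain ⟨a, ha⟩ := AV.ev (α := α) (F := F) (φ.comp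
      { toFun := fun g => ⟨fun x => g.1 x.fst, Algebra.subset_adjoin (Or.inl ⟨g.1, g.2, rfl⟩)⟩,
        map_one' := rfl, map_mul' := fun _ _ => rfl,
        map_zero' := rfl, map_add' := fun _ _ => rfl, commutes' := fun _ => rfl })
    obtain ⟨b, hb⟩ := AV.ev (α := β) (F := F) (φ.comp
      { toFun := fun g => ⟨fun x => g.1 x.snd, Algebra.subset_adjoin (Or.inr ⟨g.1, g.2, rfl⟩)⟩,
        map_one' := rfl, map_mul' := fun _ _ => rfl,
        map_zero' := rfl, map_add' := fun _ _ => rfl, commutes' := fun _ => rfl })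
    refine ⟨⟨a, b⟩, ?_⟩
    rintro f (⟨g, hg, rfl⟩ | ⟨g, hg, rfl⟩)
    · exact ha ⟨g, hg⟩
    · exact hb ⟨g, hg⟩
  sep := fun x y h => ZProd.ext
    (AV.sep _ _ fun f hf => h _ (Algebra.subset_adjoin (Or.inl ⟨f, hf, rfl⟩)))
    (AV.sep _ _ fun f hf => h _ (Algebra.subset_adjoin (Or.inr ⟨f, hf, rfl⟩)))

variable {α β γ : Type u} [AV F α] [AV F β] [AV F γ]

theorem regMap_fst : RegMap (fun x : ZProd α β => x.fst) := fun f hf =>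
  Algebra.subset_adjoin (Or.inl ⟨f, hf, rfl⟩)
theorem regMap_snd : RegMap (fun x : ZProd α β => x.snd) := fun f hf =>
  Algebra.subset_adjoin (Or.inr ⟨f, hf, rfl⟩)

theorem RegMap.mk {φ : γ → α} {ψ : γ → β} (h : RegMap φ) (h' : RegMap ψ) :
    RegMap (fun c => (⟨φ c, ψ c⟩ : ZProd α β)) :=
  RegMap.of_gens rfl (by
    rintro _ (⟨f, hf, rfl⟩ | ⟨f, hf, rfl⟩)
    · exact h f hf
    · exact h' f hf)

theorem RegMap.const (a : α) : RegMap (fun _ : β => a) := fun _ _ => Reg.const _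

/-- Product sets. -/
def zprod (S : Set α) (S' : Set β) : Set (ZProd α β) := {x | x.fst ∈ S ∧ x.snd ∈ S'}

theorem zprod_irr {S : Set α} {S' : Set β} (h : IsIrreducible S) (h' : IsIrreducible S') :
    IsIrreducible (zprod S S') := by
  rw [irr_iff] at h h' ⊢
  obtain ⟨⟨a, ha⟩, h⟩ := h
  obtain ⟨⟨b, hb⟩, h'⟩ := h'
  refine ⟨⟨⟨a, b⟩, ha, hb⟩, fun f g hf hg hfg => ?_⟩
  by_contra! hc
  obtain ⟨⟨x, hx, hfx⟩, ⟨y, hy, hgy⟩⟩ := hc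
  -- slices
  have s1 : ∀ (f : ZProd α β → F) (b : β), Reg f → Reg (fun a => f ⟨a, b⟩) := fun f b hf =>
    (RegMap.mk RegMap.id (RegMap.const b)) f hf
  have s2 : ∀ (f : ZProd α β → F) (a : α), Reg f → Reg (fun b => f ⟨a, b⟩) := fun f b hf =>
    (RegMap.mk (RegMap.const b) RegMap.id) f hf
  -- there is s with f (s, x2) ≠ 0 and g (s, y2) ≠ 0
  have : ∃ s ∈ S, f ⟨s, x.snd⟩ ≠ 0 ∧ g ⟨s, y.snd⟩ ≠ 0 := by
    by_contra! hcon
    rcases h _ _ (s1 f x.snd hf) (s1 g y.snd hg) (fun s hs => by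
      by_cases h0 : f ⟨s, x.snd⟩ = 0
      · simp [h0]
      · simp [hcon s hs h0]) with h1 | h1
    · exact hfx (h1 _ hx.1)
    · exact hgy (h1 _ hy.1)
  obtain ⟨s, hs, h1, h2⟩ := this
  rcases h' _ _ (s2 f s hf) (s2 g s hg) (fun t ht => hfg ⟨s, t⟩ ⟨hs, ht⟩) with h3 | h3
  · exact h1 (h3 _ hx.2)
  · exact h2 (h3 _ hy.2)

theorem zprod_closed {S : Set α} {S' : Set β} (h : IsClosed S) (h' : IsClosed S') :
    IsClosed (zprod S S') :=
  (h.preimage regMap_fst.continuous).inter (h'.preimage regMap_snd.continuous)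

end instances

end DPD

namespace DPD

universe u

/-- Extension of homomorphisms to an algebraic finitely generated extension, away from a
nonzero element. -/
theorem ext_hom {F : Type*} [Field F] [IsAlgClosed F] {A B : Type*} [CommRing A] [IsDomain A]
    [CommRing B] [IsDomain B] [Algebra A B] (hinj : Function.Injective (algebraMap A B))
    [halg : Algebra.IsAlgebraic A B] [hfin : Algebra.FiniteType A B] (h : B) (hh : h ≠ 0) :
    ∃ q : A, q ≠ 0 ∧ ∀ ψ : A →+* F, Function.Surjective ψ → ψ q ≠ 0 →
      ∃ ψ' : B →+* F, (∀ a, ψ' (algebraMap A B a) = ψ a) ∧ ψ' h ≠ 0 := by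
  obtain ⟨s, hs⟩ := hfin.out
  obtain ⟨y, hy0, hy⟩ := Algebra.IsAlgebraic.exists_integral_multiples A s
  obtain ⟨r, hr0, b', hb'⟩ := (halg.isAlgebraic h).exists_nonzero_dvd
    (mem_nonZeroDivisors_of_ne_zero hh)
  refine ⟨r * y, mul_ne_zero hr0 hy0, ?_⟩
  intro ψ hψ hq
  rw [map_mul] at hq
  have hψr := left_ne_zero_of_mul hq
  have hψy := right_ne_zero_of_mul hq
  let B0 := integralClosure A B
  have hB0 : ∀ b : B, ∃ N : ℕ, (algebraMap A B y) ^ N * b ∈ B0 := by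
    intro b
    have hb : b ∈ Algebra.adjoin A (s : Set B) := by rw [hs]; trivial
    have hyB : algebraMap A B y ∈ B0 := Subalgebra.algebraMap_mem _ _
    induction hb using Algebra.adjoin_induction with
    | mem x hx => refine ⟨1, ?_⟩; rw [pow_one, ← Algebra.smul_def]; exact hy x hx
    | algebraMap c => exact ⟨0, by simp⟩
    | add x z _ _ hx hz =>
      obtain ⟨N, hN⟩ := hx
      obtain ⟨M, hM⟩ := hz
      refine ⟨N + M, ?_⟩
      have := B0.add_mem (B0.mul_mem (B0.pow_mem hyB M) hN) (B0.mul_mem (B0.pow_mem hyB N) hM)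
      convert this using 1; ring
    | mul x z _ _ hx hz =>
      obtain ⟨N, hN⟩ := hx
      obtain ⟨M, hM⟩ := hz
      refine ⟨N + M, ?_⟩
      have := B0.mul_mem hN hM
      convert this using 1; ring
  have hmax : (RingHom.ker ψ).IsMaximal := RingHom.ker_isMaximal_of_surjective ψ hψ
  have hint : Algebra.IsIntegral A B0 := integralClosure.AlgebraIsIntegral
  have hinj0 : Function.Injective (algebraMap A B0) := by
    intro a a' h
    exact hinj (congrArg Subtype.val h)
  obtain ⟨Q, hQ, hQA⟩ := Ideal.exists_ideal_over_maximal_of_isIntegral (S := B0) (RingHom.ker ψ)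
    (by rw [(RingHom.injective_iff_ker_eq_bot _).1 hinj0]; exact bot_le)
  -- F maps isomorphically to B0 / Q
  let e : A ⧸ RingHom.ker ψ ≃+* F := RingHom.quotientKerEquivOfSurjective hψ
  let κ : F →+* B0 ⧸ Q := (Ideal.quotientMap Q (algebraMap A B0) hQA.ge).comp e.symm.toRingHom
  have hκ : ∀ a : A, κ (ψ a) = Ideal.Quotient.mk Q (algebraMap A B0 a) := by
    intro a
    have : e.symm (ψ a) = Ideal.Quotient.mk _ a := by
      rw [RingEquiv.symm_apply_eq]
      rfl
    change Ideal.quotientMap Q (algebraMap A B0) hQA.ge (e.symm (ψ a)) = _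
    rw [this, Ideal.quotientMap_mk]
  have hκint : κ.IsIntegral := by
    intro x
    obtain ⟨x, rfl⟩ := Ideal.Quotient.mk_surjective x
    obtain ⟨p, hp, hpx⟩ := hint.isIntegral x
    refine ⟨p.map ψ, hp.map ψ, ?_⟩
    rw [Polynomial.eval₂_map]
    have : κ.comp ψ = (Ideal.Quotient.mk Q).comp (algebraMap A B0) := by
      ext a; exact hκ a
    rw [this, ← Polynomial.hom_eval₂, hpx, map_zero]
  have hQp : Q.IsPrime := hQ.isPrime
  have hbij := IsAlgClosed.ringHom_bijective_of_isIntegral κ hκint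
  let κe := RingEquiv.ofBijective κ hbij
  let ψ0 : B0 →+* F := κe.symm.toRingHom.comp (Ideal.Quotient.mk Q)
  have hψ0 : ∀ a, ψ0 (algebraMap A B0 a) = ψ a := by
    intro a
    change κe.symm (Ideal.Quotient.mk Q (algebraMap A B0 a)) = ψ a
    rw [← hκ a]
    exact κe.symm_apply_apply (ψ a)
  -- localize
  let M := Localization.Away (algebraMap A B y)
  letI : Algebra B0 M := ((algebraMap B M).comp (algebraMap B0 B)).toAlgebra
  have hyB0 : (algebraMap A B y) ≠ 0 := fun h => hy0 (hinj (by rw [h, map_zero]))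
  have hMinj : Function.Injective (algebraMap B M) :=
    IsLocalization.injective M (powers_le_nonZeroDivisors_of_noZeroDivisors hyB0)
  have hloc : IsLocalization.Away (algebraMap A B0 y) M := by
    apply IsLocalization.Away.mk
    · exact IsLocalization.Away.algebraMap_isUnit (S := M) (algebraMap A B y)
    · intro m
      obtain ⟨k, b, hb⟩ := IsLocalization.Away.surj (algebraMap A B y) m
      obtain ⟨N, hN⟩ := hB0 b
      refine ⟨N + k, ⟨_, hN⟩, ?_⟩
      change m * (algebraMap B M (algebraMap A B y)) ^ (N + k) =
        algebraMap B M ((algebraMap A B y) ^ N * b)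
      rw [map_mul, ← hb, map_pow]; ring
    · intro a b hab
      refine ⟨0, ?_⟩
      rw [Subtype.ext (hMinj hab)]
  have hu : IsUnit (ψ0 (algebraMap A B0 y)) := by rw [hψ0]; exact hψy.isUnit
  let ψM : M →+* F := IsLocalization.Away.lift (algebraMap A B0 y) hu
  refine ⟨ψM.comp (algebraMap B M), ?_, ?_⟩
  · intro a
    have : ψM (algebraMap B0 M (algebraMap A B0 a)) = ψ0 (algebraMap A B0 a) :=
      IsLocalization.Away.lift_eq _ hu _
    rw [← hψ0, ← this]
    rfl
  · intro h0
    have h1 : (ψM.comp (algebraMap B M)) (algebraMap A B r) = ψ r := by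
      have : ψM (algebraMap B0 M (algebraMap A B0 r)) = ψ0 (algebraMap A B0 r) :=
        IsLocalization.Away.lift_eq _ hu _
      rw [← hψ0, ← this]
      rfl
    rw [hb', map_mul, h0, zero_mul] at h1
    exact hψr h1.symm

section dims
variable {F : Type u} [Field F] {α β : Type u} [AV F α] [AV F β]

/-- Restriction of functions. -/
def res (S : Set α) : (α → F) →ₐ[F] (S → F) where
  toFun f x := f x
  map_one' := rfl
  map_mul' _ _ := rfl
  map_zero' := rfl
  map_add' _ _ := rfl
  commutes' _ := rfl

/-- Coordinate ring of a set. -/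
def coord (S : Set α) : Subalgebra F (S → F) := (AV.R (F := F) (α := α)).map (res S)

theorem coord_domain {S : Set α} (hS : IsIrreducible S) : IsDomain (coord S) := by
  have h := irr_iff.1 hS
  haveI : Nontrivial (coord S) := by
    obtain ⟨x, hx⟩ := h.1
    refine ⟨0, 1, fun h => ?_⟩
    have := congrFun (congrArg Subtype.val h) ⟨x, hx⟩
    simp at this
  haveI : NoZeroDivisors (coord S) := by
    refine ⟨?_⟩
    rintro ⟨_, f, hf, rfl⟩ ⟨_, g, hg, rfl⟩ hfg
    have : ∀ x ∈ S, f x * g x = 0 := fun x hx =>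
      congrFun (congrArg Subtype.val hfg) ⟨x, hx⟩
    rcases h.2 f g hf hg this with h | h
    · left; apply Subtype.ext; ext x; exact h x x.2
    · right; apply Subtype.ext; ext x; exact h x x.2
  exact NoZeroDivisors.to_isDomain _

theorem coord_fg (S : Set α) : (coord S).FG := AV.fg.map _

theorem coord_ft (S : Set α) : Algebra.FiniteType F (coord S) :=
  ⟨(coord S).fg_top.2 (coord_fg S)⟩

/-- Dimension. -/
noncomputable def zdim (S : Set α) : ℕ := Cardinal.toNat (Algebra.trdeg F (coord S))

theorem aeval_coe {S : Set α} {σ : Type*} (Y : σ → coord S) (P : MvPolynomial σ F) (s : S) :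
    (MvPolynomial.aeval Y P).1 s = MvPolynomial.eval (fun i => (Y i).1 s) P := by
  induction P using MvPolynomial.induction_on with
  | C c => simp
  | add p q hp hq => simp [hp, hq]
  | mul_X p i hp => simp [hp]

theorem zdim_cast {S : Set α} (hS : IsIrreducible S) :
    (zdim S : Cardinal) = Algebra.trdeg F (coord S) := by
  haveI := coord_domain hS
  haveI := coord_ft S
  exact Cardinal.cast_toNat_of_lt_aleph0 trdeg_lt_aleph0_of_finiteType

/-- No nonzero polynomial relation on `S`. -/
def Indep (S : Set α) {σ : Type*} (y : σ → α → F) : Prop :=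
  ∀ P : MvPolynomial σ F, (∀ s ∈ S, MvPolynomial.eval (fun i => y i s) P = 0) → P = 0

theorem dim_ge {S : Set α} (hS : IsIrreducible S) {e : ℕ} {y : Fin e → α → F}
    (hy : ∀ i, Reg (y i)) (h : Indep S y) : e ≤ zdim S := by
  haveI := coord_domain hS
  let Y : ULift.{u} (Fin e) → coord S := fun i => ⟨res S (y i.down), y i.down, hy _, rfl⟩
  have hY : AlgebraicIndependent F Y := by
    have h1 : AlgebraicIndependent F (fun i : Fin e => Y ⟨i⟩) := by
      rw [algebraicIndependent_iff]
      intro P hP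
      apply h P
      intro s hs
      have := aeval_coe (fun i : Fin e => Y ⟨i⟩) P ⟨s, hs⟩
      rw [hP] at this
      exact this.symm
    exact h1.comp ULift.down ULift.down_injective
  have := hY.cardinalMk_le_trdeg
  rw [← zdim_cast hS] at this
  simpa using this

theorem exists_indep {S : Set α} (hS : IsIrreducible S) :
    ∃ y : Fin (zdim S) → α → F, (∀ i, Reg (y i)) ∧ Indep S y := by
  haveI := coord_domain hS
  haveI : FaithfulSMul F (coord S) :=
    (faithfulSMul_iff_algebraMap_injective F (coord S)).2 (algebraMap F (coord S)).injective
  obtain ⟨ι, x, hx⟩ := exists_isTranscendenceBasis' F (coord S)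
  have hc := hx.cardinalMk_eq_trdeg
  rw [← zdim_cast hS] at hc
  have hfin : Finite ι := by
    rw [← Cardinal.lt_aleph0_iff_finite, hc]; exact Cardinal.natCast_lt_aleph0
  cases nonempty_fintype ι
  have hcard : Fintype.card ι = zdim S := by
    rw [Cardinal.mk_fintype] at hc; exact_mod_cast hc
  let e : Fin (zdim S) ≃ ι := (Fintype.equivFinOfCardEq hcard).symm
  choose f hf hfx using fun i => (x i).2
  refine ⟨fun i => f (e i), fun i => hf _, ?_⟩
  intro P hP
  have := (hx.1.comp e e.injective)
  rw [algebraicIndependent_iff] at this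
  apply this
  apply Subtype.ext
  ext s
  rw [aeval_coe]
  rw [show (fun i => ((x ∘ e) i).1 s) = fun i => f (e i) s from ?_]
  · exact hP s s.2
  · ext i; simp only [Function.comp]; rw [← hfx]; rfl

theorem eval_bind {σ τ : Type*} (b : τ → F) (g : σ → MvPolynomial τ F) (P : MvPolynomial σ F) :
    MvPolynomial.eval b (MvPolynomial.bind₁ g P) =
      MvPolynomial.eval (fun i => MvPolynomial.eval b (g i)) P := by
  induction P using MvPolynomial.induction_on with
  | C c => simp
  | add p q hp hq => simp [hp, hq]
  | mul_X p i hp => simp [hp]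

theorem dim_prod [Infinite F] {S : Set α} {S' : Set β} (hS : IsIrreducible S)
    (hS' : IsIrreducible S') : zdim S + zdim S' ≤ zdim (zprod S S') := by
  obtain ⟨y, hy, hyi⟩ := exists_indep hS
  obtain ⟨y', hy', hyi'⟩ := exists_indep hS'
  apply dim_ge (zprod_irr hS hS')
    (y := Fin.append (fun i x => y i x.fst) (fun i x => y' i x.snd))
  · intro i
    refine Fin.addCases (fun i => ?_) (fun i => ?_) i
    · simpa using regMap_fst _ (hy i)
    · simpa using regMap_snd _ (hy' i)
  · intro P hP
    by_contra hP0
    have h1 : ∃ a, MvPolynomial.eval a P ≠ 0 := by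
      by_contra! hc
      exact hP0 (MvPolynomial.funext fun x => by simpa using hc x)
    obtain ⟨a, ha⟩ := h1
    let a1 : Fin (zdim S) → F := fun i => a (Fin.castAdd _ i)
    let a2 : Fin (zdim S') → F := fun i => a (Fin.natAdd _ i)
    have haa : a = Fin.append a1 a2 := by
      ext i; refine Fin.addCases (fun i => ?_) (fun i => ?_) i <;> simp [a1, a2]
    let P1 : MvPolynomial (Fin (zdim S)) F :=
      MvPolynomial.bind₁ (Fin.append MvPolynomial.X (fun i => MvPolynomial.C (a2 i))) P
    have hP1 : ∀ b, MvPolynomial.eval b P1 = MvPolynomial.eval (Fin.append b a2) P := by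
      intro b
      rw [eval_bind]
      congr 2
      ext i; refine Fin.addCases (fun i => ?_) (fun i => ?_) i <;> simp
    have h2 : ∃ s ∈ S, MvPolynomial.eval (fun i => y i s) P1 ≠ 0 := by
      by_contra! hc
      have := hyi P1 hc
      apply ha
      rw [haa, ← hP1, this, map_zero]
    obtain ⟨s, hs, hsP⟩ := h2
    let P2 : MvPolynomial (Fin (zdim S')) F :=
      MvPolynomial.bind₁ (Fin.append (fun i => MvPolynomial.C (y i s)) MvPolynomial.X) P
    have hP2 : ∀ b, MvPolynomial.eval b P2 = MvPolynomial.eval (Fin.append (fun i => y i s) b) P := by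
      intro b
      rw [eval_bind]
      congr 2
      ext i; refine Fin.addCases (fun i => ?_) (fun i => ?_) i <;> simp
    have h3 : P2 = 0 := by
      apply hyi' P2
      intro s' hs'
      rw [hP2]
      have := hP ⟨s, s'⟩ ⟨hs, hs'⟩
      convert this using 3
      funext i; refine Fin.addCases (fun i => ?_) (fun i => ?_) i <;> simp
    rw [hP1] at hsP
    apply hsP
    rw [← hP2, h3, map_zero]

theorem dim_lt {Y Z : Set α} (hY : IsIrreducible Y) (hZ : IsIrreducible Z) (hYZ : Y ⊆ Z)
    {f : α → F} (hf : Reg f) (hfY : ∀ x ∈ Y, f x = 0) (hfZ : ∃ x ∈ Z, f x ≠ 0) :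
    zdim Y < zdim Z := by
  obtain ⟨y, hy, hyi⟩ := exists_indep hY
  have key : ∀ (d : ℕ) (Q : Polynomial (MvPolynomial (Fin (zdim Y)) F)), Q.natDegree ≤ d →
      (∀ z ∈ Z, Polynomial.eval (f z) (Q.map (MvPolynomial.eval fun i => y i z)) = 0) → Q = 0 := by
    intro d
    induction d with
    | zero =>
      intro Q hQ h
      rw [Polynomial.eq_C_of_natDegree_le_zero hQ] at h ⊢
      simp only [Polynomial.map_C, Polynomial.eval_C] at h
      rw [hyi _ fun x hx => h x (hYZ hx), map_zero]
    | succ d ih =>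
      intro Q hQ h
      have h0 : Q.coeff 0 = 0 := by
        apply hyi
        intro x hx
        have := h x (hYZ hx)
        rw [hfY x hx, ← Polynomial.coeff_zero_eq_eval_zero, Polynomial.coeff_map] at this
        exact this
      have hQX := Polynomial.divX_mul_X_add Q
      rw [h0, map_zero, add_zero] at hQX
      have h1 : Q.divX = 0 := by
        apply ih
        · rw [Polynomial.natDegree_divX_eq_natDegree_tsub_one]; omega
        · have hreg : Reg (fun z => Polynomial.eval (f z) (Q.divX.map
              (MvPolynomial.eval fun i => y i z))) := by
            have : ∀ z, Polynomial.eval (f z) (Q.divX.map (MvPolynomial.eval fun i => y i z)) =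
              ∑ i ∈ Q.divX.support, MvPolynomial.eval (fun i => y i z) (Q.divX.coeff i) * f z ^ i := by
              intro z
              rw [Polynomial.eval_map, Polynomial.eval₂_def, Polynomial.sum]
            simp only [this]
            exact Reg.sum _ fun i _ => (Reg.mvPoly hy _).mul (hf.pow _)
          rcases (irr_iff.1 hZ).2 _ f hreg hf (fun z hz => by
            have := h z hz
            rw [← hQX, Polynomial.map_mul, Polynomial.eval_mul] at this
            simpa using this) with h2 | h2
          · exact h2
          · obtain ⟨x, hx, hfx⟩ := hfZ
            exact absurd (h2 x hx) hfx
      rw [← hQX, h1, zero_mul]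
  have := dim_ge hZ (e := zdim Y + 1) (y := Fin.cons f y) (by
    intro i; refine Fin.cases ?_ (fun i => ?_) i
    · simpa using hf
    · simpa using hy i) (by
    intro P hP
    have := key _ (MvPolynomial.finSuccEquiv F _ P) le_rfl (by
      intro z hz
      rw [← MvPolynomial.eval_eq_eval_mv_eval']
      have := hP z hz
      convert this using 3
      funext i; refine Fin.cases ?_ (fun i => ?_) i <;> simp)
    exact (map_eq_zero_iff _ (MvPolynomial.finSuccEquiv F _).injective).1 this)
  omega

theorem eq_of_dim {Y Z : Set α} (hY : IsIrreducible Y) (hZ : IsIrreducible Z) (hYZ : Y ⊆ Z)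
    (h : zdim Z ≤ zdim Y) : Z ⊆ closure Y := by
  intro z hz
  apply mem_closure_of_vanish
  intro f hf hfY
  by_contra hne
  exact absurd (dim_lt hY hZ hYZ hf hfY ⟨z, hz, hne⟩) (by omega)

end dims

end DPD

namespace DPD

universe u

section algcore
open Algebra

theorem alg_core {F A B : Type u} [Field F] [IsAlgClosed F] [CommRing A] [IsDomain A]
    [CommRing B] [IsDomain B] [Algebra F A] [Algebra F B] [Algebra A B] [IsScalarTower F A B]
    [ftA : Algebra.FiniteType F A] [ftB : Algebra.FiniteType F B]
    (hinj : Function.Injective (algebraMap A B)) (h : B) (hh : h ≠ 0) :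
    ∃ (e : ℕ) (x' : Fin e → B), Algebra.trdeg F A + e = Algebra.trdeg F B ∧
      ∃ Qp : MvPolynomial (Fin e) A, Qp ≠ 0 ∧
        ∀ ez : A →+* F, Function.Surjective ez → ∀ η : Fin e → F,
          MvPolynomial.eval₂ ez η Qp ≠ 0 → ∃ ψ' : B →+* F,
            (∀ a, ψ' (algebraMap A B a) = ez a) ∧ (∀ i, ψ' (x' i) = η i) ∧ ψ' h ≠ 0 := by
  haveI f1 : FaithfulSMul A B := (faithfulSMul_iff_algebraMap_injective _ _).2 hinj
  haveI f2 : FaithfulSMul F A :=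
    (faithfulSMul_iff_algebraMap_injective _ _).2 (algebraMap F _).injective
  haveI ftAB : Algebra.FiniteType A B :=
    Algebra.FiniteType.of_restrictScalars_finiteType F _ _
  obtain ⟨ι, x, hx⟩ := exists_isTranscendenceBasis' A B
  have hcard := hx.cardinalMk_eq_trdeg
  have hlt : Algebra.trdeg A B < Cardinal.aleph0 :=
    trdeg_lt_aleph0_of_finiteType
  have hfin : Finite ι := by rw [← Cardinal.lt_aleph0_iff_finite, hcard]; exact hlt
  cases nonempty_fintype ι
  let e := Fintype.card ι
  let ε : Fin e ≃ ι := (Fintype.equivFin ι).symm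
  let x' : Fin e → B := fun i => x (ε i)
  have hx' : IsTranscendenceBasis A x' := hx.comp_equiv ε
  let A' := Algebra.adjoin A (Set.range x')
  haveI algA : Algebra.IsAlgebraic A' B := hx'.isAlgebraic
  haveI ftA' : Algebra.FiniteType A' B :=
    Algebra.FiniteType.of_restrictScalars_finiteType A A' B
  have hinj' : Function.Injective (algebraMap A' B) := Subtype.val_injective
  obtain ⟨q, hq0, hq⟩ := ext_hom (F := F) hinj' h hh
  let E := hx'.1.aevalEquiv
  let Qp := E.symm q
  have hQp : Qp ≠ 0 := by
    intro h0
    exact hq0 (by rw [← E.apply_symm_apply q]; change E Qp = 0; rw [h0, map_zero])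
  refine ⟨e, x', ?_, Qp, hQp, ?_⟩
  · have h1 := trdeg_add_eq F A (A := B)
    rw [← hcard, Cardinal.mk_fintype] at h1
    exact h1
  intro ez hez η hη
  let ψ : A' →+* F := (MvPolynomial.eval₂Hom ez η).comp E.symm.toAlgHom.toRingHom
  have hψA : ∀ a : A, ψ (algebraMap _ A' a) = ez a := by
    intro a
    change MvPolynomial.eval₂Hom ez η (E.symm (algebraMap _ A' a)) = ez a
    rw [E.symm.commutes]
    simp [MvPolynomial.algebraMap_eq]
  have hψx : ∀ i, ψ ⟨x' i, Algebra.subset_adjoin ⟨i, rfl⟩⟩ = η i := by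
    intro i
    change MvPolynomial.eval₂Hom ez η (E.symm _) = η i
    have : E.symm ⟨x' i, Algebra.subset_adjoin ⟨i, rfl⟩⟩ = MvPolynomial.X i := by
      rw [AlgEquiv.symm_apply_eq]
      apply Subtype.ext
      simp [E]
    rw [this]; simp
  have hψs : Function.Surjective ψ := fun c => by
    obtain ⟨a, ha⟩ := hez c
    exact ⟨algebraMap _ A' a, by rw [hψA, ha]⟩
  obtain ⟨ψ', hψ', hψh⟩ := hq ψ hψs hη
  refine ⟨ψ', fun a => ?_, fun i => ?_, hψh⟩
  · rw [← hψA, ← hψ']; rfl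
  · rw [← hψx i, ← hψ']; rfl

end algcore

section core
variable {F : Type u} [Field F] {α β : Type u} [AV F α] [AV F β]

/-- Evaluation of functions on `T` at a point of the closure of `T`. -/
theorem exists_evClosure {T : Set β} {z : β} (hz : z ∈ closure T) :
    ∃ ψ : coord T →+* F, ∀ (f : β → F) (hf : Reg f), ψ ⟨res T f, f, hf, rfl⟩ = f z := by
  classical
  choose rep hrep hres using fun a : coord T => a.2
  have key : ∀ (a : coord T) (f : β → F), Reg f → a.1 = res T f → rep a z = f z := by
    intro a f hf haf
    have : ∀ x ∈ T, rep a x - f x = 0 := by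
      intro x hx
      have h1 := congrFun (hres a) ⟨x, hx⟩
      have h2 := congrFun haf ⟨x, hx⟩
      rw [← h1] at h2
      exact sub_eq_zero.2 h2
    exact sub_eq_zero.1 (vanish_closure (Reg.sub (hrep a) hf) this z hz)
  refine ⟨RingHom.mk (MonoidHom.mk (OneHom.mk (fun a => rep a z) ?_) ?_) ?_ ?_, ?_⟩
  · exact key 1 (fun _ => 1) (Reg.const 1) rfl
  · intro a b
    refine key (a * b) (fun x => rep a x * rep b x) (Reg.mul (hrep a) (hrep b)) ?_
    change a.1 * b.1 = _
    rw [← hres a, ← hres b]; rfl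
  · exact key 0 (fun _ => 0) (Reg.const 0) rfl
  · intro a b
    refine key (a + b) (fun x => rep a x + rep b x) (Reg.add (hrep a) (hrep b)) ?_
    change a.1 + b.1 = _
    rw [← hres a, ← hres b]; rfl
  · intro f hf
    exact key _ f hf rfl

/-- Pullback of functions. -/
def pull {S : Set α} {φ : α → β} (hφ : RegOn S φ) : coord (φ '' S) →ₐ[F] coord S where
  toFun a := ⟨fun s => a.1 ⟨φ s, ⟨s, s.2, rfl⟩⟩, by
    obtain ⟨f, hf, hfa⟩ := a.2
    obtain ⟨g, hg, hfg⟩ := hφ f hf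
    refine ⟨g, hg, ?_⟩
    ext s
    rw [← hfa]
    exact (hfg s s.2).symm⟩
  map_one' := rfl
  map_mul' _ _ := rfl
  map_zero' := rfl
  map_add' _ _ := rfl
  commutes' _ := rfl

theorem pull_injective {S : Set α} {φ : α → β} (hφ : RegOn S φ) :
    Function.Injective (pull hφ) := by
  intro a b h
  apply Subtype.ext
  ext ⟨_, s, hs, rfl⟩
  exact congrFun (congrArg Subtype.val h) ⟨s, hs⟩

theorem core [IsAlgClosed F] {S : Set α} (hSc : IsClosed S) (hS : IsIrreducible S) {φ : α → β}
    (hφ : RegOn S φ) {h : α → F} (hh : Reg h) (hne : ∃ x ∈ S, h x ≠ 0) :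
    ∃ (e : ℕ) (y : Fin e → α → F), (∀ i, Reg (y i)) ∧ zdim S = zdim (φ '' S) + e ∧
      ∃ g : β → F, Reg g ∧ (∃ x ∈ S, g (φ x) ≠ 0) ∧
        ∀ z ∈ closure (φ '' S), g z ≠ 0 → ∃ Q : MvPolynomial (Fin e) F, Q ≠ 0 ∧
          ∀ η : Fin e → F, MvPolynomial.eval η Q ≠ 0 →
            ∃ s ∈ S, φ s = z ∧ h s ≠ 0 ∧ ∀ i, y i s = η i := by
  have dB : IsDomain (coord S) := coord_domain hS
  have hT : IsIrreducible (φ '' S) := hφ.irr_image hS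
  have dA : IsDomain (coord (φ '' S)) := coord_domain hT
  let _ : Algebra (coord (φ '' S)) (coord S) := (pull hφ).toRingHom.toAlgebra
  have hmap : ∀ a, algebraMap (coord (φ '' S)) (coord S) a = pull hφ a := fun _ => rfl
  have tow : IsScalarTower F (coord (φ '' S)) (coord S) :=
    IsScalarTower.of_algebraMap_eq fun c => rfl
  have ftB : Algebra.FiniteType F (coord S) := coord_ft S
  have ftA : Algebra.FiniteType F (coord (φ '' S)) := coord_ft _
  obtain ⟨e, x', htr, Qp, hQp, HQ⟩ := alg_core (F := F) (A := coord (φ '' S)) (B := coord S)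
    (pull_injective hφ) ⟨res S h, h, hh, rfl⟩ (by
    intro h0
    obtain ⟨x, hx, hxn⟩ := hne
    exact hxn (congrFun (congrArg Subtype.val h0) ⟨x, hx⟩))
  have hdim : zdim S = zdim (φ '' S) + e := by
    rw [← zdim_cast hS, ← zdim_cast hT] at htr
    exact_mod_cast htr.symm
  choose y hy hyx using fun i => (x' i).2
  obtain ⟨m, hm⟩ := MvPolynomial.ne_zero_iff.1 hQp
  obtain ⟨g, hg, hgm⟩ := (Qp.coeff m).2
  refine ⟨e, y, hy, hdim, g, hg, ?_, ?_⟩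
  · by_contra! hc
    apply hm
    apply Subtype.ext
    rw [← hgm]
    ext ⟨_, s, hs, rfl⟩
    exact hc s hs
  · intro z hz hgz
    obtain ⟨ez, hez⟩ := exists_evClosure hz
    refine ⟨MvPolynomial.map ez Qp, ?_, ?_⟩
    · intro h0
      have := congrArg (MvPolynomial.coeff m) h0
      rw [MvPolynomial.coeff_map, MvPolynomial.coeff_zero] at this
      apply hgz
      rw [← hez g hg, ← this]
      congr 1
      exact Subtype.ext hgm
    · intro η hη
      obtain ⟨ψ', hψ'A', hψ'x, hψh⟩ := HQ ez
        (fun c => ⟨algebraMap F _ c, hez (fun _ => c) (Reg.const c)⟩) η (by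
          rw [MvPolynomial.eval_map] at hη
          exact hη)
      have hψ'A : ∀ a : coord (φ '' S), ψ' (pull hφ a) = ez a := hψ'A'
      obtain ⟨s, hs⟩ := AV.ev (α := α) (F := F)
        { toFun := fun f => ψ' ⟨res S f.1, f.1, f.2, rfl⟩,
          map_one' := map_one ψ', map_mul' := fun f g =>
            map_mul ψ' ⟨res S f.1, f.1, f.2, rfl⟩ ⟨res S g.1, g.1, g.2, rfl⟩,
          map_zero' := map_zero ψ', map_add' := fun f g =>
            map_add ψ' ⟨res S f.1, f.1, f.2, rfl⟩ ⟨res S g.1, g.1, g.2, rfl⟩,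
          commutes' := fun c => by
            have := hψ'A (algebraMap F _ c)
            rw [AlgHom.commutes] at this
            refine Eq.trans this ?_
            exact hez (fun _ => c) (Reg.const c) }
      have hs' : ∀ (f : α → F) (hf : Reg f), f s = ψ' ⟨res S f, f, hf, rfl⟩ :=
        fun f hf => (hs ⟨f, hf⟩).symm
      have hsS : s ∈ S := by
        rw [← hSc.closure_eq]
        apply mem_closure_of_vanish
        intro f hf hfS
        rw [hs' f hf, ← map_zero ψ']
        congr 1
        apply Subtype.ext; ext t; exact hfS t t.2
      refine ⟨s, hsS, ?_, ?_, ?_⟩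
      · apply AV.sep (F := F)
        intro f hf
        obtain ⟨g', hg', hfg'⟩ := hφ f hf
        rw [hfg' s hsS, hs' g' hg', ← hez f hf, ← hψ'A]
        congr 1
        apply Subtype.ext; ext t
        exact (hfg' t t.2).symm
      · rw [hs' h hh]; exact hψh
      · intro i
        rw [hs' (y i) (hy i), ← hψ'x i]
        congr 1
        exact Subtype.ext (hyx i)

/-- The image of a nonempty open subset contains a nonempty open subset of its closure. -/
theorem open_image [IsAlgClosed F] {S : Set α} (hSc : IsClosed S) (hS : IsIrreducible S) {φ : α → β}
    (hφ : RegOn S φ) :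
    ∃ g : β → F, Reg g ∧ (∃ x ∈ S, g (φ x) ≠ 0) ∧
        ∀ z ∈ closure (φ '' S), g z ≠ 0 → z ∈ φ '' S := by
  obtain ⟨e, y, hy, -, g, hg, hgx, H⟩ := core hSc hS hφ (Reg.const 1)
    (hS.nonempty.imp fun x hx => ⟨hx, one_ne_zero⟩)
  refine ⟨g, hg, hgx, fun z hz hgz => ?_⟩
  obtain ⟨Q, hQ, HQ⟩ := H z hz hgz
  have h1 : ∃ η, MvPolynomial.eval η Q ≠ 0 := by
    by_contra! hc
    exact hQ (MvPolynomial.funext fun x => by simpa using hc x)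
  obtain ⟨η, hη⟩ := h1
  obtain ⟨s, hs, hsz, -⟩ := HQ η hη
  exact ⟨s, hs, hsz⟩

/-- Finite fibres imply that the dimension is preserved. -/
theorem dim_finite_fibres [IsAlgClosed F] {S : Set α} (hSc : IsClosed S) (hS : IsIrreducible S)
    {φ : α → β} (hφ : RegOn S φ) (hfin : ∀ z, {s ∈ S | φ s = z}.Finite) :
    zdim S = zdim (φ '' S) := by
  obtain ⟨e, y, hy, hd, g, hg, ⟨x, hx, hgx⟩, H⟩ := core hSc hS hφ (Reg.const 1)
    (hS.nonempty.imp fun x hx => ⟨hx, one_ne_zero⟩)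
  obtain ⟨Q, hQ, HQ⟩ := H (φ x) (subset_closure ⟨x, hx, rfl⟩) hgx
  rcases Nat.eq_zero_or_pos e with rfl | he
  · simpa using hd
  exfalso
  -- the set of values of the first coordinate is finite
  let i0 : Fin e := ⟨0, he⟩
  have hfx := hfin (φ x)
  let V := (hfx.image (y i0)).toFinset
  let P : MvPolynomial (Fin e) F := Q * ∏ c ∈ V, (MvPolynomial.X i0 - MvPolynomial.C c)
  have hP : P ≠ 0 := by
    refine mul_ne_zero hQ (Finset.prod_ne_zero_iff.2 fun c _ h0 => ?_)
    have := congrArg (MvPolynomial.eval fun _ => c + 1) h0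
    simp at this
  apply hP
  apply MvPolynomial.funext
  intro η
  simp only [P, map_mul, map_prod, map_sub, MvPolynomial.eval_X, MvPolynomial.eval_C, map_zero]
  by_cases hη : MvPolynomial.eval η Q = 0
  · simp [hη]
  · obtain ⟨s, hs, hsz, -, hsy⟩ := HQ η hη
    refine mul_eq_zero_of_right _ (Finset.prod_eq_zero (i := η i0) ?_ (sub_self _))
    simp only [V, Set.Finite.mem_toFinset]
    exact ⟨s, ⟨hs, hsz⟩, hsy i0⟩

end core

end DPD

namespace DPD

universe u

section gl
variable {F : Type u} [Field F] {n : ℕ}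

/-- The underlying matrix. -/
abbrev mat (g : GL (Fin n) F) : Matrix (Fin n) (Fin n) F := g

theorem reg_gl_poly {f : GL (Fin n) F → F} (hf : Reg f) :
    ∃ (N : ℕ) (P : MvPolynomial (Fin n × Fin n) F), ∀ g : GL (Fin n) F,
      (mat g).det ^ N * f g = MvPolynomial.eval (fun q => mat g q.1 q.2) P := by
  let D : MvPolynomial (Fin n × Fin n) F := (Matrix.of fun i j => MvPolynomial.X (i, j)).det
  have hD : ∀ g : GL (Fin n) F, MvPolynomial.eval (fun q => mat g q.1 q.2) D = (mat g).det := by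
    intro g
    rw [show D = (Matrix.of fun i j => MvPolynomial.X (i, j)).det from rfl, RingHom.map_det]
    congr 1
    ext i j; simp
  refine Algebra.adjoin_induction (p := fun f _ => ∃ (N : ℕ) (P : MvPolynomial (Fin n × Fin n) F),
    ∀ g : GL (Fin n) F, (mat g).det ^ N * f g = MvPolynomial.eval (fun q => mat g q.1 q.2) P)
    ?_ ?_ ?_ ?_ hf
  · rintro _ ⟨(⟨i, j⟩ | ⟨i, j⟩), rfl⟩
    · exact ⟨0, MvPolynomial.X (i, j), fun g => by simp [glCoord]⟩
    · refine ⟨1, (Matrix.of fun i j => (MvPolynomial.X (i, j) : MvPolynomial (Fin n × Fin n) F)).adjugate i j,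
        fun g => ?_⟩
      have h1 : MvPolynomial.eval (fun q => mat g q.1 q.2)
          ((Matrix.of fun i j => (MvPolynomial.X (i, j) : MvPolynomial (Fin n × Fin n) F)).adjugate i j)
          = (mat g).adjugate i j := by
        have := RingHom.map_adjugate (MvPolynomial.eval (fun q => mat g q.1 q.2))
          (Matrix.of fun i j => (MvPolynomial.X (i, j) : MvPolynomial (Fin n × Fin n) F))
        have h2 := congrFun (congrFun this i) j
        rw [RingHom.mapMatrix_apply, Matrix.map_apply] at h2
        rw [h2]
        congr 2
        ext i j; simp
      rw [h1]
      have hu : IsUnit (mat g).det := (Matrix.isUnit_iff_isUnit_det _).1 g.isUnit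
      simp only [glCoord, pow_one]
      rw [Matrix.coe_units_inv, Matrix.inv_def, Matrix.smul_apply, smul_eq_mul, ← mul_assoc,
        Ring.mul_inverse_cancel _ hu, one_mul]
  · intro r
    exact ⟨0, MvPolynomial.C r, fun g => by simp⟩
  · rintro x y - - ⟨N, P, h⟩ ⟨N', P', h'⟩
    refine ⟨N + N', D ^ N' * P + D ^ N * P', fun g => ?_⟩
    simp only [map_add, map_mul, map_pow, hD, ← h, ← h', Pi.add_apply]
    ring
  · rintro x y - - ⟨N, P, h⟩ ⟨N', P', h'⟩
    refine ⟨N + N', P * P', fun g => ?_⟩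
    simp only [map_mul, ← h, ← h', Pi.mul_apply]
    ring

theorem det_ne (g : GL (Fin n) F) : (mat g).det ≠ 0 :=
  ((Matrix.isUnit_iff_isUnit_det _).1 g.isUnit).ne_zero

theorem glz_iff {S : Set (GL (Fin n) F)} : GLZClosed S ↔ IsClosed S := by
  constructor
  · rintro ⟨_, ⟨I, rfl⟩, rfl⟩
    rw [isClosed_iff]
    intro a ha
    simp only [Set.mem_setOf_eq, not_forall] at ha
    obtain ⟨p, hp, hpa⟩ := ha
    exact ⟨_, Reg.mvPoly (fun q : Fin n × Fin n => reg_entry q.1 q.2) p, fun x hx => hx p hp, hpa⟩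
  · intro h
    refine ⟨_, ⟨{P | ∀ g ∈ S, MvPolynomial.eval (fun q => mat g q.1 q.2) P = 0}, rfl⟩, ?_⟩
    ext a
    constructor
    · intro ha P hP
      exact hP a ha
    · intro ha
      by_contra hn
      obtain ⟨f, hf, hfS, hfa⟩ := isClosed_iff.1 h a hn
      obtain ⟨N, P, hP⟩ := reg_gl_poly hf
      have := ha P (fun g hg => by rw [← hP, hfS g hg, mul_zero])
      rw [← hP] at this
      exact mul_ne_zero (pow_ne_zero _ (det_ne a)) hfa this

theorem irr_connected {S : Set (GL (Fin n) F)} (hS : IsIrreducible S) : GLZConnected S := by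
  refine ⟨hS.nonempty, fun U V hU hV h hU' hV' => ?_⟩
  rcases isIrreducible_iff_sUnion_isClosed.1 hS {U, V} (by
    simp [glz_iff.1 hU, glz_iff.1 hV]) (by simpa using h) with ⟨z, hz, hz'⟩
  simp only [Finset.mem_insert, Finset.mem_singleton] at hz
  rcases hz with rfl | rfl
  · obtain ⟨x, hx, hx'⟩ := hV'
    exact ⟨x, hx, hz' hx, hx'⟩
  · obtain ⟨x, hx, hx'⟩ := hU'
    exact ⟨x, hx, hx', hz' hx⟩

/-- `C1` is the identity component of `C`. -/
structure IsIdc (C C1 : Subgroup (GL (Fin n) F)) : Prop where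
  le : C1 ≤ C
  closed : IsClosed (C1 : Set (GL (Fin n) F))
  irr : IsIrreducible (C1 : Set (GL (Fin n) F))
  big : ∀ T : Set (GL (Fin n) F), IsIrreducible T → (1 : GL (Fin n) F) ∈ T → T ⊆ C → T ⊆ C1
  fin : ∃ R : Set (GL (Fin n) F), R.Finite ∧ R ⊆ C ∧ ∀ c ∈ C, ∃ r ∈ R, r⁻¹ * c ∈ C1

theorem regMap_lmul (k : GL (Fin n) F) : RegMap (fun x : GL (Fin n) F => k * x) :=
  RegMap.mul (RegMap.constGL k) RegMap.id
theorem regMap_rmul (k : GL (Fin n) F) : RegMap (fun x : GL (Fin n) F => x * k) :=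
  RegMap.mul RegMap.id (RegMap.constGL k)
theorem regMap_inv : RegMap (fun x : GL (Fin n) F => x⁻¹) :=
  RegMap.inv RegMap.id
theorem regMap_conj (k : GL (Fin n) F) : RegMap (fun x : GL (Fin n) F => k * x * k⁻¹) :=
  RegMap.mul (regMap_lmul k) (RegMap.constGL k⁻¹)
theorem regMap_pmul : RegMap (fun x : ZProd (GL (Fin n) F) (GL (Fin n) F) => x.fst * x.snd) :=
  RegMap.mul regMap_fst regMap_snd
theorem regMap_pconj :
    RegMap (fun x : ZProd (GL (Fin n) F) (GL (Fin n) F) => x.fst * x.snd * x.fst⁻¹) :=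
  RegMap.mul regMap_pmul (RegMap.inv regMap_fst)

theorem irr_mul {S T : Set (GL (Fin n) F)} (hS : IsIrreducible S) (hT : IsIrreducible T) :
    IsIrreducible {x | ∃ s ∈ S, ∃ t ∈ T, x = s * t} := by
  have := (regMap_pmul (F := F) (n := n)).regOn (zprod S T) |>.irr_image (zprod_irr hS hT)
  convert this using 1
  ext x
  constructor
  · rintro ⟨s, hs, t, ht, rfl⟩
    exact ⟨⟨s, t⟩, ⟨hs, ht⟩, rfl⟩
  · rintro ⟨⟨s, t⟩, ⟨hs, ht⟩, rfl⟩
    exact ⟨s, hs, t, ht, rfl⟩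

theorem exists_idc {C : Subgroup (GL (Fin n) F)} (hC : IsClosed (C : Set (GL (Fin n) F))) :
    ∃ C1, IsIdc C C1 := by
  classical
  obtain ⟨Zs, hfin, hZc, hZi, hU⟩ :=
    TopologicalSpace.NoetherianSpace.exists_finite_set_isClosed_irreducible hC
  have hZ : (∀ t ∈ Zs, IsClosed t) ∧ (∀ t ∈ Zs, IsIrreducible t) := ⟨hZc, hZi⟩
  have hsub : ∀ Z ∈ Zs, Z ⊆ C := fun Z hZ' => by rw [hU]; exact Set.subset_sUnion_of_mem hZ'
  haveI : Finite Zs := hfin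
  have cov : ∀ T : Set (GL (Fin n) F), IsIrreducible T → T ⊆ C → ∃ Z ∈ Zs, T ⊆ Z := by
    intro T hT hTC
    obtain ⟨i, hi⟩ := irr_cover hT (Z := fun Z : Zs => Z.1) (fun i => (hZ.1 i.1 i.2))
      (fun x hx => by
        have := hTC hx
        rw [hU] at this
        obtain ⟨Z, hZ1, hZ2⟩ := this
        exact ⟨⟨Z, hZ1⟩, hZ2⟩)
    exact ⟨i.1, i.2, hi⟩
  obtain ⟨Z1, hZ1, h1⟩ := cov {1} isIrreducible_singleton (by simp [C.one_mem])
  let W := {Z ∈ Zs | (1 : GL (Fin n) F) ∈ Z}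
  have hW : W.Finite := hfin.subset fun _ h => h.1
  obtain ⟨M, -, hM⟩ := hW.exists_le_maximal (a := Z1) ⟨hZ1, h1 rfl⟩
  have hMirr : IsIrreducible M := hZ.2 M hM.1.1
  have big : ∀ T : Set (GL (Fin n) F), IsIrreducible T → (1 : GL (Fin n) F) ∈ T → T ⊆ C → T ⊆ M := by
    intro T hT hT1 hTC
    obtain ⟨Z, hZZ, hTZ⟩ := cov _ (irr_mul hMirr hT) (by
      rintro _ ⟨s, hs, t, ht, rfl⟩
      exact C.mul_mem (hsub M hM.1.1 hs) (hTC ht))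
    have hMZ : M ⊆ Z := fun m hm => hTZ ⟨m, hm, 1, hT1, by simp⟩
    have := hM.2 (y := Z) ⟨hZZ, hMZ hM.1.2⟩ hMZ
    exact fun t ht => this (hTZ ⟨1, hM.1.2, t, ht, by simp⟩)
  let C1 : Subgroup (GL (Fin n) F) :=
    { carrier := M
      one_mem' := hM.1.2
      mul_mem' := fun {a b} ha hb => big _ (irr_mul hMirr hMirr)
        ⟨1, hM.1.2, 1, hM.1.2, by simp⟩ (by
          rintro _ ⟨s, hs, t, ht, rfl⟩
          exact C.mul_mem (hsub M hM.1.1 hs) (hsub M hM.1.1 ht)) ⟨a, ha, b, hb, rfl⟩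
      inv_mem' := fun {a} ha => big _ ((regMap_inv.regOn M).irr_image hMirr)
        ⟨1, hM.1.2, by simp⟩ (by
          rintro _ ⟨s, hs, rfl⟩
          exact C.inv_mem (hsub M hM.1.1 hs)) ⟨a, ha, rfl⟩ }
  refine ⟨C1, hsub M hM.1.1, hZ.1 M hM.1.1, hMirr, big, ?_⟩
  have hne : ∀ Z : Zs, ∃ r, r ∈ Z.1 := fun Z => (hZ.2 Z.1 Z.2).nonempty
  choose r hr using hne
  refine ⟨Set.range r, Set.finite_range r, ?_, ?_⟩
  · rintro _ ⟨Z, rfl⟩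
    exact hsub _ Z.2 (hr Z)
  · intro c hc
    obtain ⟨Z, hZZ, hcZ⟩ := cov {c} isIrreducible_singleton (by simpa using hc)
    refine ⟨r ⟨Z, hZZ⟩, ⟨_, rfl⟩, ?_⟩
    apply big _ (((regMap_lmul (r ⟨Z, hZZ⟩)⁻¹).regOn Z).irr_image (hZ.2 Z hZZ))
      ⟨_, hr ⟨Z, hZZ⟩, by simp⟩ ?_ ⟨c, hcZ rfl, rfl⟩
    rintro _ ⟨s, hs, rfl⟩
    exact C.mul_mem (C.inv_mem (hsub _ hZZ (hr ⟨Z, hZZ⟩))) (hsub Z hZZ hs)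

theorem IsIdc.conj {C C1 : Subgroup (GL (Fin n) F)} (h : IsIdc C C1) {k : GL (Fin n) F}
    (hk : ∀ c ∈ C, k * c * k⁻¹ ∈ C) : ∀ c ∈ C1, k * c * k⁻¹ ∈ C1 := by
  intro c hc
  refine h.big _ (((regMap_conj k).regOn _).irr_image h.irr) ⟨1, C1.one_mem, by simp⟩ ?_ ⟨c, hc, rfl⟩
  rintro _ ⟨s, hs, rfl⟩
  exact hk s (h.le hs)

/-- Two nonempty open subsets of an irreducible set meet. -/
theorem irr_meet {α : Type u} [AV F α] {S : Set α} (hS : IsIrreducible S) {f g : α → F} (hf : Reg f)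
    (hg : Reg g) (h1 : ∃ x ∈ S, f x ≠ 0) (h2 : ∃ x ∈ S, g x ≠ 0) :
    ∃ x ∈ S, f x ≠ 0 ∧ g x ≠ 0 := by
  by_contra! hc
  rcases (irr_iff.1 hS).2 f g hf hg (fun x hx => by
    by_cases h : f x = 0
    · simp [h]
    · simp [hc x hx h]) with h | h
  · obtain ⟨x, hx, hx'⟩ := h1; exact hx' (h x hx)
  · obtain ⟨x, hx, hx'⟩ := h2; exact hx' (h x hx)

theorem open_gen {H K : Subgroup (GL (Fin n) F)} (hK : IsIrreducible (K : Set (GL (Fin n) F)))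
    {g : GL (Fin n) F → F} (hg : Reg g) (h1 : ∃ k ∈ K, g k ≠ 0)
    (h2 : ∀ z ∈ K, g z ≠ 0 → z ∈ H) : K ≤ H := by
  intro k hk
  obtain ⟨k0, hk0, hk0'⟩ := h1
  obtain ⟨z, hz, hz1, hz2⟩ := irr_meet hK hg
    (RegMap.mul regMap_inv (RegMap.constGL k) g hg) ⟨k0, hk0, hk0'⟩
    ⟨k * k0⁻¹, K.mul_mem hk (K.inv_mem hk0), by simpa using hk0'⟩
  have e : k = z * (z⁻¹ * k) := by group
  rw [e]
  exact H.mul_mem (h2 z hz hz1) (h2 _ (K.mul_mem (K.inv_mem hz) hk) hz2)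

theorem scalarGL_val (c : Fˣ) : mat (scalarGL n c) = (c : F) • (1 : Matrix (Fin n) (Fin n) F) := by
  simp [scalarGL, mat, Matrix.smul_one_eq_diagonal]

/-- The group of scalar matrices. -/
def scal (F : Type u) [Field F] (n : ℕ) : Subgroup (GL (Fin n) F) :=
  (Units.map (Matrix.scalar (α := F) (Fin n)).toMonoidHom).range

theorem mem_scal {g : GL (Fin n) F} : g ∈ scal F n ↔ IsScalarGL g := by
  simp only [scal, MonoidHom.mem_range, IsScalarGL, scalarGL]
  exact ⟨fun ⟨c, h⟩ => ⟨c, h.symm⟩, fun ⟨c, h⟩ => ⟨c, h.symm⟩⟩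

theorem scal_comm {g : GL (Fin n) F} (hg : g ∈ scal F n) (x : GL (Fin n) F) : g * x = x * g := by
  obtain ⟨c, rfl⟩ := mem_scal.1 hg
  apply Units.ext
  change mat (scalarGL n c) * mat x = mat x * mat (scalarGL n c)
  rw [scalarGL_val]; simp

theorem mem_scal_of_comm {g : GL (Fin n) F} {c : F} (hn : 0 < n)
    (h : mat g = c • (1 : Matrix (Fin n) (Fin n) F)) : g ∈ scal F n := by
  have hc : c ≠ 0 := by
    rintro rfl
    haveI : Nonempty (Fin n) := ⟨⟨0, hn⟩⟩
    have h1 := det_ne g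
    rw [h, zero_smul] at h1
    exact h1 Matrix.det_zero
  rw [mem_scal]
  refine ⟨Units.mk0 c hc, Units.ext ?_⟩
  change mat g = mat (scalarGL n _)
  rw [scalarGL_val, h]; rfl

theorem scal_irr [Infinite F] (hn : 0 < n) : IsIrreducible (scal F n : Set (GL (Fin n) F)) := by
  rw [irr_iff]
  refine ⟨⟨1, (scal F n).one_mem⟩, fun f g hf hg h => ?_⟩
  have key : ∀ f : GL (Fin n) F → F, Reg f → ∃ (N : ℕ) (P : Polynomial F), ∀ c : Fˣ,
      (c : F) ^ N * f (scalarGL n c) = P.eval (c : F) := by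
    intro f hf
    obtain ⟨N, P, hP⟩ := reg_gl_poly hf
    refine ⟨n * N, MvPolynomial.aeval (fun q : Fin n × Fin n =>
      Polynomial.C ((1 : Matrix (Fin n) (Fin n) F) q.1 q.2) * Polynomial.X) P, fun c => ?_⟩
    have h1 := hP (scalarGL n c)
    rw [scalarGL_val, Matrix.det_smul, Matrix.det_one, mul_one, Fintype.card_fin, ← pow_mul] at h1
    rw [h1]
    have h2 : ∀ P : MvPolynomial (Fin n × Fin n) F,
        MvPolynomial.eval (fun q => ((c : F) • (1 : Matrix (Fin n) (Fin n) F)) q.1 q.2) P =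
        Polynomial.eval (c : F) (MvPolynomial.aeval (fun q : Fin n × Fin n =>
      Polynomial.C ((1 : Matrix (Fin n) (Fin n) F) q.1 q.2) * Polynomial.X) P) := by
      intro P
      induction P using MvPolynomial.induction_on with
      | C a => simp
      | add p q hp hq => simp only [map_add, Polynomial.eval_add, hp, hq]
      | mul_X p q hp =>
        rw [map_mul, map_mul, Polynomial.eval_mul, hp]
        simp only [Polynomial.eval_mul, MvPolynomial.eval_X, MvPolynomial.aeval_X,
          Matrix.smul_apply, smul_eq_mul, Polynomial.eval_C, Polynomial.eval_X]
        ring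
    exact h2 P
  obtain ⟨N, P, hP⟩ := key f hf
  obtain ⟨N', P', hP'⟩ := key g hg
  have h0 : Polynomial.X * (P * P') = 0 := by
    apply Polynomial.funext
    intro c
    by_cases hc : c = 0
    · simp [hc]
    · have h1 := hP (Units.mk0 c hc)
      have h2 := hP' (Units.mk0 c hc)
      have h3 := h (scalarGL n (Units.mk0 c hc)) (mem_scal.2 ⟨_, rfl⟩)
      simp only [Units.val_mk0] at h1 h2
      simp only [Polynomial.eval_mul, ← h1, ← h2, Polynomial.eval_zero, Polynomial.eval_X]
      linear_combination c * c ^ N * c ^ N' * h3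
  rcases mul_eq_zero.1 ((mul_eq_zero.1 h0).resolve_left Polynomial.X_ne_zero) with h0 | h0
  · left
    intro x hx
    obtain ⟨c, rfl⟩ := mem_scal.1 hx
    have := hP c
    rw [h0, Polynomial.eval_zero] at this
    exact (mul_eq_zero.1 this).resolve_left (pow_ne_zero _ c.ne_zero)
  · right
    intro x hx
    obtain ⟨c, rfl⟩ := mem_scal.1 hx
    have := hP' c
    rw [h0, Polynomial.eval_zero] at this
    exact (mul_eq_zero.1 this).resolve_left (pow_ne_zero _ c.ne_zero)

end gl
end DPD

namespace DPD

universe u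

section idem
variable {F : Type u} [Field F] {n r : ℕ}

/-- A complete system of nonzero orthogonal idempotent matrices. -/
structure Idem (p : Fin r → Matrix (Fin n) (Fin n) F) : Prop where
  idem : ∀ i, p i * p i = p i
  orth : ∀ i j, i ≠ j → p i * p j = 0
  sum : ∑ i, p i = 1
  ne : ∀ i, p i ≠ 0

theorem coprime_kill {b b' : F} (hb : b ≠ b') (k : ℕ) {x y : Matrix (Fin n) (Fin n) F}
    (h : (x - b • 1) ^ k * y = 0) (h' : (x - b' • 1) ^ k * y = 0) : y = 0 := by
  have hc : IsCoprime ((Polynomial.X - Polynomial.C b) ^ k) ((Polynomial.X - Polynomial.C b') ^ k) :=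
    (Polynomial.isCoprime_X_sub_C_of_isUnit_sub (sub_ne_zero.2 hb).isUnit).pow
  obtain ⟨u, v, huv⟩ := hc
  have h1 := congrArg (Polynomial.aeval x) huv
  simp only [map_add, map_mul, map_pow, map_sub, Polynomial.aeval_X, Polynomial.aeval_C, map_one,
    Algebra.algebraMap_eq_smul_one] at h1
  calc y = 1 * y := (one_mul y).symm
    _ = 0 := by rw [← h1, add_mul, mul_assoc, mul_assoc, h, h', mul_zero, mul_zero, add_zero]

theorem comm_sub_pow {x p : Matrix (Fin n) (Fin n) F} (h : x * p = p * x) (b : F) (k : ℕ) :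
    (x - b • 1) ^ k * p = p * (x - b • 1) ^ k := by
  have : Commute (x - b • 1) p := by
    change (x - b • 1) * p = p * (x - b • 1)
    rw [sub_mul, mul_sub, h]; simp
  exact (this.pow_left k)

theorem perm_lemma {p q : Fin r → Matrix (Fin n) (Fin n) F} (hp : Idem p) (hq : Idem q)
    {x : Matrix (Fin n) (Fin n) F} (hxp : ∀ i, x * p i = p i * x) (hxq : ∀ i, x * q i = q i * x)
    {b b' : Fin r → F} (hb : Function.Injective b)
    (h1 : ∀ i, (x - b i • 1) ^ n * p i = 0) (h2 : ∀ i, (x - b' i • 1) ^ n * q i = 0) :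
    ∃ σ : Equiv.Perm (Fin r), ∀ j, p j = q (σ j) := by
  have z : ∀ i j, b' i ≠ b j → q i * p j = 0 := by
    intro i j hij
    apply coprime_kill hij n (x := x)
    · rw [← mul_assoc, h2, zero_mul]
    · rw [← mul_assoc, comm_sub_pow (hxq i), mul_assoc, h1, mul_zero]
  have ex : ∀ j, ∃ i, q i * p j ≠ 0 := by
    intro j
    by_contra! hc
    apply hp.ne j
    rw [← one_mul (p j), ← hq.sum, Finset.sum_mul]
    exact Finset.sum_eq_zero fun i _ => hc i
  choose σ hσ using ex
  have hσb : ∀ j, b' (σ j) = b j := fun j => by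
    by_contra hc
    exact hσ j (z _ _ hc)
  have hinj : Function.Injective σ := by
    intro j k hjk
    apply hb
    rw [← hσb, ← hσb, hjk]
  have hbij := Finite.injective_iff_bijective.1 hinj
  refine ⟨Equiv.ofBijective σ hbij, fun j => ?_⟩
  have e1 : q (σ j) * p j = p j := by
    conv_rhs => rw [← one_mul (p j), ← hq.sum, Finset.sum_mul]
    rw [Finset.sum_eq_single (σ j)]
    · intro i _ hi
      apply z
      intro hc
      obtain ⟨k, rfl⟩ := hbij.2 i
      apply hi
      rw [hσb] at hc
      rw [hb hc]
    · simp
  have e2 : q (σ j) * p j = q (σ j) := by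
    conv_rhs => rw [← mul_one (q (σ j)), ← hp.sum, Finset.mul_sum]
    rw [Finset.sum_eq_single j]
    · intro i _ hi
      apply z
      rw [hσb]
      exact fun hc => hi (hb hc).symm
    · simp
  change p j = q (σ j)
  rw [← e1, e2]

/-- Conjugation of matrices by invertible ones. -/
def cj (k : GL (Fin n) F) (x : Matrix (Fin n) (Fin n) F) : Matrix (Fin n) (Fin n) F :=
  mat k * x * mat k⁻¹

theorem mat_mul (a b : GL (Fin n) F) : mat (a * b) = mat a * mat b := rfl
theorem mat_one : mat (1 : GL (Fin n) F) = 1 := rfl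
theorem mat_mul_inv (a : GL (Fin n) F) : mat a * mat a⁻¹ = 1 := by
  rw [← mat_mul, mul_inv_cancel]; rfl
theorem mat_inv_mul (a : GL (Fin n) F) : mat a⁻¹ * mat a = 1 := by
  rw [← mat_mul, inv_mul_cancel]; rfl

theorem cj_mul (k : GL (Fin n) F) (x y : Matrix (Fin n) (Fin n) F) :
    cj k (x * y) = cj k x * cj k y := by
  have : mat k * x * mat k⁻¹ * (mat k * y * mat k⁻¹)
    = mat k * x * (mat k⁻¹ * mat k) * y * mat k⁻¹ := by noncomm_ring
  unfold cj
  rw [this, mat_inv_mul]; noncomm_ring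

theorem cj_add (k : GL (Fin n) F) (x y : Matrix (Fin n) (Fin n) F) :
    cj k (x + y) = cj k x + cj k y := by
  unfold cj; noncomm_ring
theorem cj_sub (k : GL (Fin n) F) (x y : Matrix (Fin n) (Fin n) F) :
    cj k (x - y) = cj k x - cj k y := by
  unfold cj; noncomm_ring
theorem cj_smul (k : GL (Fin n) F) (c : F) (y : Matrix (Fin n) (Fin n) F) :
    cj k (c • y) = c • cj k y := by
  unfold cj; simp
theorem cj_one (k : GL (Fin n) F) : cj k 1 = 1 := by
  unfold cj; rw [mul_one, mat_mul_inv]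
theorem cj_zero (k : GL (Fin n) F) : cj k 0 = 0 := by
  unfold cj; simp
theorem cj_pow (k : GL (Fin n) F) (x : Matrix (Fin n) (Fin n) F) (m : ℕ) :
    cj k (x ^ m) = cj k x ^ m := by
  induction m with
  | zero => simp [cj_one]
  | succ m ih => rw [pow_succ, pow_succ, cj_mul, ih]
theorem cj_sum {ι : Type*} (s : Finset ι) (k : GL (Fin n) F) (x : ι → Matrix (Fin n) (Fin n) F) :
    cj k (∑ i ∈ s, x i) = ∑ i ∈ s, cj k (x i) := by
  unfold cj; rw [Finset.mul_sum, Finset.sum_mul]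
theorem cj_cj (k l : GL (Fin n) F) (x : Matrix (Fin n) (Fin n) F) :
    cj k (cj l x) = cj (k * l) x := by
  unfold cj; rw [_root_.mul_inv_rev, mat_mul, mat_mul]; noncomm_ring
theorem cj_mat (k x : GL (Fin n) F) : cj k (mat x) = mat (k * x * k⁻¹) := rfl
theorem cj_eq_self {k : GL (Fin n) F} {x : Matrix (Fin n) (Fin n) F} :
    cj k x = x ↔ mat k * x = x * mat k := by
  unfold cj
  constructor
  · intro h
    calc mat k * x = mat k * x * (mat k⁻¹ * mat k) := by rw [mat_inv_mul, mul_one]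
      _ = mat k * x * mat k⁻¹ * mat k := by noncomm_ring
      _ = _ := by rw [h]
  · intro h
    rw [h, mul_assoc, mat_mul_inv, mul_one]
theorem cj_one' (x : Matrix (Fin n) (Fin n) F) : cj (1 : GL (Fin n) F) x = x := by
  simp [cj]
theorem cj_inj (k : GL (Fin n) F) {x y : Matrix (Fin n) (Fin n) F} (h : cj k x = cj k y) :
    x = y := by
  have := congrArg (cj k⁻¹) h
  rwa [cj_cj, cj_cj, inv_mul_cancel, cj_one', cj_one'] at this

theorem Idem.cj {p : Fin r → Matrix (Fin n) (Fin n) F} (hp : Idem p) (k : GL (Fin n) F) :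
    Idem (fun i => cj k (p i)) where
  idem i := by rw [← cj_mul, hp.idem]
  orth i j h := by rw [← cj_mul, hp.orth i j h, cj_zero]
  sum := by rw [← cj_sum, hp.sum, cj_one]
  ne i h := hp.ne i (cj_inj k (by rw [h, cj_zero]))

/-- The elements of `K` commuting with all `p i`. -/
def centr (K : Subgroup (GL (Fin n) F)) (p : Fin r → Matrix (Fin n) (Fin n) F) :
    Subgroup (GL (Fin n) F) where
  carrier := {k | k ∈ K ∧ ∀ i, cj k (p i) = p i}
  one_mem' := ⟨K.one_mem, fun i => cj_one' _⟩
  mul_mem' := fun {a b} ha hb => ⟨K.mul_mem ha.1 hb.1, fun i => by rw [← cj_cj, hb.2, ha.2]⟩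
  inv_mem' := fun {a} ha => ⟨K.inv_mem ha.1, fun i => by
    apply cj_inj a
    rw [cj_cj, mul_inv_cancel, cj_one', ha.2]⟩

/-- The elements of `K` permuting the `p i`. -/
def normp (K : Subgroup (GL (Fin n) F)) (p : Fin r → Matrix (Fin n) (Fin n) F) :
    Subgroup (GL (Fin n) F) where
  carrier := {k | k ∈ K ∧ ∃ σ : Equiv.Perm (Fin r), ∀ i, cj k (p i) = p (σ i)}
  one_mem' := ⟨K.one_mem, 1, fun i => cj_one' _⟩
  mul_mem' := by
    rintro a b ⟨ha, σ, hσ⟩ ⟨hb, τ, hτ⟩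
    exact ⟨K.mul_mem ha hb, τ.trans σ, fun i => by rw [← cj_cj, hτ, hσ]; rfl⟩
  inv_mem' := by
    rintro a ⟨ha, σ, hσ⟩
    refine ⟨K.inv_mem ha, σ.symm, fun i => ?_⟩
    apply cj_inj a
    rw [cj_cj, mul_inv_cancel, cj_one', hσ]; simp

theorem centr_le_normp (K : Subgroup (GL (Fin n) F)) (p : Fin r → Matrix (Fin n) (Fin n) F) :
    centr K p ≤ normp K p := fun _ h => ⟨h.1, 1, h.2⟩

theorem reg_cj (x : Matrix (Fin n) (Fin n) F) (a b : Fin n) :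
    Reg (fun k : GL (Fin n) F => cj k x a b) := by
  have h1 : ∀ a b, Reg (fun k : GL (Fin n) F => (mat k * x) a b) :=
    Reg.matMul (A := fun k : GL (Fin n) F => mat k) (B := fun _ => x)
      (fun i j => reg_entry i j) (fun i j => Reg.const (x i j))
  exact Reg.matMul (A := fun k : GL (Fin n) F => mat k * x) (B := fun k => mat k⁻¹)
    h1 (fun i j => reg_inv_entry i j) a b

theorem centr_closed {K : Subgroup (GL (Fin n) F)} (hK : IsClosed (K : Set (GL (Fin n) F)))
    (p : Fin r → Matrix (Fin n) (Fin n) F) : IsClosed (centr K p : Set (GL (Fin n) F)) := by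
  have : (centr K p : Set (GL (Fin n) F)) =
      (K : Set (GL (Fin n) F)) ∩ ⋂ (i : Fin r) (a : Fin n) (b : Fin n), {k | cj k (p i) a b = p i a b} := by
    ext k
    simp only [centr, Set.mem_inter_iff, Set.mem_iInter]
    refine and_congr_right fun _ => forall_congr' fun i => ?_
    exact ⟨fun h a b => by change cj k (p i) a b = _; rw [h], fun h => Matrix.ext h⟩
  rw [this]
  refine hK.inter (isClosed_iInter fun i => isClosed_iInter fun a => isClosed_iInter fun b => ?_)
  exact isClosed_eq' (f := fun k => cj k (p i) a b) (reg_cj (p i) a b) (Reg.const (p i a b))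

theorem normp_fin {K C1 : Subgroup (GL (Fin n) F)} {p : Fin r → Matrix (Fin n) (Fin n) F}
    (h : IsIdc (centr K p) C1) : ∃ R : Set (GL (Fin n) F), R.Finite ∧ R ⊆ normp K p ∧
      ∀ m ∈ normp K p, ∃ x ∈ R, x⁻¹ * m ∈ C1 := by
  classical
  obtain ⟨R, hR, hRC, hcov⟩ := h.fin
  let A : Equiv.Perm (Fin r) → GL (Fin n) F := fun σ =>
    if h : ∃ k ∈ K, ∀ i, cj k (p i) = p (σ i) then h.choose else 1
  have hA : ∀ σ, A σ ∈ normp K p := by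
    intro σ
    by_cases h : ∃ k ∈ K, ∀ i, cj k (p i) = p (σ i)
    · simp only [A, dif_pos h]; exact ⟨h.choose_spec.1, σ, h.choose_spec.2⟩
    · simp only [A, dif_neg h]; exact (normp K p).one_mem
  refine ⟨(fun x : _ × _ => A x.1 * x.2) '' (Set.univ ×ˢ R), (Set.finite_univ.prod hR).image _, ?_, ?_⟩
  · rintro _ ⟨⟨σ, x⟩, ⟨-, hx⟩, rfl⟩
    exact (normp K p).mul_mem (hA σ) (centr_le_normp K p (hRC hx))
  · rintro m ⟨hm, σ, hσ⟩
    have h : ∃ k ∈ K, ∀ i, cj k (p i) = p (σ i) := ⟨m, hm, hσ⟩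
    have h1 : cj (A σ) = cj h.choose := by simp only [A, dif_pos h]
    have h2 : (A σ)⁻¹ * m ∈ centr K p := by
      refine ⟨K.mul_mem (K.inv_mem (hA σ).1) hm, fun i => ?_⟩
      apply cj_inj (A σ)
      rw [cj_cj, mul_inv_cancel_left, hσ, h1, h.choose_spec.2]
    obtain ⟨x, hx, hx'⟩ := hcov _ h2
    refine ⟨_, ⟨(σ, x), ⟨trivial, hx⟩, rfl⟩, ?_⟩
    simpa [mul_assoc] using hx'

theorem domReg [IsAlgClosed F] {K C1 : Subgroup (GL (Fin n) F)}
    (hKc : IsClosed (K : Set (GL (Fin n) F)))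
    (hK : IsIrreducible (K : Set (GL (Fin n) F))) {p : Fin r → Matrix (Fin n) (Fin n) F}
    (hp : Idem p) (hC : IsIdc (centr K p) C1) {s : GL (Fin n) F} (hs : s ∈ centr K p)
    {b : Fin r → GL (Fin n) F → F} (hb : ∀ i, Reg (b i))
    (hbs : ∀ c ∈ C1, ∀ i, (mat (s * c) - b i c • 1) ^ n * p i = 0)
    (hinj : ∃ c ∈ C1, Function.Injective fun i => b i c) :
    ∃ g : GL (Fin n) F → F, Reg g ∧ (∃ z ∈ K, g z ≠ 0) ∧ ∀ z ∈ K, g z ≠ 0 →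
      ∃ k ∈ K, ∃ c ∈ C1, (Function.Injective fun i => b i c) ∧ z = k * (s * c) * k⁻¹ := by
  classical
  let h : GL (Fin n) F → F := fun c => ∏ q : Fin r × Fin r, if q.1 = q.2 then 1 else b q.1 c - b q.2 c
  have hh : Reg h := by
    apply Reg.prod
    rintro q -
    by_cases hq : q.1 = q.2
    · simp only [hq, if_true]; exact Reg.const 1
    · simp only [hq, if_false]; exact Reg.sub (hb _) (hb _)
  have hiff : ∀ c, h c ≠ 0 ↔ Function.Injective fun i => b i c := by
    intro c
    simp only [h, Finset.prod_ne_zero_iff]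
    constructor
    · intro H i j hij
      by_contra hne
      have := H (i, j) (Finset.mem_univ _)
      simp only [hne, if_false] at this
      exact this (sub_eq_zero.2 hij)
    · rintro H ⟨i, j⟩ -
      by_cases hij : i = j
      · simp [hij]
      · simp only [hij, if_false]
        exact sub_ne_zero.2 fun he => hij (H he)
  let φ : ZProd (GL (Fin n) F) (GL (Fin n) F) → GL (Fin n) F := fun x => x.fst * (s * x.snd) * x.fst⁻¹
  have hφ : RegMap φ := RegMap.mul (RegMap.mul regMap_fst
    (RegMap.mul (RegMap.constGL s) regMap_snd)) (RegMap.inv regMap_fst)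
  let S := zprod (K : Set (GL (Fin n) F)) (C1 : Set (GL (Fin n) F))
  have hSirr : IsIrreducible S := zprod_irr hK hC.irr
  have hScl : IsClosed S := zprod_closed hKc hC.closed
  obtain ⟨e, y, hy, hdim, g, hg, hgne, H⟩ := core hScl hSirr (hφ.regOn S)
    (h := fun x => h x.snd) (regMap_snd h hh) (by
      obtain ⟨c, hc, hci⟩ := hinj
      exact ⟨⟨1, c⟩, ⟨K.one_mem, hc⟩, (hiff c).2 hci⟩)
  have pick : ∀ Q : MvPolynomial (Fin e) F, Q ≠ 0 → ∃ η, MvPolynomial.eval η Q ≠ 0 := by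
    intro Q hQ
    by_contra! hc
    exact hQ (MvPolynomial.funext fun x => by simpa using hc x)
  have him : φ '' S ⊆ K := by
    rintro _ ⟨⟨k, c⟩, ⟨hk, hc⟩, rfl⟩
    exact K.mul_mem (K.mul_mem hk (K.mul_mem hs.1 (hC.le hc).1)) (K.inv_mem hk)
  obtain ⟨R, hR, hRN, hRcov⟩ := normp_fin hC
  have he : e ≤ zdim (C1 : Set (GL (Fin n) F)) := by
    by_contra hlt
    obtain ⟨x1, hx1, hgx1⟩ := hgne
    obtain ⟨Q, hQ, HQ⟩ := H _ (subset_closure ⟨x1, hx1, rfl⟩) hgx1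
    obtain ⟨η0, hη0⟩ := pick Q hQ
    obtain ⟨⟨k0, c0⟩, ⟨hk0, hc0⟩, hz0, hh0, -⟩ := HQ η0 hη0
    -- parametrisation of a piece of the fibre
    let par : GL (Fin n) F → GL (Fin n) F → ZProd (GL (Fin n) F) (GL (Fin n) F) := fun m c =>
      ⟨k0 * (m * c), s⁻¹ * ((m * c)⁻¹ * (s * c0) * (m * c))⟩
    have hpar : ∀ m, RegMap (par m) := fun m => RegMap.mk
      (RegMap.mul (RegMap.constGL _) (regMap_lmul m))
      (RegMap.mul (RegMap.constGL _) (RegMap.mul (RegMap.mul (RegMap.inv (regMap_lmul m))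
        (RegMap.constGL _)) (regMap_lmul m)))
    have hP : ∀ m : R, ∃ P : MvPolynomial (Fin e) F, P ≠ 0 ∧
        ∀ c ∈ C1, MvPolynomial.eval (fun i => y i (par m.1 c)) P = 0 := by
      intro m
      by_contra! hcon
      apply hlt
      apply dim_ge hC.irr (y := fun i c => y i (par m.1 c)) (fun i => hpar m.1 _ (hy i))
      intro P hP
      by_contra hP0
      obtain ⟨c, hc, hc'⟩ := hcon P hP0
      exact hc' (hP c hc)
    choose P hP0 hPv using hP
    haveI : Finite R := hR
    cases nonempty_fintype R
    obtain ⟨η, hη⟩ := pick (Q * ∏ m, P m) (mul_ne_zero hQ (Finset.prod_ne_zero_iff.2 fun m _ => hP0 m))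
    rw [map_mul, map_prod] at hη
    obtain ⟨⟨k, c⟩, ⟨hk, hc⟩, hz, hhc, hyv⟩ := HQ η (left_ne_zero_of_mul hη)
    have hη2 := Finset.prod_ne_zero_iff.1 (right_ne_zero_of_mul hη)
    have hk0 : k0 ∈ K := hk0
    have hk : k ∈ K := hk
    have hc : c ∈ C1 := hc
    have hc0 : c0 ∈ C1 := hc0
    -- k0⁻¹ k permutes the idempotents
    have heq : k * (s * c) * k⁻¹ = k0 * (s * c0) * k0⁻¹ := hz.trans hz0.symm
    have heq' : (k0⁻¹ * k) * (s * c) * (k0⁻¹ * k)⁻¹ = s * c0 := by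
      calc _ = k0⁻¹ * (k * (s * c) * k⁻¹) * k0 := by group
        _ = _ := by rw [heq]; group
    have hsc : ∀ c ∈ C1, ∀ i, mat (s * c) * p i = p i * mat (s * c) := fun c hc i =>
      cj_eq_self.1 (((centr K p).mul_mem hs (hC.le hc)).2 i)
    have hm : k0⁻¹ * k ∈ normp K p := by
      refine ⟨K.mul_mem (K.inv_mem hk0) hk, ?_⟩
      have hx : mat (s * c0) = cj (k0⁻¹ * k) (mat (s * c)) := by rw [cj_mat, heq']
      obtain ⟨σ, hσ⟩ := perm_lemma (hp.cj (k0⁻¹ * k)) hp (x := mat (s * c0))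
        (fun i => by rw [hx, ← cj_mul, ← cj_mul, hsc c hc]) (hsc c0 hc0)
        (b := fun i => b i c) (b' := fun i => b i c0) ((hiff c).1 hhc)
        (fun i => by
          rw [hx, ← cj_one (k0⁻¹ * k), ← cj_smul, ← cj_sub, ← cj_pow, ← cj_mul, hbs c hc, cj_zero])
        (hbs c0 hc0)
      exact ⟨σ, hσ⟩
    obtain ⟨m, hmR, hmc⟩ := hRcov _ hm
    apply hη2 ⟨m, hmR⟩ (Finset.mem_univ _)
    have hpp : par m (m⁻¹ * (k0⁻¹ * k)) = ⟨k, c⟩ := by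
      simp only [par, mul_inv_cancel_left]
      rw [← heq']
      ext1 <;> simp only [] <;> group
    have := hPv ⟨m, hmR⟩ _ hmc
    simp only [hpp] at this
    rw [← this]
    exact congrArg (fun η => MvPolynomial.eval η (P ⟨m, hmR⟩)) (funext fun i => (hyv i).symm)
  have hcl : (K : Set (GL (Fin n) F)) ⊆ closure (φ '' S) := by
    apply eq_of_dim ((hφ.regOn S).irr_image hSirr) hK him
    have := dim_prod hK hC.irr
    change _ ≤ zdim S at this
    omega
  refine ⟨g, hg, ?_, ?_⟩
  · obtain ⟨x, hx, hgx⟩ := hgne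
    exact ⟨φ x, him ⟨x, hx, rfl⟩, hgx⟩
  · intro z hz hgz
    obtain ⟨Q, hQ, HQ⟩ := H z (hcl hz) hgz
    obtain ⟨η, hη⟩ := pick Q hQ
    obtain ⟨⟨k, c⟩, ⟨hk, hc⟩, hz', hhc, -⟩ := HQ η hη
    exact ⟨k, hk, c, hc, (hiff c).1 hhc, hz'.symm⟩

end idem
end DPD

namespace DPD

universe u

section jordan
variable {F : Type u} [Field F] {n r : ℕ}

/-- Right translation of functions. -/
def rt (c : GL (Fin n) F) : Module.End F (GL (Fin n) F → F) := LinearMap.funLeft F F (fun x => x * c)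

theorem rt_apply (c : GL (Fin n) F) (f : GL (Fin n) F → F) (x : GL (Fin n) F) :
    rt c f x = f (x * c) := rfl

theorem rt_pow (c : GL (Fin n) F) (k : ℕ) (f : GL (Fin n) F → F) (x : GL (Fin n) F) :
    (rt c ^ k) f x = f (x * c ^ k) := by
  induction k generalizing x with
  | zero => simp
  | succ k ih =>
    rw [pow_succ', Module.End.mul_apply, rt_apply, ih, mul_assoc, ← pow_succ']

theorem rt_mul (c : GL (Fin n) F) (f g : GL (Fin n) F → F) :
    rt c (f * g) = rt c f * rt c g := rfl

/-- Joint generalized eigenfunctions. -/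
def gW (c d : GL (Fin n) F) (μ : F) : Submodule F (GL (Fin n) F → F) :=
  LinearMap.ker (rt d - μ • 1) ⊓ (rt c).maxGenEigenspace μ

theorem mem_gW {c d : GL (Fin n) F} {μ : F} {f : GL (Fin n) F → F} :
    f ∈ gW c d μ ↔ rt d f = μ • f ∧ ∃ k : ℕ, ((rt c - μ • 1 : Module.End F (GL (Fin n) F → F)) ^ k) f = 0 := by
  unfold gW
  rw [Submodule.mem_inf, LinearMap.mem_ker, LinearMap.sub_apply, sub_eq_zero,
    Module.End.mem_maxGenEigenspace]
  rfl

theorem gen_mul (c : GL (Fin n) F) (μ ν : F) (N : ℕ) : ∀ (k l : ℕ), k + l = N →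
    ∀ f g : GL (Fin n) F → F, ((rt c - μ • 1) ^ k) f = 0 → ((rt c - ν • 1) ^ l) g = 0 →
      ((rt c - (μ * ν) • 1) ^ N) (f * g) = 0 := by
  induction N with
  | zero =>
    intro k l h f g hf hg
    obtain rfl : k = 0 := by omega
    have hf : f = 0 := hf
    simp [hf]
  | succ N ih =>
    intro k l h f g hf hg
    rcases Nat.eq_zero_or_pos k with rfl | hk
    · have hf : f = 0 := hf
      simp [hf]
    rcases Nat.eq_zero_or_pos l with rfl | hl
    · have hg : g = 0 := hg
      simp [hg]
    obtain ⟨k, rfl⟩ := Nat.exists_eq_succ_of_ne_zero hk.ne'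
    obtain ⟨l, rfl⟩ := Nat.exists_eq_succ_of_ne_zero hl.ne'
    have e : (rt c - (μ * ν) • 1) (f * g) =
        ((rt c - μ • 1) f) * rt c g + μ • (f * ((rt c - ν • 1) g)) := by
      simp only [LinearMap.sub_apply, LinearMap.smul_apply, Module.End.one_apply, rt_mul]
      ext x
      simp only [Pi.add_apply, Pi.sub_apply, Pi.mul_apply, Pi.smul_apply, smul_eq_mul]
      ring
    rw [pow_succ, Module.End.mul_apply, e, map_add, map_smul]
    rw [ih k (l + 1) (by omega) _ _ (by rw [← Module.End.mul_apply, ← pow_succ]; exact hf) ?_,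
      ih (k + 1) l (by omega) _ _ hf (by rw [← Module.End.mul_apply, ← pow_succ]; exact hg)]
    · simp
    · have hcom : Commute ((rt c - ν • 1) ^ (l + 1)) (rt c) := by
        apply Commute.pow_left
        change (rt c - ν • 1) * rt c = rt c * (rt c - ν • 1)
        rw [sub_mul, mul_sub]; simp
      rw [← Module.End.mul_apply, hcom.eq, Module.End.mul_apply, hg, map_zero]

theorem gW_mul {c d : GL (Fin n) F} {μ ν : F} {f g : GL (Fin n) F → F} (hf : f ∈ gW c d μ)
    (hg : g ∈ gW c d ν) : f * g ∈ gW c d (μ * ν) := by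
  rw [mem_gW] at *
  obtain ⟨h1, k, hk⟩ := hf
  obtain ⟨h2, l, hl⟩ := hg
  refine ⟨?_, k + l, gen_mul c μ ν _ k l rfl f g hk hl⟩
  rw [rt_mul, h1, h2]
  ext x
  simp only [Pi.mul_apply, Pi.smul_apply, smul_eq_mul]; ring

theorem gM_mul {c d : GL (Fin n) F} {f g : GL (Fin n) F → F} (hf : f ∈ ⨆ μ, gW c d μ)
    (hg : g ∈ ⨆ μ, gW c d μ) : f * g ∈ ⨆ μ, gW c d μ := by
  induction hf using Submodule.iSup_induction' with
  | zero => simp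
  | add x y hx hy h1 h2 => rw [add_mul]; exact Submodule.add_mem _ h1 h2
  | mem μ x hx =>
    induction hg using Submodule.iSup_induction' with
    | zero => simp
    | add x y hx hy h1 h2 => rw [mul_add]; exact Submodule.add_mem _ h1 h2
    | mem ν y hy => exact Submodule.mem_iSup_of_mem (μ * ν) (gW_mul hx hy)

theorem gM_entry {c d : GL (Fin n) F} {p : Fin r → Matrix (Fin n) (Fin n) F} (hp : Idem p)
    {b : Fin r → F} (hcb : ∀ i, (mat c - b i • 1) ^ n * p i = 0)
    (hd : mat d = ∑ i, b i • p i) (u v : Fin n) :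
    (fun x : GL (Fin n) F => mat x u v) ∈ ⨆ μ, gW c d μ := by
  have e : (fun x : GL (Fin n) F => mat x u v) = ∑ i, fun x : GL (Fin n) F => (mat x * p i) u v := by
    ext x
    rw [Finset.sum_apply, ← Matrix.sum_apply, ← Finset.mul_sum, hp.sum, mul_one]
  rw [e]
  refine Submodule.sum_mem _ fun i _ => Submodule.mem_iSup_of_mem (b i) ?_
  rw [mem_gW]
  have hdp : mat d * p i = b i • p i := by
    rw [hd, Finset.sum_mul, Finset.sum_eq_single i]
    · rw [Matrix.smul_mul, hp.idem]
    · intro j _ hj; rw [Matrix.smul_mul, hp.orth j i hj, smul_zero]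
    · simp
  refine ⟨?_, n, ?_⟩
  · ext x
    rw [rt_apply, mat_mul, mul_assoc, hdp]
    simp
  · have key : ∀ (k : ℕ) (q : Matrix (Fin n) (Fin n) F),
        ((rt c - b i • 1) ^ k) (fun x : GL (Fin n) F => (mat x * q) u v) =
          fun x : GL (Fin n) F => (mat x * ((mat c - b i • 1) ^ k * q)) u v := by
      intro k
      induction k with
      | zero => intro q; simp
      | succ k ih =>
        intro q
        rw [pow_succ, Module.End.mul_apply]
        have : (rt c - b i • 1) (fun x : GL (Fin n) F => (mat x * q) u v) =
            fun x : GL (Fin n) F => (mat x * ((mat c - b i • 1) * q)) u v := by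
          ext x
          rw [LinearMap.sub_apply, Pi.sub_apply, rt_apply, mat_mul, sub_mul, mul_sub, Matrix.sub_apply,
            mul_assoc]
          simp
        rw [this, ih, pow_succ, mul_assoc]
    rw [key, hcb]
    ext x; simp

theorem gM_poly {c d : GL (Fin n) F} {p : Fin r → Matrix (Fin n) (Fin n) F} (hp : Idem p)
    {b : Fin r → F} (hcb : ∀ i, (mat c - b i • 1) ^ n * p i = 0)
    (hd : mat d = ∑ i, b i • p i) (P : MvPolynomial (Fin n × Fin n) F) :
    (fun x : GL (Fin n) F => MvPolynomial.eval (fun q => mat x q.1 q.2) P) ∈ ⨆ μ, gW c d μ := by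
  induction P using MvPolynomial.induction_on with
  | C a =>
    refine Submodule.mem_iSup_of_mem 1 ?_
    rw [mem_gW]
    refine ⟨by ext x; simp [rt_apply], 1, ?_⟩
    ext x; simp [rt_apply]
  | add P Q h1 h2 => simp only [map_add]; exact Submodule.add_mem _ h1 h2
  | mul_X P q h =>
    simp only [map_mul, MvPolynomial.eval_X]
    exact gM_mul h (gM_entry hp hcb hd q.1 q.2)

theorem jordan {K : Subgroup (GL (Fin n) F)} (hK : IsClosed (K : Set (GL (Fin n) F)))
    {c d : GL (Fin n) F} (hc : c ∈ K) {p : Fin r → Matrix (Fin n) (Fin n) F} (hp : Idem p)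
    {b : Fin r → F} (hcb : ∀ i, (mat c - b i • 1) ^ n * p i = 0)
    (hd : mat d = ∑ i, b i • p i) : d ∈ K := by
  classical
  obtain ⟨_, ⟨I, rfl⟩, hI⟩ := glz_iff.2 hK
  have hmem : ∀ x, x ∈ K ↔ ∀ P ∈ I, MvPolynomial.eval (fun q => mat x q.1 q.2) P = 0 := by
    intro x
    rw [← SetLike.mem_coe, hI]; rfl
  rw [hmem]
  intro P hP
  have hM := gM_poly hp hcb hd P
  set f : GL (Fin n) F → F := fun x => MvPolynomial.eval (fun q => mat x q.1 q.2) P with hf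
  have hfK : ∀ x ∈ K, f x = 0 := fun x hx => (hmem x).1 hx P hP
  obtain ⟨g, hg, hgf⟩ := (Submodule.mem_iSup_iff_exists_finsupp _ _).1 hM
  have hg' := fun μ => (mem_gW.1 (hg μ)).2
  choose N hN using hg'
  have hstab : ∀ (Q : Polynomial F), ∀ x ∈ K, (Polynomial.aeval (rt c) Q) f x = 0 := by
    intro Q x hx
    rw [Polynomial.aeval_eq_sum_range, LinearMap.sum_apply, Finset.sum_apply]
    refine Finset.sum_eq_zero fun i _ => ?_
    rw [LinearMap.smul_apply, Pi.smul_apply, rt_pow, hfK _ (K.mul_mem hx (K.pow_mem hc i)), smul_zero]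
  have hdiv : ∀ μ (Q : Polynomial F), (Polynomial.X - Polynomial.C μ) ^ N μ ∣ Q →
      (Polynomial.aeval (rt c) Q) (g μ) = 0 := by
    rintro μ _ ⟨Q, rfl⟩
    rw [mul_comm, map_mul, Module.End.mul_apply, map_pow, map_sub, Polynomial.aeval_X,
      Polynomial.aeval_C, Algebra.algebraMap_eq_smul_one, hN, map_zero]
  have hgK : ∀ μ ∈ g.support, ∀ x ∈ K, g μ x = 0 := by
    intro μ hμ x hx
    have hcop : IsCoprime ((Polynomial.X - Polynomial.C μ) ^ N μ)
        (∏ ν ∈ g.support.erase μ, (Polynomial.X - Polynomial.C ν) ^ N ν) := by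
      apply IsCoprime.prod_right
      intro ν hν
      exact (Polynomial.isCoprime_X_sub_C_of_isUnit_sub
        (sub_ne_zero.2 (Finset.ne_of_mem_erase hν).symm).isUnit).pow
    obtain ⟨u, v, huv⟩ := hcop
    have h1 := hstab (v * ∏ ν ∈ g.support.erase μ, (Polynomial.X - Polynomial.C ν) ^ N ν) x hx
    have h2 : (Polynomial.aeval (rt c) (v * ∏ ν ∈ g.support.erase μ,
        (Polynomial.X - Polynomial.C ν) ^ N ν)) f = g μ := by
      rw [← hgf, Finsupp.sum, map_sum, Finset.sum_eq_single μ]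
      · have h3 := congrArg (fun Q => (Polynomial.aeval (rt c) Q) (g μ)) huv
        simp only [map_add, map_one, LinearMap.add_apply, Module.End.one_apply] at h3
        rw [hdiv μ _ (Dvd.intro_left _ rfl), zero_add] at h3
        exact h3
      · intro ν hν hne
        apply hdiv
        exact Dvd.dvd.mul_left (Finset.dvd_prod_of_mem _ (Finset.mem_erase.2 ⟨hne, hν⟩)) _
      · intro h; exact absurd hμ h
    rw [← h2]; exact h1
  change f d = 0
  rw [← hgf, Finsupp.sum, Finset.sum_apply]
  refine Finset.sum_eq_zero fun μ hμ => ?_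
  have h1 := congrFun (mem_gW.1 (hg μ)).1 1
  rw [rt_apply, one_mul] at h1
  rw [h1, Pi.smul_apply, hgK μ hμ 1 K.one_mem, smul_zero]

end jordan
end DPD

namespace DPD

universe u

section spectral
open Matrix
variable {F : Type u} [Field F] {n r : ℕ}

/-- The finite set of eigenvalues. -/
noncomputable def evs (A : Matrix (Fin n) (Fin n) F) : Finset F := by
  classical exact A.charpoly.roots.toFinset

theorem mem_evs {A : Matrix (Fin n) (Fin n) F} {μ : F} :
    μ ∈ evs A ↔ ∃ v ≠ 0, A *ᵥ v = μ • v := by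
  classical
  unfold evs
  rw [Multiset.mem_toFinset, Polynomial.mem_roots (Matrix.charpoly_monic A).ne_zero,
    Polynomial.IsRoot, Matrix.eval_charpoly, ← Matrix.exists_mulVec_eq_zero_iff]
  refine exists_congr fun v => and_congr_right fun _ => ?_
  rw [Matrix.sub_mulVec, sub_eq_zero, Matrix.scalar_apply, ← Matrix.smul_one_eq_diagonal,
    Matrix.smul_mulVec, Matrix.one_mulVec, eq_comm]

theorem evs_card (A : Matrix (Fin n) (Fin n) F) : (evs A).card ≤ n := by
  classical
  unfold evs
  refine (Multiset.toFinset_card_le _).trans ((Polynomial.card_roots' _).trans ?_)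
  simp

/-- Cayley–Hamilton with exponents rounded up. -/
theorem ch_prod [IsAlgClosed F] (A : Matrix (Fin n) (Fin n) F) {Q : Polynomial F}
    (hQ : ∀ μ ∈ evs A, (Polynomial.X - Polynomial.C μ) ^ n ∣ Q) : Polynomial.aeval A Q = 0 := by
  classical
  have hdvd : A.charpoly ∣ Q := by
    rw [(IsAlgClosed.splits A.charpoly).eq_prod_roots_of_monic (Matrix.charpoly_monic A),
      Finset.prod_multiset_map_count]
    apply Finset.prod_dvd_of_coprime
    · intro a _ b _ hab
      exact (Polynomial.isCoprime_X_sub_C_of_isUnit_sub (sub_ne_zero.2 hab).isUnit).pow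
    · intro a ha
      refine (pow_dvd_pow _ ?_).trans (hQ a (by unfold evs; exact ha))
      refine (Multiset.count_le_card _ _).trans ((Polynomial.card_roots' _).trans ?_)
      simp
  obtain ⟨R, rfl⟩ := hdvd
  rw [map_mul, Matrix.aeval_self_charpoly, zero_mul]

theorem aeval_eigen {A : Matrix (Fin n) (Fin n) F} {v : Fin n → F} {μ : F} (h : A *ᵥ v = μ • v)
    (Q : Polynomial F) : Polynomial.aeval A Q *ᵥ v = Q.eval μ • v := by
  induction Q using Polynomial.induction_on' with
  | add p q hp hq => rw [map_add, Matrix.add_mulVec, hp, hq, Polynomial.eval_add, add_smul]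
  | monomial k a =>
    rw [Polynomial.aeval_monomial, Polynomial.eval_monomial, Algebra.algebraMap_eq_smul_one,
      smul_mul_assoc, one_mul, Matrix.smul_mulVec, mul_smul]
    congr 1
    induction k with
    | zero => simp
    | succ k ih => rw [pow_succ, ← Matrix.mulVec_mulVec, h, Matrix.mulVec_smul, ih, smul_smul,
        pow_succ, mul_comm]

theorem spectral_idem [IsAlgClosed F] (hn : 0 < n) (A : Matrix (Fin n) (Fin n) F)
    (hr : (evs A).card = r) : ∃ (p : Fin r → Matrix (Fin n) (Fin n) F) (lam : Fin r → F),
      Idem p ∧ Function.Injective lam ∧ (∀ i, (A - lam i • 1) ^ n * p i = 0) ∧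
      (∀ i, A * p i = p i * A) ∧ (∀ i, lam i ∈ evs A) := by
  classical
  let ε := (evs A).equivFinOfCardEq hr
  let lam : Fin r → F := fun i => (ε.symm i).1
  have hlam : Function.Injective lam := fun i j h => ε.symm.injective (Subtype.ext h)
  have hsurj : ∀ μ ∈ evs A, ∃ i, lam i = μ := fun μ hμ => ⟨ε ⟨μ, hμ⟩, by simp [lam]⟩
  have hmem : ∀ i, lam i ∈ evs A := fun i => (ε.symm i).2
  have hcop : ∀ i j, i ≠ j → IsCoprime ((Polynomial.X - Polynomial.C (lam i)) ^ n)
      ((Polynomial.X - Polynomial.C (lam j)) ^ n) := fun i j hij =>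
    (Polynomial.isCoprime_X_sub_C_of_isUnit_sub (sub_ne_zero.2 fun h => hij (hlam h)).isUnit).pow
  -- r > 0
  have hne : Nonempty (Fin r) := by
    have : A.charpoly.degree ≠ 0 := by
      rw [Matrix.charpoly_degree_eq_dim]; simp; omega
    obtain ⟨μ, hμ⟩ := IsAlgClosed.exists_root A.charpoly this
    have : μ ∈ evs A := by
      unfold evs
      rw [Multiset.mem_toFinset, Polynomial.mem_roots (Matrix.charpoly_monic A).ne_zero]; exact hμ
    exact ⟨(hsurj μ this).choose⟩
  obtain ⟨a, ha⟩ := (exists_sum_eq_one_iff_pairwise_coprime' (I := Fin r)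
    (s := fun i => (Polynomial.X - Polynomial.C (lam i)) ^ n)).2 (fun i j hij => hcop i j hij)
  let q : Fin r → Polynomial F := fun i => a i * ∏ j ∈ {i}ᶜ, (Polynomial.X - Polynomial.C (lam j)) ^ n
  have hq : ∑ i, q i = 1 := ha
  have hqd : ∀ i j, i ≠ j → (Polynomial.X - Polynomial.C (lam j)) ^ n ∣ q i := by
    intro i j hij
    exact Dvd.dvd.mul_left (Finset.dvd_prod_of_mem (fun j => (Polynomial.X - Polynomial.C (lam j)) ^ n)
      (by simp [hij.symm])) _
  let p : Fin r → Matrix (Fin n) (Fin n) F := fun i => Polynomial.aeval A (q i)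
  have orth : ∀ i j, i ≠ j → p i * p j = 0 := by
    intro i j hij
    simp only [p]
    rw [← map_mul]
    apply ch_prod
    intro μ hμ
    obtain ⟨k, rfl⟩ := hsurj μ hμ
    by_cases hk : k = i
    · rw [hk]; exact Dvd.dvd.mul_left (hqd j i hij.symm) _
    · exact Dvd.dvd.mul_right (hqd i k (Ne.symm hk)) _
  have sum : ∑ i, p i = 1 := by
    simp only [p]; rw [← map_sum, hq, map_one]
  refine ⟨p, lam, ⟨?_, orth, sum, ?_⟩, hlam, ?_, ?_, hmem⟩
  · intro i
    conv_rhs => rw [← mul_one (p i), ← sum, Finset.mul_sum]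
    rw [Finset.sum_eq_single i]
    · intro j _ hj; exact orth i j hj.symm
    · simp
  · intro i h0
    obtain ⟨v, hv, hAv⟩ := mem_evs.1 (hmem i)
    apply hv
    have : (∑ j, p j) *ᵥ v = 0 := by
      rw [Matrix.sum_mulVec]
      refine Finset.sum_eq_zero fun j _ => ?_
      by_cases hj : j = i
      · rw [hj, h0, Matrix.zero_mulVec]
      · simp only [p]
        rw [aeval_eigen hAv]
        obtain ⟨R, hR⟩ := hqd j i hj
        rw [hR]; simp [hn.ne']
    rwa [sum, Matrix.one_mulVec] at this
  · intro i
    have : (A - lam i • 1) ^ n * p i = Polynomial.aeval A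
        ((Polynomial.X - Polynomial.C (lam i)) ^ n * q i) := by
      simp only [map_mul, map_pow, map_sub, Polynomial.aeval_X, Polynomial.aeval_C,
        Algebra.algebraMap_eq_smul_one, p]
    rw [this]
    apply ch_prod
    intro μ hμ
    obtain ⟨k, rfl⟩ := hsurj μ hμ
    by_cases hk : k = i
    · rw [hk]; exact Dvd.intro _ rfl
    · exact Dvd.dvd.mul_left (hqd i k (Ne.symm hk)) _
  · intro i
    simp only [p]
    have := congrArg (Polynomial.aeval A) (mul_comm Polynomial.X (q i))
    rw [map_mul (Polynomial.aeval A) Polynomial.X (q i), map_mul (Polynomial.aeval A) (q i) Polynomial.X, Polynomial.aeval_X] at this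
    exact this

/-- Eigenvalues on a block. -/
def bev (p A : Matrix (Fin n) (Fin n) F) : Set F := {μ | ∃ v ≠ 0, p *ᵥ v = v ∧ A *ᵥ v = μ • v}

theorem single_of [IsAlgClosed F] {p A : Matrix (Fin n) (Fin n) F} (hA : A * p = p * A)
    (hp : p * p = p) {ν : F} (h : ∀ μ ∈ bev p A, μ = ν) : (A - ν • 1) ^ n * p = 0 := by
  let B := A * p + ν • (1 - p)
  have hB : Polynomial.aeval B ((Polynomial.X - Polynomial.C ν) ^ n) = 0 := by
    apply ch_prod
    intro μ hμ
    obtain ⟨v, hv, hBv⟩ := mem_evs.1 hμ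
    have : μ = ν := by
      by_contra hne
      have e1 : (1 - p) * B = ν • (1 - p) := by
        simp only [B]
        rw [mul_add, sub_mul, one_mul, ← mul_assoc, ← hA, mul_assoc, hp, sub_self, zero_add]
        rw [mul_smul_comm]
        congr 1
        rw [mul_sub, sub_mul, sub_mul, hp]; simp
      have e2 := congrArg ((1 - p) *ᵥ ·) hBv
      simp only [Matrix.mulVec_mulVec] at e2
      rw [e1, Matrix.mulVec_smul, Matrix.smul_mulVec] at e2
      have e3 : (1 - p) *ᵥ v = 0 := by
        have : (ν - μ) • ((1 - p) *ᵥ v) = 0 := by rw [sub_smul, e2, sub_self]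
        exact (smul_eq_zero.1 this).resolve_left (sub_ne_zero.2 (Ne.symm hne))
      have e4 : p *ᵥ v = v := by
        rw [Matrix.sub_mulVec, Matrix.one_mulVec, sub_eq_zero] at e3; exact e3.symm
      apply hne
      apply h
      refine ⟨v, hv, e4, ?_⟩
      rw [← hBv]
      simp only [B]
      rw [Matrix.add_mulVec, Matrix.smul_mulVec, e3, smul_zero, add_zero, ← Matrix.mulVec_mulVec, e4]
    rw [this]
  have key : ∀ k : ℕ, (A - ν • 1) ^ k * p = (B - ν • 1) ^ k * p := by
    intro k
    have e0 : (A - ν • 1) * p = (B - ν • 1) * p := by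
      simp only [B]
      rw [sub_mul, sub_mul, add_mul, mul_assoc A, hp]; simp [sub_mul, hp]
    have e5 : (B - ν • 1) * p = p * (B - ν • 1) := by
      simp only [B]
      rw [sub_mul, mul_sub, add_mul, mul_add, mul_assoc, hp, ← mul_assoc, ← hA, mul_assoc, hp]
      simp [sub_mul, mul_sub, hp]
    induction k with
    | zero => simp
    | succ k ih =>
      rw [pow_succ, mul_assoc, e0, e5, ← mul_assoc, ih, mul_assoc, ← e5, ← mul_assoc, ← pow_succ]
  rw [key]
  rw [map_pow, map_sub, Polynomial.aeval_X, Polynomial.aeval_C, Algebra.algebraMap_eq_smul_one] at hB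
  rw [hB, zero_mul]

theorem bev_nonempty [IsAlgClosed F] {p A : Matrix (Fin n) (Fin n) F} (hA : A * p = p * A)
    (hp : p * p = p) (hp0 : p ≠ 0) : (bev p A).Nonempty := by
  by_contra hc
  rw [Set.not_nonempty_iff_eq_empty] at hc
  have h : ∀ ν : F, (A - ν • 1) ^ n * p = 0 := fun ν => single_of hA hp (by simp [hc])
  exact hp0 (coprime_kill zero_ne_one n (h 0) (h 1))

theorem bev_left {p A : Matrix (Fin n) (Fin n) F} (hA : A * p = p * A)
    (hp : p * p = p) {μ : F} (h : μ ∈ bev p A) : ∃ w ≠ 0, w ᵥ* p = w ∧ w ᵥ* A = μ • w := by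
  obtain ⟨v, hv, hpv, hAv⟩ := h
  have hdet : ((A - μ • 1) * p + (1 - p)).det = 0 := by
    rw [← Matrix.exists_mulVec_eq_zero_iff]
    refine ⟨v, hv, ?_⟩
    rw [Matrix.add_mulVec, ← Matrix.mulVec_mulVec, hpv, Matrix.sub_mulVec, Matrix.sub_mulVec, hAv, hpv]
    simp [Matrix.smul_mulVec]
  obtain ⟨w, hw, hw0⟩ := Matrix.exists_vecMul_eq_zero_iff.2 hdet
  have e1 : w ᵥ* (1 - p) = 0 := by
    have := congrArg (· ᵥ* (1 - p)) hw0
    simp only [Matrix.vecMul_vecMul, Matrix.zero_vecMul] at this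
    rw [← this]
    congr 1
    rw [add_mul, mul_assoc]
    simp [mul_sub, sub_mul, hp]
  have e2 : w ᵥ* p = w := by
    rw [Matrix.vecMul_sub, Matrix.vecMul_one, sub_eq_zero] at e1; exact e1.symm
  refine ⟨w, hw, e2, ?_⟩
  rw [Matrix.vecMul_add, e1, add_zero, sub_mul, hA, smul_mul_assoc, one_mul, Matrix.vecMul_sub,
    ← Matrix.vecMul_vecMul, e2, Matrix.vecMul_smul, e2, sub_eq_zero] at hw0
  exact hw0

theorem bev_sub_evs {p A : Matrix (Fin n) (Fin n) F} {μ : F} (h : μ ∈ bev p A) : μ ∈ evs A := by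
  obtain ⟨v, hv, -, h⟩ := h
  exact mem_evs.2 ⟨v, hv, h⟩

/-- Disjoint block eigenvalues and few eigenvalues: every block has a single one. -/
theorem block_single [IsAlgClosed F] {p : Fin r → Matrix (Fin n) (Fin n) F} (hp : Idem p)
    {A : Matrix (Fin n) (Fin n) F} (hA : ∀ i, A * p i = p i * A) (hr : (evs A).card ≤ r)
    (hdis : ∀ i j, i ≠ j → ∀ μ, μ ∈ bev (p i) A → μ ∉ bev (p j) A) (i : Fin r) :
    ∃ ν : F, (A - ν • 1) ^ n * p i = 0 := by
  classical
  have hne := fun i => bev_nonempty (hA i) (hp.idem i) (hp.ne i)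
  choose ν hν using hne
  refine ⟨ν i, single_of (hA i) (hp.idem i) fun μ hμ => ?_⟩
  by_contra hc
  have hinj : Function.Injective ν := by
    intro j k hjk
    by_contra hne
    exact hdis j k hne (ν j) (hν j) (hjk ▸ hν k)
  have hnot : μ ∉ Finset.univ.image ν := by
    simp only [Finset.mem_image, Finset.mem_univ, true_and, not_exists]
    intro j hj
    by_cases hji : j = i
    · exact hc (by rw [← hj, hji])
    · exact hdis i j (Ne.symm hji) μ hμ (hj ▸ hν j)
  have hsub : insert μ (Finset.univ.image ν) ⊆ evs A := by
    intro x hx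
    rcases Finset.mem_insert.1 hx with rfl | hx
    · exact bev_sub_evs hμ
    · obtain ⟨j, -, rfl⟩ := Finset.mem_image.1 hx
      exact bev_sub_evs (hν j)
  have := Finset.card_le_card hsub
  rw [Finset.card_insert_of_notMem hnot, Finset.card_image_of_injective _ hinj, Finset.card_univ,
    Fintype.card_fin] at this
  omega

end spectral
end DPD

namespace DPD

universe u

section single
open Matrix
variable {F : Type u} [Field F] {n r : ℕ}

theorem reg_detLin {α : Type u} [AV F α]
    {L : α → (Matrix (Fin n) (Fin n) F →ₗ[F] Matrix (Fin n) (Fin n) F)}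
    (h : ∀ Y i j, Reg (fun a => L a Y i j)) : Reg (fun a => LinearMap.det (L a)) := by
  classical
  have : ∀ a, LinearMap.det (L a) =
      (LinearMap.toMatrix (Matrix.stdBasis F (Fin n) (Fin n)) (Matrix.stdBasis F (Fin n) (Fin n)) (L a)).det :=
    fun a => (LinearMap.det_toMatrix _ _).symm
  simp only [this]
  apply Reg.det
  intro x y
  have : ∀ a, LinearMap.toMatrix (Matrix.stdBasis F (Fin n) (Fin n))
      (Matrix.stdBasis F (Fin n) (Fin n)) (L a) x y
      = L a (Matrix.stdBasis F (Fin n) (Fin n) y) x.1 x.2 := by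
    intro a
    rw [LinearMap.toMatrix_apply]
    rfl
  simp only [this]
  exact h _ _ _

/-- Iterated commutator. -/
def adk (A : Matrix (Fin n) (Fin n) F) : ℕ → Matrix (Fin n) (Fin n) F → Matrix (Fin n) (Fin n) F
  | 0, Y => Y
  | k + 1, Y => A * adk A k Y - adk A k Y * A

theorem adk_sub (A : Matrix (Fin n) (Fin n) F) (k : ℕ) (Y Y' : Matrix (Fin n) (Fin n) F) :
    adk A k (Y - Y') = adk A k Y - adk A k Y' := by
  induction k with
  | zero => rfl
  | succ k ih => simp only [adk, ih]; noncomm_ring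

theorem adk_succ' (A : Matrix (Fin n) (Fin n) F) (k : ℕ) (Y : Matrix (Fin n) (Fin n) F) :
    adk A (k + 1) Y = adk A k (A * Y - Y * A) := by
  induction k with
  | zero => rfl
  | succ k ih => rw [adk, ih]; rfl

theorem adk_zero (A : Matrix (Fin n) (Fin n) F) (k : ℕ) : adk A k 0 = 0 := by
  induction k with
  | zero => rfl
  | succ k ih => simp only [adk, ih]; simp

theorem adk_kill {A : Matrix (Fin n) (Fin n) F} {ν : F} (k : ℕ) :
    ∀ (Y : Matrix (Fin n) (Fin n) F) (a b : ℕ), a + b = k → (A - ν • 1) ^ a * Y = 0 →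
      Y * (A - ν • 1) ^ b = 0 → adk A k Y = 0 := by
  induction k with
  | zero =>
    intro Y a b hab h1 h2
    have : a = 0 := by omega
    subst this
    rw [pow_zero, one_mul] at h1
    exact h1
  | succ k ih =>
    intro Y a b hab h1 h2
    rcases a with _ | a
    · rw [pow_zero, one_mul] at h1
      rw [h1, adk_zero]
    rcases b with _ | b
    · rw [pow_zero, mul_one] at h2
      rw [h2, adk_zero]
    rw [adk_succ']
    have : A * Y - Y * A = (A - ν • 1) * Y - Y * (A - ν • 1) := by
      rw [sub_mul, mul_sub, smul_mul_assoc, mul_smul_comm, one_mul, mul_one]; abel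
    rw [this, adk_sub, ih _ a (b + 1) (by omega), ih _ (a + 1) b (by omega), sub_zero]
    · rw [← mul_assoc, h1, zero_mul]
    · rw [mul_assoc, ← pow_succ', h2]
    · rw [← mul_assoc, ← pow_succ, h1]
    · rw [mul_assoc, h2, mul_zero]

theorem adk_eigen {A : Matrix (Fin n) (Fin n) F} {μ ν : F} {v w : Fin n → F}
    (hv : A *ᵥ v = μ • v) (hw : w ᵥ* A = ν • w) (k : ℕ) :
    adk A k (vecMulVec v w) = (μ - ν) ^ k • vecMulVec v w := by
  induction k with
  | zero => simp [adk]
  | succ k ih =>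
    rw [adk, ih, mul_smul_comm, smul_mul_assoc, Matrix.mul_vecMulVec, Matrix.vecMulVec_mul, hv, hw,
      Matrix.smul_vecMulVec, Matrix.vecMulVec_smul, ← smul_sub, ← sub_smul, smul_smul, pow_succ]

theorem vecMulVec_ne {v w : Fin n → F} (hv : v ≠ 0) (hw : w ≠ 0) : vecMulVec v w ≠ 0 := by
  intro h
  obtain ⟨i, hi⟩ := Function.ne_iff.1 hv
  obtain ⟨j, hj⟩ := Function.ne_iff.1 hw
  have := congrFun (congrFun h i) j
  rw [Matrix.vecMulVec_apply] at this
  exact (mul_ne_zero hi hj) this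

theorem reg_adk {α : Type u} [AV F α] {A : α → Matrix (Fin n) (Fin n) F}
    (hA : ∀ i j, Reg (fun a => A a i j)) (k : ℕ) (Y : Matrix (Fin n) (Fin n) F) :
    ∀ i j, Reg (fun a => adk (A a) k Y i j) := by
  induction k with
  | zero => exact fun i j => Reg.const _
  | succ k ih =>
    intro i j
    have h1 := Reg.matMul (A := A) (B := fun a => adk (A a) k Y) hA ih i j
    have h2 := Reg.matMul (A := fun a => adk (A a) k Y) (B := A) ih hA i j
    exact h1.sub h2

theorem reg_smul_mat (s : GL (Fin n) F) (i j : Fin n) :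
    Reg (fun c : GL (Fin n) F => mat (s * c) i j) :=
  (RegMap.mul (RegMap.constGL s) RegMap.id).entry i j

/-- The linear map detecting common eigenvalues of different blocks. -/
noncomputable def blockL (p : Fin r → Matrix (Fin n) (Fin n) F) (A : Matrix (Fin n) (Fin n) F) :
    Matrix (Fin n) (Fin n) F →ₗ[F] Matrix (Fin n) (Fin n) F where
  toFun X := (∑ i, ∑ j, if i = j then 0 else p i * (A * X - X * A) * p j) + ∑ i, p i * X * p i
  map_add' X Y := by
    simp only [mul_add, add_mul, mul_sub, sub_mul, Finset.sum_add_distrib]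
    have : ∀ i j, (if i = j then (0 : Matrix (Fin n) (Fin n) F) else p i * (A * X) * p j + p i * (A * Y) * p j -
        (p i * (X * A) * p j + p i * (Y * A) * p j)) =
        (if i = j then 0 else p i * (A * X) * p j - p i * (X * A) * p j) +
        (if i = j then 0 else p i * (A * Y) * p j - p i * (Y * A) * p j) := by
      intro i j; split_ifs
      · simp
      · abel
    simp only [this, Finset.sum_add_distrib]
    abel
  map_smul' a X := by
    simp only [mul_smul_comm, smul_mul_assoc, ← smul_sub, RingHom.id_apply, smul_add, Finset.smul_sum,
      smul_ite, smul_zero]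

theorem blockL_disjoint {p : Fin r → Matrix (Fin n) (Fin n) F} (hp : Idem p)
    {A : Matrix (Fin n) (Fin n) F} (hA : ∀ i, A * p i = p i * A)
    (hd : LinearMap.det (blockL p A) ≠ 0) :
    ∀ i j, i ≠ j → ∀ μ, μ ∈ bev (p i) A → μ ∉ bev (p j) A := by
  classical
  intro i j hij μ hi hj
  obtain ⟨v, hv, hpv, hAv⟩ := hi
  obtain ⟨w, hw, hpw, hAw⟩ := bev_left (hA j) (hp.idem j) hj
  apply hd
  rw [LinearMap.det_eq_zero_iff_ker_ne_bot, Submodule.ne_bot_iff]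
  refine ⟨vecMulVec v w, ?_, vecMulVec_ne hv hw⟩
  rw [LinearMap.mem_ker]
  change (∑ a, ∑ b, if a = b then 0 else p a * (A * vecMulVec v w - vecMulVec v w * A) * p b)
    + ∑ a, p a * vecMulVec v w * p a = 0
  have e1 : A * vecMulVec v w - vecMulVec v w * A = 0 := by
    rw [Matrix.mul_vecMulVec, Matrix.vecMulVec_mul, hAv, hAw, Matrix.smul_vecMulVec,
      Matrix.vecMulVec_smul, sub_self]
  have e2 : ∀ a, p a * vecMulVec v w * p a = 0 := by
    intro a
    by_cases ha : a = i
    · rw [mul_assoc, Matrix.vecMulVec_mul, ← hpw, Matrix.vecMul_vecMul, hp.orth j a (by rw [ha]; exact hij.symm)]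
      simp
    · rw [Matrix.mul_vecMulVec, ← hpv, Matrix.mulVec_mulVec, hp.orth a i ha]
      simp
  rw [Finset.sum_eq_zero fun a _ => e2 a, add_zero]
  refine Finset.sum_eq_zero fun a _ => Finset.sum_eq_zero fun b _ => ?_
  rw [e1]; simp

theorem blockL_base {p : Fin r → Matrix (Fin n) (Fin n) F} (hp : Idem p) {lam : Fin r → F}
    (hl : Function.Injective lam) {A : Matrix (Fin n) (Fin n) F} (hA : A = ∑ i, lam i • p i) :
    LinearMap.det (blockL p A) ≠ 0 := by
  classical
  have hAp : ∀ i, A * p i = lam i • p i := by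
    intro i
    rw [hA, Finset.sum_mul, Finset.sum_eq_single i]
    · rw [smul_mul_assoc, hp.idem]
    · intro j _ hj; rw [smul_mul_assoc, hp.orth j i hj, smul_zero]
    · simp
  have hpA : ∀ i, p i * A = lam i • p i := by
    intro i
    rw [hA, Finset.mul_sum, Finset.sum_eq_single i]
    · rw [mul_smul_comm, hp.idem]
    · intro j _ hj; rw [mul_smul_comm, hp.orth i j hj.symm, smul_zero]
    · simp
  intro hd
  rw [LinearMap.det_eq_zero_iff_ker_ne_bot, Submodule.ne_bot_iff] at hd
  obtain ⟨X, hX, hX0⟩ := hd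
  apply hX0
  rw [LinearMap.mem_ker] at hX
  change (∑ a, ∑ b, if a = b then 0 else p a * (A * X - X * A) * p b) + ∑ a, p a * X * p a = 0 at hX
  have hk : ∀ i j, p i * X * p j = 0 := by
    intro i j
    have h1 := congrArg (fun Y => p i * Y * p j) hX
    simp only [mul_add, add_mul, Finset.mul_sum, Finset.sum_mul, mul_zero, zero_mul] at h1
    rw [Finset.sum_eq_single i, Finset.sum_eq_single j, Finset.sum_eq_single i] at h1
    · by_cases hij : i = j
      · subst hij
        rw [if_pos rfl] at h1
        rw [mul_zero, zero_mul, zero_add] at h1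
        rw [← h1]
        have : p i * (p i * X * p i) * p i = (p i * p i) * X * (p i * p i) := by noncomm_ring
        rw [this, hp.idem]
      · rw [if_neg hij] at h1
        have e : p i * (p i * (A * X - X * A) * p j) * p j + p i * (p i * X * p i) * p j
          = (p i * p i) * A * X * (p j * p j) - (p i * p i) * X * (A * (p j * p j)) +
            p i * p i * X * (p i * p j) := by noncomm_ring
        rw [e, hp.idem, hp.idem, hp.orth i j hij, hpA, hAp, mul_zero, add_zero, smul_mul_assoc,
          smul_mul_assoc, mul_smul_comm, ← sub_smul] at h1
        exact (smul_eq_zero.1 h1).resolve_left (sub_ne_zero.2 fun h => hij (hl h))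
    · intro a _ ha
      have : p i * (p a * X * p a) * p j = (p i * p a) * X * p a * p j := by noncomm_ring
      rw [this, hp.orth i a ha.symm]; simp
    · simp
    · intro b _ hb
      split_ifs
      · simp
      · rw [mul_assoc, mul_assoc (p i * (A * X - X * A)), hp.orth b j hb]; simp
    · simp
    · intro a _ ha
      refine Finset.sum_eq_zero fun b _ => ?_
      split_ifs
      · simp
      · rw [← mul_assoc, ← mul_assoc, hp.orth i a ha.symm]; simp
    · simp
  calc X = (∑ i, p i) * X * (∑ j, p j) := by rw [hp.sum, one_mul, mul_one]
    _ = ∑ i, ∑ j, p i * X * p j := by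
      rw [Finset.sum_mul, Finset.sum_mul]
      refine Finset.sum_congr rfl fun i _ => ?_
      rw [Finset.mul_sum]
    _ = 0 := Finset.sum_eq_zero fun i _ => Finset.sum_eq_zero fun j _ => hk i j

theorem reg_blockL {α : Type u} [AV F α] (p : Fin r → Matrix (Fin n) (Fin n) F)
    {A : α → Matrix (Fin n) (Fin n) F} (hA : ∀ i j, Reg (fun a => A a i j)) :
    Reg (fun a => LinearMap.det (blockL p (A a))) := by
  classical
  apply reg_detLin
  intro Y i j
  have hc : ∀ (Y : Matrix (Fin n) (Fin n) F) i j, Reg (fun _ : α => Y i j) := fun Y i j => Reg.const _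
  have h1 := reg_adk hA 1 Y
  have h2 : ∀ a b i j, Reg (fun x => (p a * adk (A x) 1 Y * p b) i j) := by
    intro a b
    have h3 := Reg.matMul (A := fun _ : α => p a) (B := fun x => adk (A x) 1 Y) (hc _) h1
    exact Reg.matMul (A := fun x : α => p a * adk (A x) 1 Y) (B := fun x => p b) h3 (hc _)
  have h4 : ∀ x, blockL p (A x) Y i j = (∑ a, ∑ b, if a = b then 0 else
      (p a * adk (A x) 1 Y * p b) i j) + (∑ a, p a * Y * p a) i j := by
    intro x
    change ((∑ a, ∑ b, if a = b then 0 else p a * (A x * Y - Y * A x) * p b)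
      + ∑ a, p a * Y * p a) i j = _
    rw [Matrix.add_apply]
    congr 1
    rw [Matrix.sum_apply]
    refine Finset.sum_congr rfl fun a _ => ?_
    rw [Matrix.sum_apply]
    refine Finset.sum_congr rfl fun b _ => ?_
    split_ifs
    · rfl
    · rfl
  simp only [h4]
  refine Reg.add (Reg.sum _ fun a _ => Reg.sum _ fun b _ => ?_) (Reg.const _)
  by_cases hab : a = b
  · simp only [if_pos hab]; exact Reg.const _
  · simp only [if_neg hab]; exact h2 a b i j

theorem single_block [IsAlgClosed F] {K C1 : Subgroup (GL (Fin n) F)}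
    (hmax : ∀ k ∈ K, (evs (mat k)).card ≤ r)
    {p : Fin r → Matrix (Fin n) (Fin n) F} (hp : Idem p) (hC : IsIdc (centr K p) C1)
    {s : GL (Fin n) F} (hs : s ∈ K) {lam : Fin r → F} (hl : Function.Injective lam)
    (hl0 : ∀ i, lam i ≠ 0) (hsl : mat s = ∑ i, lam i • p i) {c : GL (Fin n) F} (hc : c ∈ C1)
    (i : Fin r) : ∃ ν : F, (mat c - ν • 1) ^ n * p i = 0 := by
  classical
  have hcomm : ∀ c ∈ C1, ∀ i, mat c * p i = p i * mat c := fun c hc i =>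
    cj_eq_self.1 ((hC.le hc).2 i)
  have hsp : ∀ i, mat s * p i = lam i • p i := by
    intro i
    rw [hsl, Finset.sum_mul, Finset.sum_eq_single i]
    · rw [smul_mul_assoc, hp.idem]
    · intro j _ hj; rw [smul_mul_assoc, hp.orth j i hj, smul_zero]
    · simp
  have hps : ∀ i, p i * mat s = lam i • p i := by
    intro i
    rw [hsl, Finset.mul_sum, Finset.sum_eq_single i]
    · rw [mul_smul_comm, hp.idem]
    · intro j _ hj; rw [mul_smul_comm, hp.orth i j hj.symm, smul_zero]
    · simp
  have hAc : ∀ c ∈ C1, ∀ i, mat (s * c) * p i = p i * mat (s * c) := by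
    intro c hc i
    rw [mat_mul, mul_assoc, hcomm c hc i, ← mul_assoc, hsp, ← mul_assoc, hps]
  have key : ∀ X a b, ∀ c ∈ C1, adk (mat (s * c)) (n + n) (p i * X * p i) a b = 0 := by
    intro X a b c hc
    by_contra hne
    have hr1 : Reg (fun c : GL (Fin n) F => adk (mat (s * c)) (n + n) (p i * X * p i) a b) :=
      reg_adk (A := fun c => mat (s * c)) (reg_smul_mat s) _ _ a b
    have hr2 : Reg (fun c : GL (Fin n) F => LinearMap.det (blockL p (mat (s * c)))) :=
      reg_blockL p (A := fun c => mat (s * c)) (reg_smul_mat s)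
    obtain ⟨x, hx, h1, h2⟩ := irr_meet hC.irr hr1 hr2 ⟨c, hc, hne⟩ ⟨1, C1.one_mem, by
      rw [mul_one]; exact blockL_base hp hl hsl⟩
    apply h1
    obtain ⟨ν, hν⟩ := block_single hp (hAc x hx) (hmax _ (K.mul_mem hs (hC.le hx).1))
      (blockL_disjoint hp (hAc x hx) h2) i
    have hcp : (mat (s * x) - ν • 1) ^ n * p i = p i * (mat (s * x) - ν • 1) ^ n := by
      have : Commute (mat (s * x) - ν • 1) (p i) := by
        apply Commute.sub_left (hAc x hx i)
        exact (Commute.one_left _).smul_left _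
      exact this.pow_left n
    have := adk_kill (n + n) (p i * X * p i) n n rfl (A := mat (s * x)) (ν := ν)
      (by rw [← mul_assoc, ← mul_assoc, hν, zero_mul, zero_mul])
      (by rw [mul_assoc, ← hcp, hν, mul_zero])
    rw [this]; rfl
  obtain ⟨μ, hμ⟩ := bev_nonempty (hAc c hc i) (hp.idem i) (hp.ne i)
  have hsing : (mat (s * c) - μ • 1) ^ n * p i = 0 := by
    apply single_of (hAc c hc i) (hp.idem i)
    intro μ' hμ'
    by_contra hne
    obtain ⟨v, hv, hpv, hAv⟩ := hμ'
    obtain ⟨w, hw, hpw, hAw⟩ := bev_left (hAc c hc i) (hp.idem i) hμ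
    have h1 : adk (mat (s * c)) (n + n) (vecMulVec v w) = 0 := by
      have : vecMulVec v w = p i * vecMulVec v w * p i := by
        rw [Matrix.mul_vecMulVec, Matrix.vecMulVec_mul, hpv, hpw]
      rw [this]
      ext a b
      exact key _ a b c hc
    rw [adk_eigen hAv hAw] at h1
    rcases smul_eq_zero.1 h1 with h | h
    · exact pow_ne_zero _ (sub_ne_zero.2 hne) h
    · exact vecMulVec_ne hv hw h
  refine ⟨μ / lam i, ?_⟩
  have e1 : ∀ k : ℕ, (mat (s * c) - μ • 1) ^ k * p i =
      lam i ^ k • ((mat c - (μ / lam i) • 1) ^ k * p i) := by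
    intro k
    have hb : (mat (s * c) - μ • 1) * p i = lam i • ((mat c - (μ / lam i) • 1) * p i) := by
      rw [sub_mul, sub_mul, smul_sub, mat_mul, mul_assoc, hcomm c hc i, ← mul_assoc, hsp,
        smul_mul_assoc, smul_mul_assoc, smul_mul_assoc, smul_smul, mul_div_cancel₀ _ (hl0 i)]
    have hcc : (mat c - (μ / lam i) • 1) * p i = p i * (mat c - (μ / lam i) • 1) := by
      rw [sub_mul, mul_sub, hcomm c hc i]; simp
    induction k with
    | zero => simp
    | succ k ih =>
      rw [pow_succ, mul_assoc, hb, hcc, mul_smul_comm, ← mul_assoc, ih, smul_mul_assoc, mul_assoc, ← hcc,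
        smul_smul, ← mul_assoc, ← pow_succ, pow_succ (lam i), mul_comm (lam i)]
  rw [e1] at hsing
  exact (smul_eq_zero.1 hsing).resolve_left (pow_ne_zero _ (hl0 i))

end single
end DPD

namespace DPD

universe u

section kol
open Module
variable {F : Type u} [Field F]

theorem burnside [IsAlgClosed F] {U : Type*} [AddCommGroup U] [Module F U] [FiniteDimensional F U]
    [Nontrivial U] (A : Subalgebra F (End F U))
    (hs : ∀ W : Submodule F U, (∀ T ∈ A, ∀ w ∈ W, T w ∈ W) → W = ⊥ ∨ W = ⊤) (T : End F U) : T ∈ A := by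
  classical
  have hsimple : IsSimpleModule A U := by
    haveI : IsSimpleOrder (Submodule A U) :=
      { eq_bot_or_eq_top := fun W => by
          rcases hs (W.restrictScalars F) (fun T hT w hw => W.smul_mem (⟨T, hT⟩ : A) hw) with h | h
          · left
            rw [Submodule.restrictScalars_eq_bot_iff] at h; exact h
          · right
            rw [Submodule.restrictScalars_eq_top_iff] at h; exact h }
    exact (isSimpleModule_iff A U).2 inferInstance
  have hsch := (IsSimpleModule.algebraMap_end_bijective_of_isAlgClosed (A := A) (V := U) F).2
  let f : End (End A U) U :=
    { toFun := T
      map_add' := T.map_add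
      map_smul' := fun φ x => by
        obtain ⟨t, rfl⟩ := hsch φ
        have h : ∀ y : U, (algebraMap F (End A U) t) • y = t • y := fun y => rfl
        rw [h, RingHom.id_apply, h, T.map_smul] }
  let b := Module.finBasis F U
  obtain ⟨a, ha⟩ := jacobson_density (R := A) f (Finset.univ.image b)
  have : T = a.1 := by
    apply b.ext
    intro i
    exact ha (b i) (by simp)
  rw [this]
  exact a.2

theorem single_trace {U : Type*} [AddCommGroup U] [Module F U] [FiniteDimensional F U]
    {T : End F U} {β : F} {N : ℕ} (h : (T - β • 1) ^ N = 0) :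
    LinearMap.trace F U T = finrank F U * β ∧ LinearMap.det T = β ^ finrank F U := by
  have hnil : IsNilpotent (T - β • 1) := ⟨N, h⟩
  constructor
  · have h1 := (LinearMap.isNilpotent_trace_of_isNilpotent hnil).eq_zero
    rw [map_sub, map_smul, LinearMap.trace_one, sub_eq_zero] at h1
    rw [h1, smul_eq_mul, mul_comm]
  · have hnil' : IsNilpotent (β • 1 - T) := by
      rw [← neg_sub]; exact hnil.neg
    obtain ⟨M, hM⟩ := hnil'
    have h2 := (LinearMap.charpoly_eq_X_pow_iff (β • 1 - T)).2 (fun m => ⟨M, by rw [hM]; rfl⟩)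
    have h3 := LinearMap.eval_charpoly (β • 1 - T) β
    rw [h2, Algebra.algebraMap_eq_smul_one, sub_sub_cancel] at h3
    rw [← h3]; simp

theorem kol_simple [IsAlgClosed F] {α : Type u} [AV F α] {S : Set α} (hS : IsIrreducible S)
    {U : Type*} [AddCommGroup U] [Module F U] [FiniteDimensional F U] [Nontrivial U]
    {τ : α → End F U} (hreg : ∀ (l : Dual F U) (u : U), Reg (fun a => l (τ a u)))
    (hmul : ∀ a ∈ S, ∀ b ∈ S, ∃ c ∈ S, τ a * τ b = τ c) (hone : ∃ e ∈ S, τ e = 1)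
    (hsing : ∀ a ∈ S, ∃ (β : F) (N : ℕ), (τ a - β • 1) ^ N = 0)
    (hs : ∀ W : Submodule F U, (∀ a ∈ S, ∀ w ∈ W, τ a w ∈ W) → W = ⊥ ∨ W = ⊤) :
    ∀ a ∈ S, ∃ β : F, τ a = β • 1 := by
  classical
  -- the span of the image
  let M : Submonoid (End F U) :=
    { carrier := τ '' S
      one_mem' := hone
      mul_mem' := by
        rintro _ _ ⟨a, ha, rfl⟩ ⟨b, hb, rfl⟩
        obtain ⟨c, hc, h⟩ := hmul a ha b hb
        exact ⟨c, hc, h.symm⟩ }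
  have hspan : ∀ T : End F U, T ∈ Submodule.span F (τ '' S) := by
    intro T
    have := burnside (Algebra.adjoin F (M : Set (End F U))) (fun W hW => hs W fun a ha w hw =>
      hW _ (Algebra.subset_adjoin ⟨a, ha, rfl⟩) w hw) T
    have h2 := Algebra.adjoin_eq_span_of_subset F (s := (M : Set (End F U)))
      (by rw [Submonoid.closure_eq]; exact Submodule.subset_span)
    rw [← Subalgebra.mem_toSubmodule, h2] at this
    exact this
  set m := finrank F U with hm
  have hmpos : 0 < m := finrank_pos
  have htr : ∀ b : End F U, Reg (fun a => LinearMap.trace F U (τ a * b)) := by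
    intro b
    have : ∀ a, LinearMap.trace F U (τ a * b) =
        ∑ i, (Module.finBasis F U).coord i (τ a (b (Module.finBasis F U i))) := by
      intro a
      rw [LinearMap.trace_eq_matrix_trace F (Module.finBasis F U), Matrix.trace]
      refine Finset.sum_congr rfl fun i _ => ?_
      rw [Matrix.diag_apply, LinearMap.toMatrix_apply]
      rfl
    simp only [this]
    exact Reg.sum _ fun i _ => hreg _ _
  choose! β N hβ using hsing
  have htrβ : ∀ a ∈ S, LinearMap.trace F U (τ a) = m * β a := fun a ha => (single_trace (hβ a ha)).1
  have hdet : ∀ a ∈ S, LinearMap.det (τ a) = β a ^ m := fun a ha => (single_trace (hβ a ha)).2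
  have hm0 : (m : F) ≠ 0 := by
    intro h0
    obtain ⟨u, hu⟩ := exists_ne (0 : U)
    obtain ⟨l, hl⟩ := Module.Projective.exists_dual_ne_zero F hu
    have hz : ∀ T ∈ Submodule.span F (τ '' S), LinearMap.trace F U T = 0 := by
      intro T hT
      have : Submodule.span F (τ '' S) ≤ LinearMap.ker (LinearMap.trace F U) := by
        rw [Submodule.span_le]
        rintro _ ⟨a, ha, rfl⟩
        change LinearMap.trace F U (τ a) = 0
        rw [htrβ a ha, h0, zero_mul]
      exact this hT
    have := hz (l.smulRight u) (hspan _)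
    rw [LinearMap.trace_smulRight] at this
    exact hl this
  obtain ⟨e, he, hτe⟩ := hone
  have key : ∀ b ∈ S, ∀ a ∈ S, m * LinearMap.trace F U (τ a * τ b) =
      LinearMap.trace F U (τ a) * LinearMap.trace F U (τ b) := by
    intro b hb
    have hpow : ∀ a ∈ S, (m * LinearMap.trace F U (τ a * τ b)) ^ m =
      (LinearMap.trace F U (τ a) * LinearMap.trace F U (τ b)) ^ m := by
      intro a ha
      obtain ⟨c, hc, hcab⟩ := hmul a ha b hb
      have : β c ^ m = β a ^ m * β b ^ m := by
        rw [← hdet a ha, ← hdet b hb, ← hdet c hc, ← hcab, map_mul]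
      rw [hcab, htrβ a ha, htrβ b hb, htrβ c hc, mul_pow, mul_pow, this]
      ring
    have hcov : ∃ i : Polynomial.nthRootsFinset m (1 : F), S ⊆ {a | m * LinearMap.trace F U (τ a * τ b) =
        i.1 * (LinearMap.trace F U (τ a * 1) * LinearMap.trace F U (τ b))} := by
      apply irr_cover hS
      · intro i
        exact isClosed_eq' (f := fun a => m * LinearMap.trace F U (τ a * τ b))
          ((Reg.const _).mul (htr _)) ((Reg.const _).mul ((htr 1).mul (Reg.const _)))
      · intro a ha
        have h := hpow a ha
        by_cases h0 : LinearMap.trace F U (τ a) * LinearMap.trace F U (τ b) = 0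
        · refine ⟨⟨1, ?_⟩, ?_⟩
          · rw [Polynomial.mem_nthRootsFinset hmpos]; simp
          · rw [h0, zero_pow hmpos.ne'] at h
            have := pow_eq_zero_iff hmpos.ne' |>.1 h
            simp only [Set.mem_setOf_eq, mul_one]
            rw [this, h0, mul_zero]
        · refine ⟨⟨(m * LinearMap.trace F U (τ a * τ b)) /
            (LinearMap.trace F U (τ a) * LinearMap.trace F U (τ b)), ?_⟩, ?_⟩
          · rw [Polynomial.mem_nthRootsFinset hmpos, div_pow, h, div_self (pow_ne_zero _ h0)]
          · simp only [Set.mem_setOf_eq, mul_one]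
            rw [div_mul_cancel₀ _ h0]
    obtain ⟨ζ, hζ⟩ := hcov
    simp only [mul_one] at hζ
    have h1 := hζ he
    simp only [Set.mem_setOf_eq] at h1
    rw [hτe, one_mul, LinearMap.trace_one, ← hm] at h1
    by_cases hb0 : LinearMap.trace F U (τ b) = 0
    · intro a ha
      have := hζ ha
      simp only [Set.mem_setOf_eq] at this
      rw [this, hb0, mul_zero, mul_zero]
    · have hz1 : ζ.1 = 1 := by
        have : (m * LinearMap.trace F U (τ b)) * (ζ.1 - 1) = 0 := by
          rw [mul_sub, mul_one, sub_eq_zero, mul_comm, ← h1]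
        exact sub_eq_zero.1 ((mul_eq_zero.1 this).resolve_left (mul_ne_zero hm0 hb0))
      intro a ha
      have := hζ ha
      simp only [Set.mem_setOf_eq] at this
      rw [this, hz1, one_mul]
  intro a ha
  refine ⟨LinearMap.trace F U (τ a) / m, ?_⟩
  have hz : ∀ T : End F U, LinearMap.trace F U ((τ a - (LinearMap.trace F U (τ a) / m) • 1) * T) = 0 := by
    intro T
    have : Submodule.span F (τ '' S) ≤ LinearMap.ker
        ((LinearMap.trace F U) ∘ₗ (LinearMap.mulLeft F (τ a - (LinearMap.trace F U (τ a) / m) • 1))) := by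
      rw [Submodule.span_le]
      rintro _ ⟨b, hb, rfl⟩
      change LinearMap.trace F U ((τ a - (LinearMap.trace F U (τ a) / m) • 1) * τ b) = 0
      rw [sub_mul, smul_mul_assoc, one_mul, map_sub, map_smul, smul_eq_mul, sub_eq_zero]
      have := key b hb a ha
      field_simp
      rw [mul_comm]
      exact this
    exact this (hspan T)
  rw [← sub_eq_zero]
  ext u
  by_contra hne
  obtain ⟨l, hl⟩ := Module.Projective.exists_dual_ne_zero F hne
  apply hl
  have := hz (l.smulRight u)
  rw [LinearMap.trace_mul_comm] at this
  have e : ∀ X : End F U, (l.smulRight u) * X = (l ∘ₗ X).smulRight u := by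
    intro X; ext w; rfl
  rw [e, LinearMap.trace_smulRight] at this
  exact this

theorem exists_min_stable {W : Type*} [AddCommGroup W] [Module F W] [FiniteDimensional F W]
    [Nontrivial W] (P : Submodule F W → Prop) (htop : P ⊤) :
    ∃ U : Submodule F W, U ≠ ⊥ ∧ P U ∧ ∀ U' ≤ U, P U' → U' = ⊥ ∨ U' = U := by
  obtain ⟨U, ⟨h1, h2⟩, hmin⟩ := WellFounded.has_min (wellFounded_lt (α := Submodule F W))
    {U | U ≠ ⊥ ∧ P U} ⟨⊤, top_ne_bot, htop⟩
  refine ⟨U, h1, h2, fun U' hle hP => ?_⟩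
  by_contra! hc
  exact hmin U' ⟨hc.1, hP⟩ (lt_of_le_of_ne hle hc.2)

theorem kol_vec [IsAlgClosed F] {α : Type u} [AV F α] {S : Set α} (hS : IsIrreducible S)
    {E : Type*} [AddCommGroup E] [Module F E] [FiniteDimensional F E] [Nontrivial E]
    {ρ : α → End F E} (hreg : ∀ (l : Dual F E) (u : E), Reg (fun a => l (ρ a u)))
    (hmul : ∀ a ∈ S, ∀ b ∈ S, ∃ c ∈ S, ρ a * ρ b = ρ c) (hone : ∃ e ∈ S, ρ e = 1)
    (hsing : ∀ a ∈ S, ∃ (β : F) (N : ℕ), (ρ a - β • 1) ^ N = 0) :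
    ∃ l : E, l ≠ 0 ∧ ∀ a ∈ S, ∃ β : F, ρ a l = β • l := by
  classical
  obtain ⟨U, hU0, hUst, hUmin⟩ := exists_min_stable (W := E)
    (fun (U : Submodule F E) => ∀ a ∈ S, ∀ l : E, l ∈ U → ρ a l ∈ U) (fun _ _ _ _ => Submodule.mem_top)
  obtain ⟨e, he, hρe⟩ := hone
  obtain ⟨l0, hl0, hl00⟩ := (Submodule.ne_bot_iff _).1 hU0
  haveI : Nontrivial U := ⟨⟨l0, hl0⟩, 0, fun h => hl00 (congrArg Subtype.val h)⟩
  -- a projection onto U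
  obtain ⟨U2, hcompl⟩ := Submodule.exists_isCompl U
  let π : E →ₗ[F] U := U.projectionOnto U2 hcompl
  have hπ' : ∀ u : U, π u.1 = u := fun u => Submodule.projectionOnto_apply_left hcompl u
  let τ : α → End F U := fun a => π ∘ₗ (ρ a) ∘ₗ U.subtype
  have hτ : ∀ a ∈ S, ∀ u : U, ((τ a u : U) : E) = ρ a u.1 := by
    intro a ha u
    change ((π (ρ a u.1) : U) : E) = _
    have := hπ' ⟨ρ a u.1, hUst a ha u.1 u.2⟩
    rw [this]
  have hsc := kol_simple hS (U := U) (τ := τ) ?_ ?_ ?_ ?_ ?_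
  · refine ⟨l0, hl00, fun a ha => ?_⟩
    obtain ⟨β, hβ⟩ := hsc a ha
    refine ⟨β, ?_⟩
    have := hτ a ha ⟨l0, hl0⟩
    rw [hβ] at this
    exact this.symm
  · intro l u
    exact hreg (l ∘ₗ π) u.1
  · intro a ha b hb
    obtain ⟨c, hc, h⟩ := hmul a ha b hb
    refine ⟨c, hc, ?_⟩
    ext1 u
    apply Subtype.ext
    rw [Module.End.mul_apply, hτ a ha, hτ b hb, hτ c hc, ← h]
    rfl
  · refine ⟨e, he, ?_⟩
    ext1 u
    apply Subtype.ext
    rw [hτ e he, hρe]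
    rfl
  · intro a ha
    obtain ⟨β, N, h⟩ := hsing a ha
    refine ⟨β, N, ?_⟩
    have : ∀ (k : ℕ) (u : U), ((((τ a - β • 1) ^ k) u : U) : E) = ((ρ a - β • 1) ^ k) u.1 := by
      intro k
      induction k with
      | zero => intro u; rfl
      | succ k ih =>
        intro u
        rw [pow_succ, Module.End.mul_apply, ih, pow_succ, Module.End.mul_apply]
        have : (((τ a - β • 1) u : U) : E) = (ρ a - β • 1) u.1 := by
          simp [← hτ a ha]
        rw [this]
    ext1 u
    apply Subtype.ext
    rw [this, h]
    simp
  · intro V hV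
    have hst : ∀ a ∈ S, ∀ l : E, l ∈ V.map U.subtype → ρ a l ∈ V.map U.subtype := by
      rintro a ha _ ⟨v, hv, rfl⟩
      exact ⟨τ a v, hV a ha v hv, hτ a ha v⟩
    rcases hUmin (V.map U.subtype) (Submodule.map_subtype_le _ _) hst with h | h
    · left
      rw [eq_bot_iff]
      intro u hu
      have : u.1 ∈ V.map U.subtype := ⟨u, hu, rfl⟩
      rw [h] at this
      exact Subtype.ext this
    · right
      rw [eq_top_iff]
      intro u _
      have : u.1 ∈ V.map U.subtype := by rw [h]; exact u.2
      obtain ⟨v, hv, hvu⟩ := this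
      have : v = u := Subtype.ext hvu
      rwa [← this]

theorem kol [IsAlgClosed F] {α : Type u} [AV F α] {S : Set α} (hS : IsIrreducible S)
    {W : Type*} [AddCommGroup W] [Module F W] [FiniteDimensional F W] [Nontrivial W]
    {ρ : α → End F W} (hreg : ∀ (l : Dual F W) (u : W), Reg (fun a => l (ρ a u)))
    (hmul : ∀ a ∈ S, ∀ b ∈ S, ∃ c ∈ S, ρ a * ρ b = ρ c) (hone : ∃ e ∈ S, ρ e = 1)
    (hsing : ∀ a ∈ S, ∃ (β : F) (N : ℕ), (ρ a - β • 1) ^ N = 0) :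
    ∃ l : Dual F W, l ≠ 0 ∧ ∀ a ∈ S, ∃ β : F, ∀ w, l (ρ a w) = β * l w := by
  let D : α → End F (Dual F W) := fun a => Dual.transpose (R := F) (ρ a)
  have hD : ∀ a l, D a l = l ∘ₗ ρ a := fun a l => rfl
  have hk := kol_vec hS (E := Dual F W) (ρ := D) ?_ ?_ ?_ ?_
  · obtain ⟨l, hl, h⟩ := hk
    refine ⟨l, hl, fun a ha => ?_⟩
    obtain ⟨β, hβ⟩ := h a ha
    exact ⟨β, fun w => LinearMap.congr_fun hβ w⟩
  · intro Λ u
    obtain ⟨w, hw⟩ := (Module.evalEquiv F W).surjective Λ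
    have : ∀ a, Λ (D a u) = u (ρ a w) := by
      intro a
      rw [← hw]
      rfl
    simp only [this]
    exact hreg _ _
  · intro a ha b hb
    obtain ⟨c, hc, h⟩ := hmul b hb a ha
    refine ⟨c, hc, ?_⟩
    apply LinearMap.ext
    intro l
    rw [hD, ← h]
    rfl
  · obtain ⟨e, he, h⟩ := hone
    refine ⟨e, he, ?_⟩
    apply LinearMap.ext
    intro l
    rw [hD, h]
    rfl
  · intro a ha
    obtain ⟨β, N, h⟩ := hsing a ha
    refine ⟨β, N, ?_⟩
    have : ∀ (k : ℕ) (l : Dual F W), ((D a - β • 1) ^ k) l = l ∘ₗ ((ρ a - β • 1) ^ k) := by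
      intro k
      induction k with
      | zero => intro u; rfl
      | succ k ih =>
        intro u
        rw [pow_succ, Module.End.mul_apply, ih, pow_succ']
        have : (D a - β • 1) u = u ∘ₗ (ρ a - β • 1) := by
          rw [LinearMap.comp_sub, ← hD]
          ext w
          simp
        rw [this]
        rfl
    apply LinearMap.ext
    intro l
    rw [this, h]
    simp

end kol
end DPD

namespace DPD

universe u

section FT
variable {F : Type u} [Field F]

theorem coeff_scale {κ : Type} [Fintype κ] (Q : MvPolynomial κ F) (d : ℕ) :
    ∃ Q' : MvPolynomial κ F, (∀ a ∈ Q'.support, ∑ j, a j = d) ∧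
      ∀ x : κ → F, (MvPolynomial.aeval (fun j => Polynomial.C (x j) * Polynomial.X) Q).coeff d =
        MvPolynomial.eval x Q' := by
  classical
  induction Q using MvPolynomial.induction_on' with
  | monomial a c =>
    have h : ∀ x : κ → F, MvPolynomial.aeval (fun j => Polynomial.C (x j) * Polynomial.X)
        (MvPolynomial.monomial a c) = Polynomial.C (MvPolynomial.eval x (MvPolynomial.monomial a c)) *
          Polynomial.X ^ (∑ j, a j) := by
      intro x
      rw [MvPolynomial.aeval_monomial, MvPolynomial.eval_monomial, Finsupp.prod_fintype _ _ (by simp),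
        Finsupp.prod_fintype _ _ (by simp)]
      simp only [mul_pow, Finset.prod_mul_distrib, Finset.prod_pow_eq_pow_sum, map_mul, map_prod, map_pow]
      rw [Polynomial.algebraMap_eq, mul_assoc]
    by_cases hd : ∑ j, a j = d
    · refine ⟨MvPolynomial.monomial a c, ?_, fun x => ?_⟩
      · intro b hb
        rw [Finset.mem_singleton.1 (MvPolynomial.support_monomial_subset hb), hd]
      · rw [h, Polynomial.coeff_C_mul_X_pow, if_pos hd.symm]
    · refine ⟨0, by simp, fun x => ?_⟩
      rw [h, Polynomial.coeff_C_mul_X_pow, if_neg (Ne.symm hd), map_zero]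
  | add P Q hP hQ =>
    obtain ⟨P', h1, h2⟩ := hP
    obtain ⟨Q', h3, h4⟩ := hQ
    refine ⟨P' + Q', fun a ha => ?_, fun x => ?_⟩
    · rcases Finset.mem_union.1 (MvPolynomial.support_add ha) with h | h
      · exact h1 a h
      · exact h3 a h
    · rw [map_add, Polynomial.coeff_add, h2, h4, map_add]

theorem eval_scale {κ : Type} [Fintype κ] (Q : MvPolynomial κ F) (x : κ → F) (t : F) :
    (MvPolynomial.aeval (fun j => Polynomial.C (x j) * Polynomial.X) Q).eval t =
      MvPolynomial.eval (t • x) Q := by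
  have : (Polynomial.evalRingHom t).comp (MvPolynomial.aeval (R := F)
      (fun j => Polynomial.C (x j) * Polynomial.X)).toRingHom = MvPolynomial.eval (t • x) := by
    apply MvPolynomial.ringHom_ext
    · intro c; simp
    · intro j
      simp
      exact mul_comm _ _
  exact RingHom.congr_fun this Q

/-- A linear form as a polynomial. -/
noncomputable def linPoly {κ : Type} [Fintype κ] [DecidableEq κ] (l : (κ → F) →ₗ[F] F) : MvPolynomial κ F :=
  ∑ j, MvPolynomial.C (l (Pi.single j 1)) * MvPolynomial.X j

theorem eval_linPoly {κ : Type} [Fintype κ] [DecidableEq κ] (l : (κ → F) →ₗ[F] F) (x : κ → F) :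
    MvPolynomial.eval x (linPoly l) = l x := by
  unfold linPoly
  rw [map_sum]
  conv_rhs => rw [pi_eq_sum_univ' x, map_sum]
  refine Finset.sum_congr rfl fun j _ => ?_
  rw [map_mul, MvPolynomial.eval_C, MvPolynomial.eval_X, map_smul, smul_eq_mul, mul_comm]

theorem cone_nss [IsAlgClosed F] {κ : Type} [Fintype κ] {ι : Type*} [Fintype ι] {X : Set (κ → F)}
    (hX : IsClosed X) (hcone : ∀ (t : F), ∀ x ∈ X, t • x ∈ X) (l : ι → (κ → F) →ₗ[F] F)
    (hl : ∀ x ∈ X, (∀ i, l i x = 0) → x = 0) :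
    ∃ N : ℕ, 0 < N ∧ ∀ j, ∃ Q : ι → MvPolynomial κ F, (∀ i, ∀ a ∈ (Q i).support, ∑ k, a k + 1 = N) ∧
      ∀ x ∈ X, x j ^ N = ∑ i, l i x * MvPolynomial.eval x (Q i) := by
  classical
  let J : Ideal (MvPolynomial κ F) := MvPolynomial.vanishingIdeal F X ⊔ Ideal.span (Set.range fun i => linPoly (l i))
  have hz : ∀ x ∈ MvPolynomial.zeroLocus F J, x = 0 := by
    intro x hx
    rw [MvPolynomial.mem_zeroLocus_iff] at hx
    apply hl
    · rw [← hX.closure_eq]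
      apply mem_closure_of_vanish
      intro f hf hfX
      obtain ⟨P, hP⟩ := reg_iff_poly.1 hf
      have : P ∈ J := by
        apply Ideal.mem_sup_left
        rw [MvPolynomial.mem_vanishingIdeal_iff]
        intro y hy
        have := hfX y hy
        rw [hP] at this
        simpa [MvPolynomial.aeval_eq_eval] using this
      have := hx P this
      rw [hP]
      simpa [MvPolynomial.aeval_eq_eval] using this
    · intro i
      have := hx (linPoly (l i)) (Ideal.mem_sup_right (Ideal.subset_span ⟨i, rfl⟩))
      rw [← eval_linPoly]
      simpa [MvPolynomial.aeval_eq_eval] using this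
  have hrad : ∀ j, ∃ N : ℕ, MvPolynomial.X j ^ N ∈ J := by
    intro j
    have : (MvPolynomial.X j : MvPolynomial κ F) ∈ J.radical := by
      rw [← MvPolynomial.vanishingIdeal_zeroLocus_eq_radical (K := F), MvPolynomial.mem_vanishingIdeal_iff]
      intro x hx
      rw [hz x hx]; simp
    exact this
  choose N0 hN0 using hrad
  refine ⟨∑ j, N0 j + 1, Nat.succ_pos _, fun j => ?_⟩
  set N := ∑ j, N0 j with hN
  have hmem : (MvPolynomial.X j : MvPolynomial κ F) ^ (N + 1) ∈ J := by
    have hle : N0 j ≤ N + 1 := (Finset.single_le_sum (fun _ _ => Nat.zero_le _) (Finset.mem_univ j)).trans (Nat.le_succ _)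
    exact Ideal.mem_of_dvd _ (pow_dvd_pow _ hle) (hN0 j)
  obtain ⟨P, hP, R, hR, hPR⟩ := Submodule.mem_sup.1 hmem
  obtain ⟨c, hc⟩ := (Ideal.mem_span_range_iff_exists_fun).1 hR
  choose Q hQ1 hQ2 using fun i => coeff_scale (c i) N
  refine ⟨Q, fun i a ha => by rw [hQ1 i a ha], fun x hx => ?_⟩
  have hs : ∀ t : F, (t * x j) ^ (N + 1) = ∑ i, t * l i x * MvPolynomial.eval (t • x) (c i) := by
    intro t
    have h1 := congrArg (MvPolynomial.eval (t • x)) hPR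
    rw [MvPolynomial.mem_vanishingIdeal_iff] at hP
    have h2 : MvPolynomial.eval (t • x) P = 0 := by
      have := hP (t • x) (hcone t x hx)
      simpa [MvPolynomial.aeval_eq_eval] using this
    rw [map_add, h2, zero_add, ← hc, map_sum, map_pow, MvPolynomial.eval_X] at h1
    rw [← smul_eq_mul, ← Pi.smul_apply, ← h1]
    refine Finset.sum_congr rfl fun i _ => ?_
    rw [map_mul, eval_linPoly, map_smul, smul_eq_mul, mul_comm]
  have hpoly : Polynomial.C (x j ^ (N + 1)) * Polynomial.X ^ (N + 1) = Polynomial.X *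
      ∑ i, Polynomial.C (l i x) * MvPolynomial.aeval (fun j => Polynomial.C (x j) * Polynomial.X) (c i) := by
    apply Polynomial.funext
    intro t
    have := hs t
    rw [Polynomial.eval_mul, Polynomial.eval_C, Polynomial.eval_pow, Polynomial.eval_X, Polynomial.eval_mul,
      Polynomial.eval_X, Polynomial.eval_finset_sum, ← mul_pow, mul_comm (x j), this, Finset.mul_sum]
    refine Finset.sum_congr rfl fun i _ => ?_
    rw [Polynomial.eval_mul, Polynomial.eval_C, eval_scale, mul_assoc]
  have := congrArg (fun P => Polynomial.coeff P (N + 1)) hpoly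
  rw [Polynomial.coeff_C_mul_X_pow, if_pos rfl, Polynomial.coeff_X_mul, Polynomial.finset_sum_coeff] at this
  rw [this]
  refine Finset.sum_congr rfl fun i _ => ?_
  rw [Polynomial.coeff_C_mul, hQ2]

theorem ft [IsAlgClosed F] {κ : Type} [Fintype κ] {ι : Type*} [Fintype ι] {X : Set (κ → F)}
    (hX : IsClosed X) (hcone : ∀ (t : F), ∀ x ∈ X, t • x ∈ X) (l : ι → (κ → F) →ₗ[F] F)
    (hl : ∀ x ∈ X, (∀ i, l i x = 0) → x = 0) {α : Type u} [AV F α] {S : Set α} (hS : IsIrreducible S)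
    {σ : α → κ → F} (hσ : ∀ j, Reg (fun a => σ a j)) (hσX : ∀ a ∈ S, σ a ∈ X)
    (hconst : ∀ a ∈ S, ∀ a' ∈ S, ∀ i, l i (σ a) = l i (σ a')) :
    ∀ a ∈ S, ∀ a' ∈ S, σ a = σ a' := by
  classical
  obtain ⟨N, hN, hQ⟩ := cone_nss hX hcone l hl
  choose Q hQ1 hQ2 using hQ
  haveI := coord_domain hS
  obtain ⟨a0, ha0⟩ := hS.1
  let Y : κ → coord S := fun j => ⟨res S (fun a => σ a j), _, hσ j, rfl⟩
  let φ : MvPolynomial κ F →ₐ[F] coord S := MvPolynomial.aeval Y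
  let Bs : Set (κ →₀ ℕ) := {a | ∀ j, a j < N}
  have hBs : Bs.Finite := by
    have : Function.Injective (fun a : κ →₀ ℕ => (a : κ → ℕ)) := DFunLike.coe_injective
    refine Set.Finite.of_finite_image (f := fun a : κ →₀ ℕ => (a : κ → ℕ)) ?_ this.injOn
    refine Set.Finite.subset (Set.Finite.pi' (t := fun _ : κ => Set.Iio N) fun _ => Set.finite_Iio N) ?_
    rintro _ ⟨a, ha, rfl⟩ j
    exact ha j
  let B : Submodule F (coord S) := Submodule.span F ((fun a => φ (MvPolynomial.monomial a 1)) '' Bs)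
  have hYN : ∀ j, Y j ^ N = ∑ i, l i (σ a0) • φ (Q j i) := by
    intro j
    apply Subtype.ext
    funext s
    have h1 := hQ2 j (σ s) (hσX s s.2)
    have h2 : ((∑ i, l i (σ a0) • φ (Q j i) : coord S) : S → F) s = ∑ i, l i (σ a0) * MvPolynomial.eval (σ s) (Q j i) := by
      rw [AddSubmonoidClass.coe_finset_sum, Finset.sum_apply]
      refine Finset.sum_congr rfl fun i _ => ?_
      change l i (σ a0) * (φ (Q j i)).1 s = _
      rw [aeval_coe]
      rfl
    rw [h2]
    refine Eq.trans h1 (Finset.sum_congr rfl fun i _ => ?_)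
    rw [hconst s s.2 a0 ha0 i]
  have hall : ∀ (d : ℕ) (a : κ →₀ ℕ), ∑ j, a j = d → φ (MvPolynomial.monomial a 1) ∈ B := by
    intro d
    induction d using Nat.strong_induction_on with
    | _ d ih =>
      intro a had
      by_cases ha : a ∈ Bs
      · exact Submodule.subset_span ⟨a, ha, rfl⟩
      · simp only [Bs, Set.mem_setOf_eq, not_forall, not_lt] at ha
        obtain ⟨j, hj⟩ := ha
        let a' : κ →₀ ℕ := a - Finsupp.single j N
        have haa : Finsupp.single j N + a' = a := add_tsub_cancel_of_le (Finsupp.single_le_iff.2 hj)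
        have hd' : N + ∑ k, a' k = d := by
          rw [← had, ← haa]
          simp only [Finsupp.add_apply, Finset.sum_add_distrib]
          congr 1
          rw [Finset.sum_eq_single j]
          · simp
          · intro b _ hb; simp [hb.symm]
          · simp
        have e1 : φ (MvPolynomial.monomial a 1) = ∑ i, l i (σ a0) • φ (Q j i * MvPolynomial.monomial a' 1) := by
          rw [← haa, ← one_mul (1 : F), ← MvPolynomial.monomial_mul, map_mul, one_mul]
          have : φ (MvPolynomial.monomial (Finsupp.single j N) 1) = Y j ^ N := by
            rw [← MvPolynomial.X_pow_eq_monomial, map_pow]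
            congr 1
            exact MvPolynomial.aeval_X _ _
          rw [this, hYN, Finset.sum_mul]
          refine Finset.sum_congr rfl fun i _ => ?_
          rw [smul_mul_assoc, map_mul]
        rw [e1]
        refine Submodule.sum_mem _ fun i _ => Submodule.smul_mem _ _ ?_
        rw [(Q j i).as_sum, Finset.sum_mul, map_sum]
        refine Submodule.sum_mem _ fun b hb => ?_
        rw [MvPolynomial.monomial_mul, mul_one]
        have : MvPolynomial.monomial (b + a') (MvPolynomial.coeff b (Q j i)) =
            MvPolynomial.coeff b (Q j i) • MvPolynomial.monomial (b + a') (1 : F) := by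
          rw [MvPolynomial.smul_monomial, smul_eq_mul, mul_one]
        rw [this, map_smul]
        refine Submodule.smul_mem _ _ (ih (∑ k, (b + a') k) ?_ _ rfl)
        have := hQ1 j i b hb
        simp only [Finsupp.add_apply, Finset.sum_add_distrib]
        omega
  have hint : ∀ j, IsIntegral F (Y j) := by
    intro j
    refine isIntegral_of_smul_mem_submodule B ?_ ?_ (Y j) ?_
    · intro h
      have h1 := hall 0 0 (by simp)
      rw [h, Submodule.mem_bot] at h1
      have h2 : φ (MvPolynomial.monomial 0 1) = 1 := map_one φ
      rw [h2] at h1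
      exact one_ne_zero h1
    · exact Submodule.fg_span (hBs.image _)
    · intro b hb
      have hle : B ≤ B.comap (LinearMap.mulLeft F (Y j)) := by
        refine Submodule.span_le.2 ?_
        rintro _ ⟨a, ha, rfl⟩
        change Y j * φ (MvPolynomial.monomial a 1) ∈ B
        have : Y j * φ (MvPolynomial.monomial a 1) = φ (MvPolynomial.monomial (Finsupp.single j 1 + a) 1) := by
          have h3 : MvPolynomial.monomial (Finsupp.single j 1 + a) (1:F) = MvPolynomial.X j * MvPolynomial.monomial a 1 := by
            rw [MvPolynomial.X, MvPolynomial.monomial_mul, one_mul]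
          rw [h3, map_mul]
          congr 1
          exact (MvPolynomial.aeval_X _ _).symm
        rw [this]
        exact hall _ _ rfl
      exact hle hb
  have hcj : ∀ j, ∀ a ∈ S, σ a j = σ a0 j := by
    intro j
    obtain ⟨f, hf, hfY⟩ := hint j
    have hroot : ∀ a ∈ S, f.eval (σ a j) = 0 := by
      intro a ha
      let ev : coord S →ₐ[F] F := (Pi.evalAlgHom F (fun _ : S => F) ⟨a, ha⟩).comp (coord S).val
      have h1 : ev (Polynomial.aeval (Y j) f) = Polynomial.aeval (ev (Y j)) f :=
        (Polynomial.aeval_algHom_apply ev (Y j) f).symm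
      have h2 : Polynomial.aeval (Y j) f = 0 := hfY
      rw [h2, map_zero, Polynomial.aeval_def, Algebra.algebraMap_self, Polynomial.eval₂_id] at h1
      exact h1.symm
    obtain ⟨i, hi⟩ := irr_cover hS (ι := f.roots.toFinset) (Z := fun i => {a | σ a j = i.1})
      (fun i => isClosed_eq' (f := fun a => σ a j) (hσ j) (Reg.const _)) (fun a ha => ⟨⟨σ a j, by
        rw [Multiset.mem_toFinset, Polynomial.mem_roots hf.ne_zero]; exact hroot a ha⟩, rfl⟩)
    intro a ha
    have h1 : σ a j = i.1 := hi ha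
    have h2 : σ a0 j = i.1 := hi ha0
    rw [h1, h2]
  intro a ha a' ha'
  funext j
  rw [hcj j a ha, hcj j a' ha']

end FT
end DPD

namespace DPD

universe u

section KolU
variable {F : Type u} [Field F] {n : ℕ}
open Matrix Module

theorem reg_dual {α : Type u} [AV F α] {κ : Type} [Fintype κ] (l : (κ → F) →ₗ[F] F) {σ : α → κ → F}
    (h : ∀ j, Reg (fun a => σ a j)) : Reg (fun a => l (σ a)) := by
  classical
  have : (fun a => l (σ a)) = fun a => MvPolynomial.eval (fun j => σ a j) (linPoly l) := by
    funext a; rw [eval_linPoly]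
  rw [this]
  exact Reg.mvPoly h _

theorem reg_mulVec (v : Fin n → F) (j : Fin n) : Reg (fun c : GL (Fin n) F => (mat c *ᵥ v) j) := by
  simp only [Matrix.mulVec, dotProduct]
  exact Reg.sum _ fun k _ => (reg_entry j k).mul (Reg.const _)

theorem kolU [IsAlgClosed F] {Γ : Subgroup (GL (Fin n) F)} (hΓ : IsIrreducible (Γ : Set (GL (Fin n) F)))
    (U : Submodule F (Fin n → F)) (hU : U ≠ ⊥) (hst : ∀ c ∈ Γ, ∀ u ∈ U, mat c *ᵥ u ∈ U)
    (hsing : ∀ c ∈ Γ, ∃ (ν : F) (N : ℕ), ∀ u ∈ U, (mat c - ν • 1) ^ N *ᵥ u = 0) :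
    ∃ (ℓ : (Fin n → F) →ₗ[F] F) (β : GL (Fin n) F → F), Reg β ∧ (∃ u ∈ U, ℓ u ≠ 0) ∧
      (∀ c ∈ Γ, ∀ u ∈ U, ℓ (mat c *ᵥ u) = β c * ℓ u) ∧
      (∀ c ∈ Γ, ∀ d ∈ Γ, β (c * d) = β c * β d) ∧ β 1 = 1 ∧
      ∀ c ∈ Γ, ∀ (ν : F) (N : ℕ), (∀ u ∈ U, (mat c - ν • 1) ^ N *ᵥ u = 0) → β c = ν := by
  classical
  haveI : Nontrivial U := (Submodule.nontrivial_iff_ne_bot).2 hU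
  obtain ⟨π, hπ⟩ := LinearMap.exists_leftInverse_of_injective U.subtype (by simp)
  have hπ' : ∀ u : U, π (u : Fin n → F) = u := fun u => LinearMap.congr_fun hπ u
  let ρ : GL (Fin n) F → End F U := fun c => π ∘ₗ (Matrix.toLin' (mat c)) ∘ₗ U.subtype
  have hρ0 : ∀ c (u : U), ρ c u = π (mat c *ᵥ (u : Fin n → F)) := by
    intro c u; simp [ρ]
  have hρ : ∀ c ∈ Γ, ∀ u : U, ((ρ c u : U) : Fin n → F) = mat c *ᵥ (u : Fin n → F) := by
    intro c hc u
    rw [hρ0]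
    have := hπ' ⟨_, hst c hc u u.2⟩
    simp only at this
    rw [this]
  have hpow : ∀ c ∈ Γ, ∀ (ν : F) (N : ℕ) (u : U), ((((ρ c - ν • 1) ^ N) u : U) : Fin n → F) =
      (mat c - ν • 1) ^ N *ᵥ (u : Fin n → F) := by
    intro c hc ν N
    induction N with
    | zero => intro u; simp
    | succ N ih =>
      intro u
      rw [pow_succ, pow_succ, Module.End.mul_apply, ih, ← Matrix.mulVec_mulVec]
      congr 1
      rw [LinearMap.sub_apply, Submodule.coe_sub, hρ c hc, Matrix.sub_mulVec, Matrix.smul_mulVec, Matrix.one_mulVec]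
      rfl
  have hk := kol (S := (Γ : Set (GL (Fin n) F))) hΓ (ρ := ρ) ?_ ?_ ?_ ?_
  · obtain ⟨l, hl0, hl⟩ := hk
    have : ∃ u0 : U, l u0 ≠ 0 := by
      by_contra h
      push Not at h
      exact hl0 (LinearMap.ext h)
    obtain ⟨u0, hu0⟩ := this
    let ℓ : (Fin n → F) →ₗ[F] F := l ∘ₗ π
    have hℓ : ∀ u (hu : u ∈ U), ℓ u = l ⟨u, hu⟩ := by
      intro u hu
      change l (π u) = _
      rw [hπ' ⟨u, hu⟩]
    have hℓ0 : ℓ u0 ≠ 0 := by rw [hℓ u0 u0.2]; exact hu0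
    let β : GL (Fin n) F → F := fun c => ℓ (mat c *ᵥ (u0 : Fin n → F)) * (ℓ u0)⁻¹
    have hβ : ∀ c ∈ Γ, ∀ u ∈ U, ℓ (mat c *ᵥ u) = β c * ℓ u := by
      intro c hc
      obtain ⟨b, hb⟩ := hl c hc
      have h1 : ∀ u ∈ U, ℓ (mat c *ᵥ u) = b * ℓ u := by
        intro u hu
        rw [hℓ _ (hst c hc u hu), hℓ u hu, ← hb]
        congr 1
        exact Subtype.ext (hρ c hc ⟨u, hu⟩).symm
      have h2 : β c = b := by
        change ℓ (mat c *ᵥ (u0 : Fin n → F)) * (ℓ u0)⁻¹ = b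
        rw [h1 _ u0.2, mul_assoc, mul_inv_cancel₀ hℓ0, mul_one]
      rw [h2]; exact h1
    refine ⟨ℓ, β, ?_, ⟨u0, u0.2, hℓ0⟩, hβ, ?_, ?_, ?_⟩
    · exact (reg_dual ℓ (fun j => reg_mulVec _ j)).mul (Reg.const _)
    · intro c hc d hd
      apply mul_right_cancel₀ hℓ0
      rw [← hβ _ (Γ.mul_mem hc hd) _ u0.2, mat_mul, ← Matrix.mulVec_mulVec, hβ c hc _ (hst d hd _ u0.2), hβ d hd _ u0.2, ← mul_assoc (β c)]
    · apply mul_right_cancel₀ hℓ0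
      rw [← hβ _ Γ.one_mem _ u0.2, mat_one, Matrix.one_mulVec, one_mul]
    · intro c hc ν N hν
      have h1 : ∀ (N : ℕ), ∀ u ∈ U, ℓ ((mat c - ν • 1) ^ N *ᵥ u) = (β c - ν) ^ N * ℓ u := by
        intro N
        induction N with
        | zero => intro u hu; simp
        | succ N ih =>
          intro u hu
          have h3 : (mat c - ν • 1) *ᵥ u = mat c *ᵥ u - ν • u := by
            rw [Matrix.sub_mulVec, Matrix.smul_mulVec, Matrix.one_mulVec]
          rw [pow_succ, ← Matrix.mulVec_mulVec, h3, ih _ (U.sub_mem (hst c hc u hu) (U.smul_mem _ hu)), map_sub,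
            hβ c hc u hu, map_smul, smul_eq_mul]
          ring
      have h2 := h1 N u0 u0.2
      rw [hν _ u0.2, map_zero] at h2
      rcases mul_eq_zero.1 h2.symm with h | h
      · exact sub_eq_zero.1 (IsReduced.pow_eq_zero h)
      · exact absurd h hℓ0
  · intro l u
    have : (fun c => l (ρ c u)) = fun c => (l ∘ₗ π) (mat c *ᵥ (u : Fin n → F)) := by
      funext c; rw [hρ0]; rfl
    rw [this]
    exact reg_dual _ (fun j => reg_mulVec _ j)
  · intro a ha b hb
    refine ⟨a * b, Γ.mul_mem ha hb, ?_⟩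
    ext1 u
    apply Subtype.ext
    rw [Module.End.mul_apply, hρ a ha, hρ b hb, hρ _ (Γ.mul_mem ha hb), mat_mul, Matrix.mulVec_mulVec]
  · refine ⟨1, Γ.one_mem, ?_⟩
    ext1 u
    apply Subtype.ext
    rw [hρ 1 Γ.one_mem, mat_one, Matrix.one_mulVec]
    rfl
  · intro c hc
    obtain ⟨ν, N, h⟩ := hsing c hc
    refine ⟨ν, N, ?_⟩
    ext1 u
    apply Subtype.ext
    rw [hpow c hc, h u u.2]
    rfl

theorem fp [IsAlgClosed F] {κ : Type} [Fintype κ] {Γ : Subgroup (GL (Fin n) F)}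
    (hΓ : IsIrreducible (Γ : Set (GL (Fin n) F))) (ρ : GL (Fin n) F → (κ → F) →ₗ[F] (κ → F))
    (hρ : ∀ v j, Reg (fun c => ρ c v j)) (hmul : ∀ c ∈ Γ, ∀ d ∈ Γ, ∀ v, ρ (c * d) v = ρ c (ρ d v))
    (h1 : ∀ v, ρ 1 v = v)
    (hU : ∀ U : Submodule F (κ → F), U ≠ ⊥ → (∀ c ∈ Γ, ∀ u ∈ U, ρ c u ∈ U) →
      ∃ (ℓ : (κ → F) →ₗ[F] F) (β : GL (Fin n) F → F), Reg β ∧ (∃ u ∈ U, ℓ u ≠ 0) ∧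
        (∀ c ∈ Γ, ∀ u ∈ U, ℓ (ρ c u) = β c * ℓ u))
    {X : Set (κ → F)} (hX : IsClosed X) (hcone : ∀ (t : F), ∀ x ∈ X, t • x ∈ X)
    (hst : ∀ c ∈ Γ, ∀ x ∈ X, ρ c x ∈ X) (hne : ∃ x ∈ X, x ≠ 0) :
    ∃ x ∈ X, x ≠ 0 ∧ ∀ c ∈ Γ, ∃ β : F, ρ c x = β • x := by
  classical
  let PP : Set (TopologicalSpace.Closeds (κ → F)) := {Y | (Y : Set (κ → F)) ⊆ X ∧ (∀ (t : F), ∀ x ∈ Y, t • x ∈ Y) ∧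
    (∀ c ∈ Γ, ∀ x ∈ Y, ρ c x ∈ Y) ∧ ∃ x ∈ Y, x ≠ 0}
  obtain ⟨Y, ⟨hYX, hYc, hYs, x, hxY, hx0⟩, hmin⟩ := WellFounded.has_min
    (wellFounded_lt (α := TopologicalSpace.Closeds (κ → F))) PP ⟨⟨X, hX⟩, subset_rfl, hcone, hst, hne⟩
  let U : Submodule F (κ → F) := Submodule.span F (Y : Set (κ → F))
  have hYU : ∀ y ∈ Y, y ∈ U := fun y hy => Submodule.subset_span hy
  have hUs : ∀ c ∈ Γ, ∀ u ∈ U, ρ c u ∈ U := by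
    intro c hc
    have : U ≤ U.comap (ρ c) := Submodule.span_le.2 fun y hy => hYU _ (hYs c hc y hy)
    exact this
  obtain ⟨ℓ, β, hβ, ⟨u, hu, hℓu⟩, hℓ⟩ := hU U (fun h => hx0 (by have := hYU x hxY; rw [h] at this; exact this)) hUs
  have hβ1 : β 1 = 1 := by
    apply mul_right_cancel₀ hℓu
    rw [← hℓ 1 Γ.one_mem u hu, h1, one_mul]
  have hβi : ∀ c ∈ Γ, β c⁻¹ * β c = 1 := by
    intro c hc
    apply mul_right_cancel₀ hℓu
    rw [mul_assoc, ← hℓ c hc u hu, ← hℓ _ (Γ.inv_mem hc) _ (hUs c hc u hu), ← hmul _ (Γ.inv_mem hc) _ hc,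
      inv_mul_cancel, h1, one_mul]
  have hker : ∀ y ∈ Y, ℓ y = 0 → y = 0 := by
    by_contra hcon
    push Not at hcon
    obtain ⟨y, hy, hy1, hy0⟩ := hcon
    have hcl : IsClosed ((Y : Set (κ → F)) ∩ {v | ℓ v = 0}) := Y.2.inter (isClosed_zero (reg_dual ℓ fun j => reg_coord j))
    let Y' : TopologicalSpace.Closeds (κ → F) := ⟨_, hcl⟩
    have hY' : Y' ∈ PP := by
      refine ⟨fun z hz => hYX hz.1, fun t z hz => ⟨hYc t z hz.1, ?_⟩, fun c hc z hz => ⟨hYs c hc z hz.1, ?_⟩, y, ⟨hy, hy1⟩, hy0⟩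
      · change ℓ (t • z) = 0
        rw [map_smul, show ℓ z = 0 from hz.2, smul_zero]
      · change ℓ (ρ c z) = 0
        rw [hℓ c hc z (hYU z hz.1), show ℓ z = 0 from hz.2, mul_zero]
    have hle : Y' ≤ Y := fun z hz => hz.1
    have heq : Y' = Y := by
      by_contra hne'
      exact hmin Y' hY' (lt_of_le_of_ne hle hne')
    have hUk : U ≤ LinearMap.ker ℓ := by
      refine Submodule.span_le.2 fun z hz => ?_
      have : z ∈ Y' := by rw [heq]; exact hz
      exact this.2
    exact hℓu (hUk hu)
  have hft := ft Y.2 hYc (fun _ : Unit => ℓ) (fun y hy h => hker y hy (h ())) hΓ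
    (σ := fun c => β c⁻¹ • ρ c x) ?_ ?_ ?_
  · refine ⟨x, hYX hxY, hx0, fun c hc => ⟨(β c⁻¹)⁻¹, ?_⟩⟩
    have h2 := hft c hc 1 Γ.one_mem
    simp only [inv_one, hβ1, h1, one_smul] at h2
    have h3 : β c⁻¹ ≠ 0 := left_ne_zero_of_mul_eq_one (hβi c hc)
    rw [← h2, smul_smul, inv_mul_cancel₀ h3, one_smul, h2]
  · intro j
    have : Reg (fun c : GL (Fin n) F => β c⁻¹) := regMap_inv β hβ
    exact this.mul (hρ x j)
  · intro c hc
    exact hYc _ _ (hYs c hc x hxY)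
  · have : ∀ c ∈ Γ, ℓ (β c⁻¹ • ρ c x) = ℓ x := by
      intro c hc
      rw [map_smul, hℓ c hc x (hYU x hxY), smul_eq_mul, ← mul_assoc, hβi c hc, one_mul]
    intro a ha a' ha' i
    rw [this a ha, this a' ha']

end KolU
end DPD

namespace DPD

universe u

section Dat
variable {F : Type u} [Field F] {n r : ℕ}
open Matrix Module

theorem Idem.sum_mul {p : Fin r → Matrix (Fin n) (Fin n) F} (hp : Idem p) (a : Fin r → F) (i : Fin r) :
    (∑ j, a j • p j) * p i = a i • p i := by
  classical
  rw [Finset.sum_mul, Finset.sum_eq_single i]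
  · rw [smul_mul_assoc, hp.idem]
  · intro j _ hj
    rw [smul_mul_assoc, hp.orth j i hj, smul_zero]
  · simp

theorem Idem.mul_sum {p : Fin r → Matrix (Fin n) (Fin n) F} (hp : Idem p) (a : Fin r → F) (i : Fin r) :
    p i * (∑ j, a j • p j) = a i • p i := by
  classical
  rw [Finset.mul_sum, Finset.sum_eq_single i]
  · rw [mul_smul_comm, hp.idem]
  · intro j _ hj
    rw [mul_smul_comm, hp.orth i j hj.symm, smul_zero]
  · simp

theorem Idem.sum_mul_sum {p : Fin r → Matrix (Fin n) (Fin n) F} (hp : Idem p) (a b : Fin r → F) :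
    (∑ j, a j • p j) * (∑ j, b j • p j) = ∑ j, (a j * b j) • p j := by
  rw [Finset.mul_sum]
  refine Finset.sum_congr rfl fun i _ => ?_
  rw [mul_smul_comm, hp.sum_mul, smul_smul, mul_comm]

theorem Idem.glOf {p : Fin r → Matrix (Fin n) (Fin n) F} (hp : Idem p) (a : Fin r → F) (ha : ∀ i, a i ≠ 0) :
    ∃ s : GL (Fin n) F, mat s = ∑ i, a i • p i ∧ mat s⁻¹ = ∑ i, (a i)⁻¹ • p i := by
  refine ⟨⟨∑ i, a i • p i, ∑ i, (a i)⁻¹ • p i, ?_, ?_⟩, rfl, rfl⟩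
  · rw [hp.sum_mul_sum, ← hp.sum]
    refine Finset.sum_congr rfl fun i _ => ?_
    rw [mul_inv_cancel₀ (ha i), one_smul]
  · rw [hp.sum_mul_sum, ← hp.sum]
    refine Finset.sum_congr rfl fun i _ => ?_
    rw [inv_mul_cancel₀ (ha i), one_smul]

theorem mem_centr {K : Subgroup (GL (Fin n) F)} {p : Fin r → Matrix (Fin n) (Fin n) F} {k : GL (Fin n) F} :
    k ∈ centr K p ↔ k ∈ K ∧ ∀ i, cj k (p i) = p i := Iff.rfl

theorem centr_comm {K : Subgroup (GL (Fin n) F)} {p : Fin r → Matrix (Fin n) (Fin n) F} {k : GL (Fin n) F}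
    (hk : k ∈ centr K p) (i : Fin r) : mat k * p i = p i * mat k := cj_eq_self.1 (hk.2 i)

theorem gl_ne_zero {c : GL (Fin n) F} {v : Fin n → F} (hv : v ≠ 0) : mat c *ᵥ v ≠ 0 := by
  intro h
  apply hv
  have := congrArg (fun w => mat c⁻¹ *ᵥ w) h
  simpa [Matrix.mulVec_mulVec, mat_inv_mul] using this

/-- The standing data: a closed irreducible group, together with a maximal family of idempotents. -/
structure Dat (K C1 : Subgroup (GL (Fin n) F)) (p : Fin r → Matrix (Fin n) (Fin n) F)
    (b : Fin r → GL (Fin n) F → F) : Prop where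
  hn : 0 < n
  Kc : IsClosed (K : Set (GL (Fin n) F))
  Ki : IsIrreducible (K : Set (GL (Fin n) F))
  sc : scal F n ≤ K
  irrK : ∀ W : Submodule F (Fin n → F), (∀ g ∈ K, ∀ v ∈ W, mat g *ᵥ v ∈ W) → W = ⊥ ∨ W = ⊤
  hp : Idem p
  hC : IsIdc (centr K p) C1
  hb : ∀ i, Reg (b i)
  bs : ∀ c ∈ C1, ∀ i, (mat c - b i c • 1) ^ n * p i = 0
  bmul : ∀ i, ∀ c ∈ C1, ∀ d ∈ C1, b i (c * d) = b i c * b i d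
  b1 : ∀ i, b i 1 = 1
  reg : ∃ c ∈ C1, Function.Injective fun i => b i c

theorem range_ne {p : Fin r → Matrix (Fin n) (Fin n) F} (hp : Idem p) (i : Fin r) :
    ∃ w, p i *ᵥ w ≠ 0 := by
  by_contra h
  push Not at h
  apply hp.ne i
  ext a c
  have := congrFun (h (Pi.single c 1)) a
  simpa using this

theorem exists_chars [IsAlgClosed F] {K C1 : Subgroup (GL (Fin n) F)} {p : Fin r → Matrix (Fin n) (Fin n) F}
    (hp : Idem p) (hC : IsIdc (centr K p) C1)
    (hsb : ∀ c ∈ C1, ∀ i, ∃ ν : F, (mat c - ν • 1) ^ n * p i = 0) :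
    ∃ b : Fin r → GL (Fin n) F → F, (∀ i, Reg (b i)) ∧ (∀ c ∈ C1, ∀ i, (mat c - b i c • 1) ^ n * p i = 0) ∧
      (∀ i, ∀ c ∈ C1, ∀ d ∈ C1, b i (c * d) = b i c * b i d) ∧ (∀ i, b i 1 = 1) := by
  have key : ∀ i, ∃ β : GL (Fin n) F → F, Reg β ∧ (∀ c ∈ C1, (mat c - β c • 1) ^ n * p i = 0) ∧
      (∀ c ∈ C1, ∀ d ∈ C1, β (c * d) = β c * β d) ∧ β 1 = 1 := by
    intro i
    have hk := kolU hC.irr (LinearMap.range (Matrix.toLin' (p i))) ?_ ?_ ?_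
    · obtain ⟨ℓ, β, h1, h2, h3, h4, h5, h6⟩ := hk
      refine ⟨β, h1, fun c hc => ?_, h4, h5⟩
      obtain ⟨ν, hν⟩ := hsb c hc i
      have : β c = ν := by
        refine h6 c hc ν n ?_
        rintro _ ⟨w, rfl⟩
        rw [Matrix.toLin'_apply, Matrix.mulVec_mulVec, hν, Matrix.zero_mulVec]
      rw [this, hν]
    · intro h
      obtain ⟨w, hw⟩ := range_ne hp i
      apply hw
      have : p i *ᵥ w ∈ LinearMap.range (Matrix.toLin' (p i)) := ⟨w, by simp⟩
      rw [h] at this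
      exact this
    · rintro c hc _ ⟨w, rfl⟩
      refine ⟨mat c *ᵥ w, ?_⟩
      rw [Matrix.toLin'_apply, Matrix.toLin'_apply, Matrix.mulVec_mulVec, Matrix.mulVec_mulVec, centr_comm (hC.le hc)]
    · intro c hc
      obtain ⟨ν, hν⟩ := hsb c hc i
      refine ⟨ν, n, ?_⟩
      rintro _ ⟨w, rfl⟩
      rw [Matrix.toLin'_apply, Matrix.mulVec_mulVec, hν, Matrix.zero_mulVec]
  choose b h1 h2 h3 h4 using key
  exact ⟨b, h1, fun c hc i => h2 i c hc, h3, h4⟩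

/-- The operator `X ↦ A X - ρ X A`. -/
noncomputable def twL (ρ : F) (A : Matrix (Fin n) (Fin n) F) :
    Matrix (Fin n) (Fin n) F →ₗ[F] Matrix (Fin n) (Fin n) F :=
  LinearMap.mulLeft F A - ρ • LinearMap.mulRight F A

theorem twL_apply (ρ : F) (A X : Matrix (Fin n) (Fin n) F) : twL ρ A X = A * X - ρ • (X * A) := rfl

theorem twL_det_zero {ρ : F} {A X : Matrix (Fin n) (Fin n) F} (hX : X ≠ 0) (h : A * X = ρ • (X * A)) :
    LinearMap.det (twL ρ A) = 0 := by
  by_contra hd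
  apply hX
  have h1 : LinearMap.ker (twL ρ A) = ⊥ := by
    by_contra hk
    exact hd (LinearMap.det_eq_zero_iff_ker_ne_bot.2 hk)
  have : X ∈ LinearMap.ker (twL ρ A) := by
    rw [LinearMap.mem_ker, twL_apply, h, sub_self]
  rw [h1] at this
  exact this

theorem eig_of_pow {A q : Matrix (Fin n) (Fin n) F} {β μ : F} {v : Fin n → F} {N : ℕ} (h : (A - β • 1) ^ N * q = 0)
    (hv : v ≠ 0) (hq : q *ᵥ v = v) (hA : A *ᵥ v = μ • v) : μ = β := by
  have h1 : ∀ N, (A - β • 1) ^ N *ᵥ v = (μ - β) ^ N • v := by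
    intro N
    induction N with
    | zero => simp
    | succ N ih =>
      rw [pow_succ, ← Matrix.mulVec_mulVec, Matrix.sub_mulVec, Matrix.smul_mulVec, Matrix.one_mulVec, hA, ← sub_smul,
        Matrix.mulVec_smul, ih, smul_smul, ← pow_succ']
  have h2 := h1 N
  rw [← hq, Matrix.mulVec_mulVec, h, Matrix.zero_mulVec, hq] at h2
  rcases smul_eq_zero.1 h2.symm with h3 | h3
  · exact sub_eq_zero.1 (IsReduced.pow_eq_zero h3)
  · exact absurd h3 hv

theorem exists_dat [IsAlgClosed F] {K : Subgroup (GL (Fin n) F)} (hn : 0 < n)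
    (Kc : IsClosed (K : Set (GL (Fin n) F))) (Ki : IsIrreducible (K : Set (GL (Fin n) F))) (sc : scal F n ≤ K)
    (irrK : ∀ W : Submodule F (Fin n → F), (∀ g ∈ K, ∀ v ∈ W, mat g *ᵥ v ∈ W) → W = ⊥ ∨ W = ⊤) :
    ∃ (r : ℕ) (C1 : Subgroup (GL (Fin n) F)) (p : Fin r → Matrix (Fin n) (Fin n) F)
    (b : Fin r → GL (Fin n) F → F), Dat K C1 p b := by
  classical
  obtain ⟨r, ⟨g, hg, hgr⟩, hmax0⟩ : ∃ r, (∃ g ∈ K, (evs (mat g)).card = r) ∧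
      ∀ m, (∃ g ∈ K, (evs (mat g)).card = m) → m ≤ r := by
    have hne : ∃ m, ∃ g ∈ K, (evs (mat g)).card = m := ⟨_, 1, K.one_mem, rfl⟩
    have hbd : ∀ m, (∃ g ∈ K, (evs (mat g)).card = m) → m ≤ n := by
      rintro _ ⟨g, _, rfl⟩; exact evs_card _
    obtain ⟨m, hm⟩ := hne
    exact ⟨Nat.findGreatest (fun m => ∃ g ∈ K, (evs (mat g)).card = m) n, Nat.findGreatest_spec (P := fun m => ∃ g ∈ K, (evs (mat g)).card = m) (hbd m hm) hm,
      fun m' hm' => Nat.le_findGreatest (hbd m' hm') hm'⟩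
  have hmax : ∀ k ∈ K, (evs (mat k)).card ≤ r := fun k hk => hmax0 _ ⟨k, hk, rfl⟩
  obtain ⟨p, lam, hp, hl, hlp, hcomm, hev⟩ := spectral_idem hn (mat g) hgr
  have hl0 : ∀ i, lam i ≠ 0 := by
    intro i h0
    obtain ⟨v, hv, hgv⟩ := mem_evs.1 (hev i)
    rw [h0, zero_smul] at hgv
    exact gl_ne_zero hv hgv
  obtain ⟨s, hs, -⟩ := hp.glOf lam hl0
  have hsK : s ∈ K := jordan Kc hg hp hlp hs
  have hsp : ∀ i, mat s * p i = lam i • p i := fun i => by rw [hs, hp.sum_mul]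
  have hps : ∀ i, p i * mat s = lam i • p i := fun i => by rw [hs, hp.mul_sum]
  have hsC : s ∈ centr K p := ⟨hsK, fun i => cj_eq_self.2 (by rw [hsp, hps])⟩
  obtain ⟨C1, hC⟩ := exists_idc (centr_closed Kc p)
  obtain ⟨b, hb, bs, bmul, b1⟩ := exists_chars hp hC fun c hc i => single_block hmax hp hC hsK hl hl0 hs hc i
  refine ⟨r, C1, p, b, hn, Kc, Ki, sc, irrK, hp, hC, hb, bs, bmul, b1, ?_⟩
  by_contra hreg
  push Not at hreg
  have hbs : ∀ c ∈ C1, ∀ i, (mat (s * c) - (lam i * b i c) • 1) ^ n * p i = 0 := by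
    intro c hc i
    have hcp := centr_comm (hC.le hc) i
    have : ∀ N, (mat (s * c) - (lam i * b i c) • 1) ^ N * p i = lam i ^ N • ((mat c - b i c • 1) ^ N * p i) := by
      intro N
      induction N with
      | zero => simp
      | succ N ih =>
        have h1 : (mat (s * c) - (lam i * b i c) • 1) * p i = lam i • ((mat c - b i c • 1) * p i) := by
          rw [sub_mul, sub_mul, mat_mul, mul_assoc, hcp, ← mul_assoc, hsp, smul_sub, smul_mul_assoc, smul_mul_assoc,
            smul_mul_assoc, one_mul, smul_smul]
        rw [pow_succ', mul_assoc, ih, comm_sub_pow hcp, mul_smul_comm, ← mul_assoc, h1, smul_mul_assoc, mul_assoc,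
          ← comm_sub_pow hcp, ← mul_assoc, ← pow_succ', smul_smul, ← pow_succ]
    rw [this, bs c hc, smul_zero]
  obtain ⟨G, hG, hGne, hGz⟩ := domReg Kc Ki hp hC hsC (b := fun i c => lam i * b i c)
    (fun i => (Reg.const _).mul (hb i)) hbs ⟨1, C1.one_mem, fun i j hij => hl (by simpa [b1] using hij)⟩
  obtain ⟨⟨⟨i, j⟩, hij⟩, hZ⟩ := irr_cover hC.irr (ι := {x : Fin r × Fin r // x.1 ≠ x.2})
    (Z := fun x => {c | b x.1.1 c = b x.1.2 c}) (fun x => isClosed_eq' (hb _) (hb _)) (fun c hc => by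
      have := hreg c hc
      simp only [Function.Injective, not_forall] at this
      obtain ⟨i, j, h1, h2⟩ := this
      exact ⟨⟨(i, j), h2⟩, h1⟩)
  simp only at hij
  have hbij : ∀ c ∈ C1, b i c = b j c := fun c hc => hZ hc
  set ρ := lam i * (lam j)⁻¹ with hρ
  have hρ1 : ρ ≠ 1 := by
    intro h
    apply hij; apply hl
    rw [hρ] at h
    field_simp [hl0 j] at h
    exact h
  have hD : Reg (fun z : GL (Fin n) F => LinearMap.det (twL ρ (mat z))) := by
    apply reg_detLin
    intro Y a c
    have h1 : Reg (fun z : GL (Fin n) F => (mat z * Y) a c) :=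
      Reg.matMul (A := fun z : GL (Fin n) F => mat z) (B := fun _ => Y) (fun i j => reg_entry i j) (fun i j => Reg.const _) a c
    have h2 : Reg (fun z : GL (Fin n) F => (Y * mat z) a c) :=
      Reg.matMul (A := fun _ => Y) (B := fun z : GL (Fin n) F => mat z) (fun i j => Reg.const _) (fun i j => reg_entry i j) a c
    exact h1.sub ((Reg.const ρ).mul h2)
  rcases (irr_iff.1 Ki).2 _ _ hG hD (fun z hz => by
    by_cases hgz : G z = 0
    · rw [hgz, zero_mul]
    obtain ⟨k, hk, c, hc, hinj, rfl⟩ := hGz z hz hgz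
    have hscC : s * c ∈ centr K p := mul_mem hsC (hC.le hc)
    obtain ⟨μ, hμ⟩ := bev_nonempty (centr_comm hscC i) (hp.idem i) (hp.ne i)
    obtain ⟨ν, hν⟩ := bev_nonempty (centr_comm hscC j) (hp.idem j) (hp.ne j)
    obtain ⟨w, hw0, hwp, hwA⟩ := bev_left (centr_comm hscC j) (hp.idem j) hν
    obtain ⟨v', hv0', hvp', hvA'⟩ := hν
    obtain ⟨v, hv0, hvp, hvA⟩ := hμ
    have e1 : μ = lam i * b i c := eig_of_pow (hbs c hc i) hv0 hvp hvA
    have e2 : ν = lam j * b j c := eig_of_pow (hbs c hc j) hv0' hvp' hvA'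
    have hX : mat (s * c) * vecMulVec v w = ρ • (vecMulVec v w * mat (s * c)) := by
      rw [Matrix.mul_vecMulVec, Matrix.vecMulVec_mul, hvA, hwA, Matrix.smul_vecMulVec, Matrix.vecMulVec_smul, smul_smul,
        e1, e2, hbij c hc, hρ]
      congr 1
      field_simp [hl0 j]
    have : LinearMap.det (twL ρ (mat (k * (s * c) * k⁻¹))) = 0 := by
      refine twL_det_zero (X := cj k (vecMulVec v w)) ?_ ?_
      · intro h
        exact vecMulVec_ne hv0 hw0 (cj_inj k (by rw [h, cj_zero]))
      · rw [← cj_mat, ← cj_mul, hX, cj_smul, cj_mul]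
    rw [this, mul_zero]) with h | h
  · obtain ⟨z, hz, hgz⟩ := hGne
    exact hgz (h z hz)
  · have h1 := h 1 K.one_mem
    have h2 : twL ρ (mat (1 : GL (Fin n) F)) = (1 - ρ) • (LinearMap.id) := by
      ext1 X
      rw [twL_apply, mat_one, one_mul, mul_one, LinearMap.smul_apply, sub_smul, one_smul]
      rfl
    rw [h2, LinearMap.det_smul, LinearMap.det_id, mul_one] at h1
    exact hρ1 (sub_eq_zero.1 (IsReduced.pow_eq_zero h1)).symm

end Dat
end DPD

namespace DPD

universe u

section Cone
variable {F : Type u} [Field F] {n r : ℕ}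
open Matrix Module

/-- A minimal nonzero closed stable cone. -/
structure MinCone (K : Subgroup (GL (Fin n) F)) (X : Set (Fin n → F)) : Prop where
  closed : IsClosed X
  cone : ∀ (t : F), ∀ x ∈ X, t • x ∈ X
  st : ∀ k ∈ K, ∀ x ∈ X, mat k *ᵥ x ∈ X
  ne : ∃ x ∈ X, x ≠ 0
  min : ∀ Y : Set (Fin n → F), Y ⊆ X → IsClosed Y → (∀ (t : F), ∀ x ∈ Y, t • x ∈ Y) →
    (∀ k ∈ K, ∀ x ∈ Y, mat k *ᵥ x ∈ Y) → (∃ x ∈ Y, x ≠ 0) → X ⊆ Y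

theorem exists_minCone (K : Subgroup (GL (Fin n) F)) (hn : 0 < n) : ∃ X, MinCone K X := by
  let PP : Set (TopologicalSpace.Closeds (Fin n → F)) := {Y | (∀ (t : F), ∀ x ∈ Y, t • x ∈ Y) ∧
    (∀ c ∈ K, ∀ x ∈ Y, mat c *ᵥ x ∈ Y) ∧ ∃ x ∈ Y, x ≠ 0}
  obtain ⟨Y, ⟨h1, h2, h3⟩, hmin⟩ := WellFounded.has_min
    (wellFounded_lt (α := TopologicalSpace.Closeds (Fin n → F))) PP ⟨⟨Set.univ, isClosed_univ⟩, fun _ _ _ => trivial,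
      fun _ _ _ _ => trivial, Pi.single ⟨0, hn⟩ 1, trivial, by simp⟩
  refine ⟨Y, Y.2, h1, h2, h3, fun Z hZ hZc h4 h5 h6 => ?_⟩
  have heq : (⟨Z, hZc⟩ : TopologicalSpace.Closeds (Fin n → F)) = Y := by
    by_contra hne
    exact hmin ⟨Z, hZc⟩ ⟨h4, h5, h6⟩ (lt_of_le_of_ne hZ hne)
  rw [← heq]
  exact subset_rfl

theorem regMap_lin {κ κ' : Type} [Fintype κ] [Fintype κ'] (L : (κ → F) →ₗ[F] (κ' → F)) : RegMap (fun v => L v) := by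
  refine RegMap.pi fun i => ?_
  exact reg_dual ((LinearMap.proj i : (κ' → F) →ₗ[F] F) ∘ₗ L) (σ := fun v => v) (fun j => reg_coord j)

theorem regMap_mulVec (A : Matrix (Fin n) (Fin n) F) : RegMap (fun v : Fin n → F => A *ᵥ v) :=
  regMap_lin (Matrix.toLin' A)

theorem closed_zero : IsClosed ({0} : Set (Fin n → F)) := by
  have : ({0} : Set (Fin n → F)) = ⋂ j, {v | v j = 0} := by
    ext v; simp [funext_iff]
  rw [this]
  exact isClosed_iInter fun j => isClosed_zero (reg_coord j)

theorem scal_mem {K : Subgroup (GL (Fin n) F)} (sc : scal F n ≤ K) {t : F} (ht : t ≠ 0) :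
    ∃ k ∈ K, mat k = t • (1 : Matrix (Fin n) (Fin n) F) :=
  ⟨scalarGL n (Units.mk0 t ht), sc (mem_scal.2 ⟨_, rfl⟩), scalarGL_val _⟩

theorem MinCone.orbit [IsAlgClosed F] {K : Subgroup (GL (Fin n) F)} (Kc : IsClosed (K : Set (GL (Fin n) F)))
    (Ki : IsIrreducible (K : Set (GL (Fin n) F))) (sc : scal F n ≤ K) {X : Set (Fin n → F)} (hX : MinCone K X)
    {x y : Fin n → F} (hx : x ∈ X) (hy : y ∈ X) (hx0 : x ≠ 0) (hy0 : y ≠ 0) : ∃ k ∈ K, y = mat k *ᵥ x := by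
  set φ : GL (Fin n) F → (Fin n → F) := fun k => mat k *ᵥ x with hφ
  have hφr : RegMap φ := RegMap.pi fun j => reg_mulVec x j
  set O := φ '' (K : Set (GL (Fin n) F)) with hO
  have hxO : x ∈ O := ⟨1, K.one_mem, by simp [hφ]⟩
  have hOst : ∀ k ∈ K, ∀ z ∈ closure O, mat k *ᵥ z ∈ closure O := by
    intro k hk z hz
    have hc := (regMap_mulVec (mat k)).continuous
    refine map_mem_closure hc hz ?_
    rintro _ ⟨l, hl, rfl⟩
    exact ⟨k * l, K.mul_mem hk hl, by simp [hφ, mat_mul, Matrix.mulVec_mulVec]⟩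
  have hOcone : ∀ t : F, t ≠ 0 → ∀ z ∈ closure O, t • z ∈ closure O := by
    intro t ht z hz
    obtain ⟨k, hk, hkt⟩ := scal_mem sc ht
    have := hOst k hk z hz
    rwa [hkt, Matrix.smul_mulVec, Matrix.one_mulVec] at this
  have hOX : closure O ⊆ X := by
    refine closure_minimal ?_ hX.closed
    rintro _ ⟨l, hl, rfl⟩
    exact hX.st l hl x hx
  obtain ⟨g, hg, ⟨k0, hk0, hgk0⟩, hgO⟩ := open_image Kc Ki (hφr.regOn _)
  have h0X : (0 : Fin n → F) ∈ X := by have := hX.cone 0 x hx; rwa [zero_smul] at this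
  by_contra hcon
  push Not at hcon
  have hyO : y ∈ closure O := by
    have := hX.min (closure O ∪ {0}) (Set.union_subset hOX (by simpa using h0X)) (isClosed_closure.union closed_zero)
      (fun t z hz => by
        by_cases ht : t = 0
        · right; rw [ht, zero_smul]; rfl
        rcases hz with hz | hz
        · left; exact hOcone t ht z hz
        · right; rw [Set.mem_singleton_iff.1 hz, smul_zero]; rfl)
      (fun k hk z hz => by
        rcases hz with hz | hz
        · left; exact hOst k hk z hz
        · right; rw [Set.mem_singleton_iff.1 hz, Matrix.mulVec_zero]; rfl) ⟨x, Or.inl (subset_closure hxO), hx0⟩ hy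
    rcases this with h | h
    · exact h
    · exact absurd h hy0
  let W : Set (Fin n → F) := (closure O ∩ {z | ∀ k ∈ K, g (mat k *ᵥ z) = 0}) ∪ {0}
  have hWc : IsClosed W := by
    refine (isClosed_closure.inter ?_).union closed_zero
    have : {z | ∀ k ∈ K, g (mat k *ᵥ z) = 0} = ⋂ k ∈ K, {z | g (mat k *ᵥ z) = 0} := by ext z; simp
    rw [this]
    exact isClosed_biInter fun k hk => isClosed_zero (regMap_mulVec (mat k) g hg)
  have hyW : y ∈ W := by
    refine Or.inl ⟨hyO, fun k hk => ?_⟩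
    by_contra hgk
    obtain ⟨l, hl, hl'⟩ := hgO _ (hOst k hk y hyO) hgk
    refine hcon (k⁻¹ * l) (K.mul_mem (K.inv_mem hk) hl) ?_
    rw [mat_mul, ← Matrix.mulVec_mulVec]
    change _ = _ *ᵥ φ l
    rw [hl', Matrix.mulVec_mulVec, mat_inv_mul, Matrix.one_mulVec]
  have hWx := hX.min W (Set.union_subset (fun z hz => hOX hz.1) (by simpa using h0X)) hWc
    (fun t z hz => by
        by_cases ht : t = 0
        · right; rw [ht, zero_smul]; rfl
        rcases hz with hz | hz
        · left
          refine ⟨hOcone t ht z hz.1, fun k hk => ?_⟩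
          obtain ⟨l, hl, hlt⟩ := scal_mem sc ht
          have := hz.2 (k * l) (K.mul_mem hk hl)
          rwa [mat_mul, hlt, mul_smul_comm, mul_one, Matrix.smul_mulVec, ← Matrix.mulVec_smul] at this
        · right; rw [Set.mem_singleton_iff.1 hz, smul_zero]; rfl)
      (fun k hk z hz => by
        rcases hz with hz | hz
        · left
          refine ⟨hOst k hk z hz.1, fun l hl => ?_⟩
          have := hz.2 (l * k) (K.mul_mem hl hk)
          rwa [mat_mul, ← Matrix.mulVec_mulVec] at this
        · right; rw [Set.mem_singleton_iff.1 hz, Matrix.mulVec_zero]; rfl) ⟨y, hyW, hy0⟩ hx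
  rcases hWx with h | h
  · exact hgk0 (h.2 k0 hk0)
  · exact hx0 h

theorem MinCone.span {K : Subgroup (GL (Fin n) F)}
    (irrK : ∀ W : Submodule F (Fin n → F), (∀ g ∈ K, ∀ v ∈ W, mat g *ᵥ v ∈ W) → W = ⊥ ∨ W = ⊤)
    {X : Set (Fin n → F)} (hX : MinCone K X) : Submodule.span F X = ⊤ := by
  rcases irrK (Submodule.span F X) (fun k hk => by
    have : Submodule.span F X ≤ (Submodule.span F X).comap (Matrix.toLin' (mat k)) :=
      Submodule.span_le.2 fun y hy => Submodule.subset_span (by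
        rw [Matrix.toLin'_apply]; exact hX.st k hk y hy)
    intro v hv
    have := this hv
    rwa [Submodule.mem_comap, Matrix.toLin'_apply] at this) with h | h
  · obtain ⟨x, hx, hx0⟩ := hX.ne
    have := Submodule.subset_span (R := F) hx
    rw [h] at this
    exact absurd this hx0
  · exact h

theorem MinCone.ext {K : Subgroup (GL (Fin n) F)}
    (irrK : ∀ W : Submodule F (Fin n → F), (∀ g ∈ K, ∀ v ∈ W, mat g *ᵥ v ∈ W) → W = ⊥ ∨ W = ⊤)
    {X : Set (Fin n → F)} (hX : MinCone K X) {A B : Matrix (Fin n) (Fin n) F} (h : ∀ x ∈ X, A *ᵥ x = B *ᵥ x) : A = B := by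
  apply Matrix.toLin'.injective
  apply LinearMap.ext_on (hX.span irrK)
  intro x hx
  rw [Matrix.toLin'_apply, Matrix.toLin'_apply, h x hx]

variable {K C1 : Subgroup (GL (Fin n) F)} {p : Fin r → Matrix (Fin n) (Fin n) F}
    {b : Fin r → GL (Fin n) F → F}

theorem Idem.exists_ne {p : Fin r → Matrix (Fin n) (Fin n) F} (hp : Idem p) {v : Fin n → F} (hv : v ≠ 0) :
    ∃ i, p i *ᵥ v ≠ 0 := by
  by_contra h
  push Not at h
  apply hv
  have : v = (∑ i, p i) *ᵥ v := by rw [hp.sum, Matrix.one_mulVec]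
  rw [this, Matrix.sum_mulVec]
  exact Finset.sum_eq_zero fun i _ => h i

theorem Dat.comm (D : Dat K C1 p b) {c : GL (Fin n) F} (hc : c ∈ C1) (i : Fin r) : mat c * p i = p i * mat c :=
  centr_comm (D.hC.le hc) i

theorem Dat.eigX [IsAlgClosed F] (D : Dat K C1 p b) {Y : Set (Fin n → F)} (hY : IsClosed Y)
    (hcone : ∀ (t : F), ∀ x ∈ Y, t • x ∈ Y) (hst : ∀ c ∈ C1, ∀ x ∈ Y, mat c *ᵥ x ∈ Y) (hne : ∃ x ∈ Y, x ≠ 0) :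
    ∃ v ∈ Y, v ≠ 0 ∧ ∃ j, p j *ᵥ v = v ∧ ∀ c ∈ C1, mat c *ᵥ v = b j c • v := by
  have hk := fp D.hC.irr (fun c => Matrix.toLin' (mat c)) ?_ ?_ ?_ ?_ hY hcone (by simpa using hst) hne
  · obtain ⟨v, hvY, hv0, hv⟩ := hk
    simp only [Matrix.toLin'_apply] at hv
    refine ⟨v, hvY, hv0, ?_⟩
    obtain ⟨c0, hc0, hinj⟩ := D.reg
    have hval : ∀ c ∈ C1, ∀ i, p i *ᵥ v ≠ 0 → mat c *ᵥ v = b i c • v := by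
      intro c hc i hi
      obtain ⟨β, hβ⟩ := hv c hc
      have : β = b i c := by
        refine eig_of_pow (D.bs c hc i) hi ?_ ?_
        · rw [Matrix.mulVec_mulVec, D.hp.idem]
        · rw [Matrix.mulVec_mulVec, D.comm hc, ← Matrix.mulVec_mulVec, hβ, Matrix.mulVec_smul]
      rw [hβ, this]
    obtain ⟨j, hj⟩ := D.hp.exists_ne hv0
    refine ⟨j, ?_, fun c hc => hval c hc j hj⟩
    have hother : ∀ i, i ≠ j → p i *ᵥ v = 0 := by
      intro i hij
      by_contra hi
      have h1 := hval c0 hc0 i hi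
      rw [hval c0 hc0 j hj] at h1
      apply hij
      apply hinj
      have h2 := sub_eq_zero.2 h1
      rw [← sub_smul] at h2
      rcases smul_eq_zero.1 h2 with h | h
      · exact (sub_eq_zero.1 h).symm
      · exact absurd h hv0
    have : v = (∑ i, p i) *ᵥ v := by rw [D.hp.sum, Matrix.one_mulVec]
    conv_rhs => rw [this, Matrix.sum_mulVec]
    rw [Finset.sum_eq_single j (fun i _ hi => hother i hi) (by simp)]
  · intro v j
    simp only [Matrix.toLin'_apply]
    exact reg_mulVec v j
  · intro c hc d hd v
    simp only [Matrix.toLin'_apply]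
    rw [mat_mul, Matrix.mulVec_mulVec]
  · intro v
    simp
  · intro U hU hUst
    simp only [Matrix.toLin'_apply] at hUst
    obtain ⟨u, hu, hu0⟩ := Submodule.exists_mem_ne_zero_of_ne_bot hU
    obtain ⟨i, hi⟩ := D.hp.exists_ne hu0
    have hk2 := kolU D.hC.irr (U.map (Matrix.toLin' (p i))) ?_ ?_ ?_
    · obtain ⟨ℓ, β, h1, ⟨_, ⟨w, hw, rfl⟩, hℓw⟩, h3, -⟩ := hk2
      refine ⟨ℓ ∘ₗ Matrix.toLin' (p i), β, h1, ⟨w, hw, hℓw⟩, fun c hc u hu => ?_⟩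
      rw [LinearMap.comp_apply, LinearMap.comp_apply, ← h3 c hc _ ⟨u, hu, rfl⟩, Matrix.toLin'_apply, Matrix.toLin'_apply,
        Matrix.toLin'_apply, Matrix.mulVec_mulVec, Matrix.mulVec_mulVec, D.comm hc]
    · intro h
      have : Matrix.toLin' (p i) u ∈ U.map (Matrix.toLin' (p i)) := ⟨u, hu, rfl⟩
      rw [h, Matrix.toLin'_apply] at this
      exact hi this
    · rintro c hc _ ⟨w, hw, rfl⟩
      refine ⟨mat c *ᵥ w, hUst c hc w hw, ?_⟩
      rw [Matrix.toLin'_apply, Matrix.toLin'_apply, Matrix.mulVec_mulVec, Matrix.mulVec_mulVec, D.comm hc]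
    · intro c hc
      refine ⟨b i c, n, ?_⟩
      rintro _ ⟨w, hw, rfl⟩
      rw [Matrix.toLin'_apply, Matrix.mulVec_mulVec, D.bs c hc, Matrix.zero_mulVec]

theorem Dat.bne (D : Dat K C1 p b) {c : GL (Fin n) F} (hc : c ∈ C1) (i : Fin r) : b i c ≠ 0 := by
  intro h
  have := D.bmul i c hc c⁻¹ (C1.inv_mem hc)
  rw [mul_inv_cancel, D.b1, h, zero_mul] at this
  exact one_ne_zero this

/-- The semisimple part of an element. -/
theorem Dat.tor (D : Dat K C1 p b) {c : GL (Fin n) F} (hc : c ∈ C1) :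
    ∃ t ∈ K, mat t = ∑ i, b i c • p i := by
  obtain ⟨s, hs, -⟩ := D.hp.glOf (fun i => b i c) (fun i => D.bne hc i)
  exact ⟨s, jordan D.Kc (D.hC.le hc).1 D.hp (D.bs c hc) hs, hs⟩

theorem Dat.extreme [IsAlgClosed F] (D : Dat K C1 p b) {X : Set (Fin n → F)} (hX : MinCone K X) :
    ∃ i0, ∀ x ∈ X, p i0 *ᵥ x ∈ X := by
  let M : (Fin r → F) → Matrix (Fin n) (Fin n) F := fun a => ∑ i, a i • p i
  let A : Set (Fin r → F) := {a | ∀ x ∈ X, M a *ᵥ x ∈ X}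
  have hA : IsClosed A := by
    have : A = ⋂ x ∈ X, (fun a => M a *ᵥ x) ⁻¹' X := by ext a; simp [A]
    rw [this]
    refine isClosed_biInter fun x hx => hX.closed.preimage ?_
    let L : (Fin r → F) →ₗ[F] (Fin n → F) :=
      { toFun := fun a => M a *ᵥ x
        map_add' := fun a a' => by
          simp only [M, Pi.add_apply, add_smul, Finset.sum_add_distrib, Matrix.add_mulVec]
        map_smul' := fun t a => by
          simp only [M, Pi.smul_apply, smul_eq_mul, mul_smul, ← Finset.smul_sum, Matrix.smul_mulVec, RingHom.id_apply] }
    exact (regMap_lin L).continuous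
  have hM1 : M 1 = 1 := by simp [M, D.hp.sum]
  have hr : 0 < r := by
    rcases Nat.eq_zero_or_pos r with h | h
    · subst h
      have hs := D.hp.sum
      haveI : Nonempty (Fin n) := ⟨⟨0, D.hn⟩⟩
      simp at hs
    · exact h
  have hk := fp D.hC.irr (κ := Fin r) (fun c => LinearMap.pi fun i => b i c • LinearMap.proj i) ?_ ?_ ?_ ?_
    (X := A) hA ?_ ?_ ⟨1, ?_, ?_⟩
  · obtain ⟨a, haA, ha0, hac⟩ := hk
    obtain ⟨c0, hc0, hinj⟩ := D.reg
    obtain ⟨β, hβ⟩ := hac c0 hc0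
    have : ∃ i0, a i0 ≠ 0 := by
      by_contra h
      push Not at h
      exact ha0 (funext h)
    obtain ⟨i0, hi0⟩ := this
    have hβi : ∀ i, a i ≠ 0 → b i c0 = β := by
      intro i hi
      have := congrFun hβ i
      simp only [LinearMap.pi_apply, LinearMap.smul_apply, LinearMap.proj_apply, smul_eq_mul, Pi.smul_apply] at this
      exact mul_right_cancel₀ hi this
    have hother : ∀ i, i ≠ i0 → a i = 0 := by
      intro i hi
      by_contra h
      exact hi (hinj (by simp only [hβi i h, hβi i0 hi0]))
    have hMa : M a = a i0 • p i0 := by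
      simp only [M]
      rw [Finset.sum_eq_single i0 (fun i _ hi => by rw [hother i hi, zero_smul]) (by simp)]
    refine ⟨i0, fun x hx => ?_⟩
    have := hX.cone (a i0)⁻¹ _ (haA x hx)
    rwa [hMa, Matrix.smul_mulVec, smul_smul, inv_mul_cancel₀ hi0, one_smul] at this
  · intro v j
    exact (D.hb j).mul (Reg.const _)
  · intro c hc d hd v
    funext j
    simp [D.bmul j c hc d hd, mul_assoc]
  · intro v
    funext j
    simp [D.b1]
  · intro U hU hUst
    obtain ⟨u, hu, hu0⟩ := Submodule.exists_mem_ne_zero_of_ne_bot hU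
    have : ∃ i0, u i0 ≠ 0 := by
      by_contra h
      push Not at h
      exact hu0 (funext h)
    obtain ⟨i, hi⟩ := this
    refine ⟨LinearMap.proj i, b i, D.hb i, ⟨u, hu, hi⟩, fun c hc u hu => ?_⟩
    simp
  · intro t a ha x hx
    have : M (t • a) = t • M a := by
      simp only [M, Pi.smul_apply, smul_eq_mul, mul_smul, ← Finset.smul_sum]
    rw [this, Matrix.smul_mulVec]
    exact hX.cone _ _ (ha x hx)
  · intro c hc a ha x hx
    obtain ⟨t, htK, ht⟩ := D.tor hc
    have h1 := hX.st t htK _ (ha x hx)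
    rw [Matrix.mulVec_mulVec, ht] at h1
    simp only [M] at h1
    rw [D.hp.sum_mul_sum] at h1
    exact h1
  · intro x hx
    rw [hM1, Matrix.one_mulVec]
    exact hx
  · intro h
    have := congrFun h ⟨0, hr⟩
    exact one_ne_zero this

end Cone
end DPD

namespace DPD

universe u

section Step7
variable {F : Type u} [Field F] {n r : ℕ}
open Matrix Module

variable {K C1 : Subgroup (GL (Fin n) F)} {p : Fin r → Matrix (Fin n) (Fin n) F}
    {b : Fin r → GL (Fin n) F → F}

theorem IsIdc.sub {C C1 D : Subgroup (GL (Fin n) F)} (h : IsIdc C C1) (hD : D ≤ C) (h1 : C1 ≤ D) : IsIdc D C1 := by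
  obtain ⟨R, hR, hRC, hR2⟩ := h.fin
  refine ⟨h1, h.closed, h.irr, fun T hT h1T hTD => h.big T hT h1T (hTD.trans hD), R ∩ D, hR.inter_of_left _,
    Set.inter_subset_right, fun c hc => ?_⟩
  obtain ⟨x, hx, hxc⟩ := hR2 c (hD hc)
  refine ⟨x, ⟨hx, ?_⟩, hxc⟩
  have : x = c * (x⁻¹ * c)⁻¹ := by group
  rw [this]
  exact D.mul_mem hc (D.inv_mem (h1 hxc))

theorem Dat.bval (D : Dat K C1 p b) {c : GL (Fin n) F} (hc : c ∈ C1) {i : Fin r} {β : F}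
    (h : mat c * p i = β • p i) : b i c = β := by
  obtain ⟨w, hw⟩ := range_ne D.hp i
  refine (eig_of_pow (D.bs c hc i) hw ?_ ?_).symm
  · rw [Matrix.mulVec_mulVec, D.hp.idem]
  · rw [Matrix.mulVec_mulVec, h, Matrix.smul_mulVec]

theorem Dat.binv (D : Dat K C1 p b) {c : GL (Fin n) F} (hc : c ∈ C1) (i : Fin r) : b i c⁻¹ = (b i c)⁻¹ := by
  apply eq_inv_of_mul_eq_one_left
  rw [← D.bmul i _ (C1.inv_mem hc) _ hc, inv_mul_cancel, D.b1]

theorem Dat.torset [IsAlgClosed F] (D : Dat K C1 p b) : ∃ φ : GL (Fin n) F → GL (Fin n) F,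
    RegOn (C1 : Set (GL (Fin n) F)) φ ∧ φ 1 = 1 ∧
    ∀ c ∈ C1, φ c ∈ C1 ∧ mat (φ c) = ∑ i, b i c • p i ∧ ∀ i, b i (φ c) = b i c := by
  have h0 : ∀ c, c ∈ C1 → ∃ s : GL (Fin n) F, mat s = ∑ i, b i c • p i ∧ mat s⁻¹ = ∑ i, (b i c)⁻¹ • p i :=
    fun c hc => D.hp.glOf _ (fun i => D.bne hc i)
  choose! φ h1 h2 using h0
  have hreg : RegOn (C1 : Set (GL (Fin n) F)) φ := by
    refine RegOn.gl (fun i j => ⟨fun c => ∑ k, b k c * p k i j, ?_, fun c hc => ?_⟩)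
      (fun i j => ⟨fun c => ∑ k, b k c⁻¹ * p k i j, ?_, fun c hc => ?_⟩)
    · exact Reg.sum _ fun k _ => (D.hb k).mul (Reg.const _)
    · have := h1 c hc
      change mat (φ c) i j = _
      rw [this, Matrix.sum_apply]
      rfl
    · refine Reg.sum _ fun k _ => ?_
      exact Reg.mul (regMap_inv _ (D.hb k)) (Reg.const _)
    · have := h2 c hc
      change mat (φ c)⁻¹ i j = _
      rw [this, Matrix.sum_apply]
      refine Finset.sum_congr rfl fun k _ => ?_
      rw [D.binv hc]
      rfl
  have hone : φ 1 = 1 := by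
    apply Units.ext
    change mat (φ 1) = mat 1
    rw [h1 1 C1.one_mem, mat_one, ← D.hp.sum]
    exact Finset.sum_congr rfl fun i _ => by rw [D.b1, one_smul]
  have hK : ∀ c ∈ C1, φ c ∈ centr K p := by
    intro c hc
    refine ⟨jordan D.Kc (D.hC.le hc).1 D.hp (D.bs c hc) (h1 c hc), fun i => cj_eq_self.2 ?_⟩
    rw [h1 c hc, D.hp.sum_mul, D.hp.mul_sum]
  have hC1 : ∀ c ∈ C1, φ c ∈ C1 := by
    intro c hc
    refine D.hC.big (φ '' C1) (hreg.irr_image D.hC.irr) ⟨1, C1.one_mem, hone⟩ ?_ ⟨c, hc, rfl⟩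
    rintro _ ⟨d, hd, rfl⟩
    exact hK d hd
  refine ⟨φ, hreg, hone, fun c hc => ⟨hC1 c hc, h1 c hc, fun i => D.bval (hC1 c hc) ?_⟩⟩
  rw [h1 c hc, D.hp.sum_mul]

/-- The stabilizer of a line. -/
def lineStab (K : Subgroup (GL (Fin n) F)) (v : Fin n → F) : Subgroup (GL (Fin n) F) where
  carrier := {k | k ∈ K ∧ ∃ a : F, a ≠ 0 ∧ mat k *ᵥ v = a • v}
  one_mem' := ⟨K.one_mem, 1, one_ne_zero, by simp⟩
  mul_mem' := by
    rintro k l ⟨hk, a, ha0, ha⟩ ⟨hl, a', ha0', ha'⟩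
    refine ⟨K.mul_mem hk hl, a * a', mul_ne_zero ha0 ha0', ?_⟩
    rw [mat_mul, ← Matrix.mulVec_mulVec, ha', Matrix.mulVec_smul, ha, smul_smul, mul_comm]
  inv_mem' := by
    rintro k ⟨hk, a, ha0, ha⟩
    refine ⟨K.inv_mem hk, a⁻¹, inv_ne_zero ha0, ?_⟩
    have : v = a⁻¹ • (mat k *ᵥ v) := by rw [ha, smul_smul, inv_mul_cancel₀ ha0, one_smul]
    conv_lhs => rw [this]
    rw [Matrix.mulVec_smul, Matrix.mulVec_mulVec, mat_inv_mul, Matrix.one_mulVec]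

theorem lineStab_closed (Kc : IsClosed (K : Set (GL (Fin n) F))) {v : Fin n → F} (hv : v ≠ 0) :
    IsClosed (lineStab K v : Set (GL (Fin n) F)) := by
  obtain ⟨j, hj⟩ : ∃ j, v j ≠ 0 := by
    by_contra h
    push Not at h
    exact hv (funext h)
  have : (lineStab K v : Set (GL (Fin n) F)) = (K : Set (GL (Fin n) F)) ∩
      ⋂ i, {k | (mat k *ᵥ v) i * v j = (mat k *ᵥ v) j * v i} := by
    ext k
    simp only [Set.mem_inter_iff, Set.mem_iInter, Set.mem_setOf_eq, SetLike.mem_coe]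
    constructor
    · rintro ⟨hk, a, ha0, ha⟩
      refine ⟨hk, fun i => ?_⟩
      rw [ha, Pi.smul_apply, Pi.smul_apply, smul_eq_mul, smul_eq_mul]; ring
    · rintro ⟨hk, h⟩
      have he : mat k *ᵥ v = ((mat k *ᵥ v) j * (v j)⁻¹) • v := by
        funext i
        rw [Pi.smul_apply, smul_eq_mul, mul_right_comm, ← h i, mul_assoc, mul_inv_cancel₀ hj, mul_one]
      refine ⟨hk, _, ?_, he⟩
      intro h0
      rw [h0, zero_smul] at he
      exact gl_ne_zero hv he
  rw [this]
  refine Kc.inter (isClosed_iInter fun i => ?_)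
  exact isClosed_eq' (f := fun k : GL (Fin n) F => (mat k *ᵥ v) i * v j) ((reg_mulVec v i).mul (Reg.const _))
    ((reg_mulVec v j).mul (Reg.const _))

theorem Dat.conjN [IsAlgClosed F] (D : Dat K C1 p b) {X : Set (Fin n → F)} (hX : MinCone K X)
    {v0 v : Fin n → F} (hv0X : v0 ∈ X) (hv00 : v0 ≠ 0) (hv0 : ∀ c ∈ C1, ∃ β : F, mat c *ᵥ v0 = β • v0)
    (hvX : v ∈ X) (hvn : v ≠ 0) {j : Fin r} (hj : p j *ᵥ v = v) :
    ∃ m ∈ normp K p, ∃ a : F, a ≠ 0 ∧ mat m *ᵥ v0 = a • v := by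
  obtain ⟨k, hk, hkv⟩ := hX.orbit D.Kc D.Ki D.sc hv0X hvX hv00 hvn
  obtain ⟨φ, hφ, hφ1, hφc⟩ := D.torset
  obtain ⟨P1, hP1⟩ := exists_idc (lineStab_closed D.Kc hv00)
  have hP1K : P1 ≤ K := fun x hx => (hP1.le hx).1
  have hkv' : mat k⁻¹ *ᵥ v = v0 := by rw [hkv, Matrix.mulVec_mulVec, mat_inv_mul, Matrix.one_mulVec]
  have hC1P : C1 ≤ P1 := by
    refine hP1.big C1 D.hC.irr C1.one_mem fun c hc => ?_
    obtain ⟨β, hβ⟩ := hv0 c hc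
    refine ⟨(D.hC.le hc).1, β, ?_, hβ⟩
    rintro rfl
    rw [zero_smul] at hβ
    exact gl_ne_zero hv00 hβ
  have hIp : IsIdc (centr P1 p) C1 :=
    D.hC.sub (fun x hx => ⟨hP1K hx.1, hx.2⟩) (fun c hc => ⟨hC1P hc, (D.hC.le hc).2⟩)
  set q : Fin r → Matrix (Fin n) (Fin n) F := fun i => cj k⁻¹ (p i) with hq
  have hqI : Idem q := D.hp.cj k⁻¹
  obtain ⟨D1, hD1⟩ := exists_idc (centr_closed hP1.closed q)
  have hkq : ∀ i, cj k (q i) = p i := fun i => by rw [hq]; simp only; rw [cj_cj, mul_inv_cancel, cj_one']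
  -- conjugating D1 into C1
  have hDC : ∀ d ∈ D1, k * d * k⁻¹ ∈ C1 := by
    intro d hd
    refine D.hC.big ((fun x => k * x * k⁻¹) '' D1) (((regMap_conj k).regOn _).irr_image hD1.irr)
      ⟨1, D1.one_mem, by simp⟩ ?_ ⟨d, hd, rfl⟩
    rintro _ ⟨e, he, rfl⟩
    have he' := hD1.le he
    refine ⟨K.mul_mem (K.mul_mem hk (hP1K he'.1)) (K.inv_mem hk), fun i => ?_⟩
    have h1 : cj e (q i) = q i := he'.2 i
    rw [← cj_cj, ← cj_cj]
    change cj k (cj e (q i)) = _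
    rw [h1, hkq]
  have hTP : ∀ c ∈ C1, k⁻¹ * φ c * k ∈ P1 := by
    intro c hc
    have hreg2 : RegOn (C1 : Set (GL (Fin n) F)) (fun c => k⁻¹ * φ c * k) := by
      intro f hf
      have h1 : RegMap (fun x : GL (Fin n) F => k⁻¹ * x * k) := RegMap.mul (regMap_lmul _) (RegMap.constGL k)
      exact hφ _ (h1 f hf)
    refine hP1.big ((fun c => k⁻¹ * φ c * k) '' C1) (hreg2.irr_image D.hC.irr) ⟨1, C1.one_mem, by simp [hφ1]⟩ ?_
      ⟨c, hc, rfl⟩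
    rintro _ ⟨e, he, rfl⟩
    refine ⟨K.mul_mem (K.mul_mem (K.inv_mem hk) (D.hC.le (hφc e he).1).1) hk, b j e, D.bne he j, ?_⟩
    simp only
    have : (∑ i, b i e • p i) *ᵥ v = b j e • v := by
      rw [← hj, Matrix.mulVec_mulVec, D.hp.sum_mul, Matrix.smul_mulVec]
    rw [mat_mul, mat_mul, ← Matrix.mulVec_mulVec, ← hkv, ← Matrix.mulVec_mulVec, (hφc e he).2.1, this,
      Matrix.mulVec_smul, hkv']
  have hTD : ∀ c ∈ C1, k⁻¹ * φ c * k ∈ D1 := by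
    intro c hc
    have hreg2 : RegOn (C1 : Set (GL (Fin n) F)) (fun c => k⁻¹ * φ c * k) := by
      intro f hf
      have h1 : RegMap (fun x : GL (Fin n) F => k⁻¹ * x * k) := RegMap.mul (regMap_lmul _) (RegMap.constGL k)
      exact hφ _ (h1 f hf)
    refine hD1.big ((fun c => k⁻¹ * φ c * k) '' C1) (hreg2.irr_image D.hC.irr) ⟨1, C1.one_mem, by simp [hφ1]⟩ ?_
      ⟨c, hc, rfl⟩
    rintro _ ⟨e, he, rfl⟩
    refine ⟨hTP e he, fun i => ?_⟩
    simp only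
    rw [← cj_cj, hkq, ← cj_cj, (D.hC.le (hφc e he).1).2 i]
  obtain ⟨c0, hc0, hinj0⟩ := D.reg
  obtain ⟨g1, hg1, hg1n, hg1z⟩ := domReg hP1.closed hP1.irr D.hp hIp (centr P1 p).one_mem D.hb
    (fun c hc i => by rw [one_mul]; exact D.bs c hc i) D.reg
  obtain ⟨g2, hg2, hg2n, hg2z⟩ := domReg hP1.closed hP1.irr hqI hD1 (centr P1 q).one_mem
    (b := fun i d => b i (k * d * k⁻¹)) (fun i => regMap_conj k _ (D.hb i))
    (fun d hd i => by
      rw [one_mul]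
      apply cj_inj k
      rw [cj_zero, cj_mul, cj_pow, cj_sub, cj_smul, cj_one, cj_mat, hkq]
      exact D.bs _ (hDC d hd) i)
    ⟨k⁻¹ * φ c0 * k, hTD c0 hc0, by
      have : k * (k⁻¹ * φ c0 * k) * k⁻¹ = φ c0 := by group
      simp only [this, (hφc c0 hc0).2.2]
      exact hinj0⟩
  obtain ⟨z, hz, hz1, hz2⟩ := irr_meet hP1.irr hg1 hg2 hg1n hg2n
  obtain ⟨x1, hx1, c, hc, hcinj, e1⟩ := hg1z z hz hz1
  obtain ⟨x2, hx2, d, hd, hdinj, e2⟩ := hg2z z hz hz2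
  rw [one_mul] at e1 e2
  set c' := k * d * k⁻¹ with hc'
  have hc'C : c' ∈ C1 := hDC d hd
  set m := k * x2⁻¹ * x1 with hm
  have hmK : m ∈ K := K.mul_mem (K.mul_mem hk (K.inv_mem (hP1K hx2))) (hP1K hx1)
  have hcm : c' = m * c * m⁻¹ := by
    have h1 : x1 * c * x1⁻¹ = x2 * d * x2⁻¹ := by rw [← e1, ← e2]
    have h2 : d = x2⁻¹ * (x1 * c * x1⁻¹) * x2 := by rw [h1]; group
    rw [hc', h2, hm]; group
  obtain ⟨σ, hσ⟩ := perm_lemma D.hp (D.hp.cj m) (x := mat c') (fun i => D.comm hc'C i)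
    (fun i => by
      rw [hcm, ← cj_mat, ← cj_mul, D.comm hc, cj_mul]) (b := fun i => b i c') hdinj (b' := fun i => b i c)
    (fun i => D.bs c' hc'C i)
    (fun i => by
      rw [hcm, ← cj_mat, ← cj_one m, ← cj_smul, ← cj_sub, ← cj_pow, ← cj_mul, D.bs c hc, cj_zero])
  refine ⟨m, ⟨hmK, σ.symm, fun i => ?_⟩, ?_⟩
  · rw [hσ (σ.symm i), Equiv.apply_symm_apply]
  · obtain ⟨-, a, ha0, ha⟩ := hP1.le (P1.mul_mem (P1.inv_mem hx2) hx1)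
    refine ⟨a, ha0, ?_⟩
    rw [hm, mul_assoc, mat_mul, ← Matrix.mulVec_mulVec, ha, Matrix.mulVec_smul, ← hkv]

end Step7
end DPD

namespace DPD

universe u

section Step8
variable {F : Type u} [Field F] {n r : ℕ}
open Matrix Module

variable {K C1 : Subgroup (GL (Fin n) F)} {p : Fin r → Matrix (Fin n) (Fin n) F}
    {b : Fin r → GL (Fin n) F → F}

theorem Dat.norm (D : Dat K C1 p b) {m : GL (Fin n) F} (hm : m ∈ normp K p) {c : GL (Fin n) F} (hc : c ∈ C1) :
    m * c * m⁻¹ ∈ C1 := by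
  refine D.hC.conj (k := m) ?_ c hc
  rintro c hc
  obtain ⟨hmK, σ, hσ⟩ := hm
  obtain ⟨hcK, hcp⟩ := mem_centr.1 hc
  refine mem_centr.2 ⟨K.mul_mem (K.mul_mem hmK hcK) (K.inv_mem hmK), fun i => ?_⟩
  obtain ⟨j, rfl⟩ := σ.surjective i
  rw [← hσ, cj_cj]
  have : m * c * m⁻¹ * m = m * c := by group
  rw [this, ← cj_cj, hcp]

theorem Dat.norm' (D : Dat K C1 p b) {m : GL (Fin n) F} (hm : m ∈ normp K p) {c : GL (Fin n) F} (hc : c ∈ C1) :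
    m⁻¹ * c * m ∈ C1 := by
  have := D.norm ((normp K p).inv_mem hm) hc
  rwa [inv_inv] at this

theorem Dat.ex [IsAlgClosed F] (D : Dat K C1 p b) {X : Set (Fin n → F)} (hX : MinCone K X) :
    ∃ (i0 : Fin r) (E : Set (Fin r)), i0 ∈ E ∧
      (∀ m ∈ normp K p, ∀ i ∈ E, ∃ j ∈ E, cj m (p i) = p j) ∧
      (∀ i ∈ E, ∃ m ∈ normp K p, cj m (p i0) = p i) ∧
      (∀ i ∈ E, ∀ c ∈ C1, mat c * p i = b i c • p i) ∧
      (∀ x ∈ X, (∀ i ∈ E, p i *ᵥ x = 0) → x = 0) := by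
  obtain ⟨i0, hi0⟩ := D.extreme hX
  obtain ⟨v0, hv0X, hv00, j0, hj0, hv0⟩ := D.eigX hX.closed hX.cone
    (fun c hc x hx => hX.st c (D.hC.le hc).1 x hx) hX.ne
  have key : ∀ {v : Fin n → F} {j : Fin r}, v ∈ X → v ≠ 0 → p j *ᵥ v = v →
      ∃ m ∈ normp K p, ∃ a : F, a ≠ 0 ∧ mat m *ᵥ v0 = a • v := fun hvX hvn hj =>
    D.conjN hX hv0X hv00 (fun c hc => ⟨_, hv0 c hc⟩) hvX hvn hj
  have scal0 : ∀ c ∈ C1, mat c * p i0 = b i0 c • p i0 := by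
    intro c hc
    refine hX.ext D.irrK fun x hx => ?_
    rw [← Matrix.mulVec_mulVec, Matrix.smul_mulVec]
    by_cases hv : p i0 *ᵥ x = 0
    · rw [hv]; simp
    have hpv : p i0 *ᵥ (p i0 *ᵥ x) = p i0 *ᵥ x := by rw [Matrix.mulVec_mulVec, D.hp.idem]
    obtain ⟨m, hm, a, ha, hma⟩ := key (hi0 x hx) hv hpv
    have hv' : p i0 *ᵥ x = a⁻¹ • mat m *ᵥ v0 := by rw [hma, smul_smul, inv_mul_cancel₀ ha, one_smul]
    have h1 : mat c *ᵥ (p i0 *ᵥ x) = b j0 (m⁻¹ * c * m) • (p i0 *ᵥ x) := by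
      have h2 : mat c * mat m = mat m * mat (m⁻¹ * c * m) := by
        rw [← mat_mul, ← mat_mul]; congr 1; group
      rw [hv', Matrix.mulVec_smul, Matrix.mulVec_mulVec, h2, ← Matrix.mulVec_mulVec, hv0 _ (D.norm' hm hc),
        Matrix.mulVec_smul, smul_comm]
    rw [h1, eig_of_pow (D.bs c hc i0) hv hpv h1]
  have hE : ∀ i, (∃ m ∈ normp K p, cj m (p i0) = p i) → ∀ c ∈ C1, mat c * p i = b i c • p i := by
    rintro i ⟨m, hm, hmi⟩ c hc
    have h1 : mat c * p i = b i0 (m⁻¹ * c * m) • p i := by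
      have := congrArg (cj m) (scal0 _ (D.norm' hm hc))
      rw [cj_mul, cj_mat, cj_smul, hmi] at this
      have h2 : m * (m⁻¹ * c * m) * m⁻¹ = c := by group
      rwa [h2] at this
    rw [h1, D.bval hc h1]
  refine ⟨i0, {i | ∃ m ∈ normp K p, cj m (p i0) = p i}, ⟨1, (normp K p).one_mem, cj_one' _⟩, ?_,
    fun i hi => hi, fun i hi => hE i hi, ?_⟩
  · rintro m hm i ⟨m', hm', hi⟩
    obtain ⟨σ, hσ⟩ := hm.2
    exact ⟨σ i, ⟨m * m', (normp K p).mul_mem hm hm', by rw [← cj_cj, hi, hσ]⟩, hσ i⟩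
  · by_contra! hcon
    obtain ⟨x, hxX, hx, hx0⟩ := hcon
    set Y : Set (Fin n → F) := {x | x ∈ X ∧ ∀ i, (∃ m ∈ normp K p, cj m (p i0) = p i) → p i *ᵥ x = 0} with hY
    obtain ⟨v, hvY, hv, j, hj, -⟩ := D.eigX (Y := Y) (by
        have : Y = X ∩ ⋂ i, ⋂ (_ : ∃ m ∈ normp K p, cj m (p i0) = p i), (fun v => p i *ᵥ v) ⁻¹' {0} := by
          ext y
          simp only [hY, Set.mem_setOf_eq, Set.mem_inter_iff, Set.mem_iInter, Set.mem_preimage, Set.mem_singleton_iff]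
        rw [this]
        exact hX.closed.inter (isClosed_iInter fun i => isClosed_iInter fun _ =>
          closed_zero.preimage (regMap_mulVec (p i)).continuous))
      (fun t y hy => ⟨hX.cone t y hy.1, fun i hi => by rw [Matrix.mulVec_smul, hy.2 i hi, smul_zero]⟩)
      (fun c hc y hy => ⟨hX.st c (D.hC.le hc).1 y hy.1, fun i hi => by
        rw [Matrix.mulVec_mulVec, ← D.comm hc, ← Matrix.mulVec_mulVec, hy.2 i hi, Matrix.mulVec_zero]⟩)
      ⟨x, ⟨hxX, fun i hi => hx i hi⟩, hx0⟩
    obtain ⟨m, hm, a, ha, hma⟩ := key hvY.1 hv hj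
    obtain ⟨w, hwX, hw⟩ : ∃ w ∈ X, p i0 *ᵥ w ≠ 0 := by
      by_contra! h
      refine D.hp.ne i0 (hX.ext D.irrK fun x hx => ?_)
      rw [h x hx, Matrix.zero_mulVec]
    have hpw : p i0 *ᵥ (p i0 *ᵥ w) = p i0 *ᵥ w := by rw [Matrix.mulVec_mulVec, D.hp.idem]
    obtain ⟨m', hm', a', ha', hma'⟩ := key (hi0 w hwX) hw hpw
    have hmm := (normp K p).mul_mem hm ((normp K p).inv_mem hm')
    obtain ⟨σ, hσ⟩ := hmm.2
    have h0 := hvY.2 (σ i0) ⟨_, hmm, hσ i0⟩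
    have h1 : cj (m * m'⁻¹) (p i0) * mat (m * m'⁻¹) = mat (m * m'⁻¹) * p i0 := by
      rw [cj, Matrix.mul_assoc, mat_inv_mul, Matrix.mul_one]
    have h2 : mat (m * m'⁻¹) *ᵥ (p i0 *ᵥ w) = (a'⁻¹ * a) • v := by
      have : p i0 *ᵥ w = a'⁻¹ • mat m' *ᵥ v0 := by rw [hma', smul_smul, inv_mul_cancel₀ ha', one_smul]
      rw [this, Matrix.mulVec_smul, Matrix.mulVec_mulVec, ← mat_mul, inv_mul_cancel_right, hma, smul_smul]
    have h3 : p (σ i0) *ᵥ ((a'⁻¹ * a) • v) = (a'⁻¹ * a) • v := by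
      rw [← h2, ← hσ, Matrix.mulVec_mulVec, h1, ← Matrix.mulVec_mulVec, hpw]
    rw [Matrix.mulVec_smul, h0, smul_zero] at h3
    exact smul_ne_zero (mul_ne_zero (inv_ne_zero ha') ha) hv h3.symm

/-- Elements of `C1` on which all extreme characters are trivial form a finite group. -/
theorem Dat.fin [IsAlgClosed F] (D : Dat K C1 p b) {X : Set (Fin n → F)} (hX : MinCone K X) {E : Set (Fin r)}
    (hE : ∀ i ∈ E, ∀ c ∈ C1, mat c * p i = b i c • p i)
    (hE0 : ∀ x ∈ X, (∀ i ∈ E, p i *ᵥ x = 0) → x = 0) :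
    ∃ J : Subgroup (GL (Fin n) F), (∀ c, c ∈ J ↔ c ∈ C1 ∧ ∀ i ∈ E, b i c = 1) ∧ (J : Set (GL (Fin n) F)).Finite := by
  classical
  let J : Subgroup (GL (Fin n) F) :=
    { carrier := {c | c ∈ C1 ∧ ∀ i ∈ E, b i c = 1}
      one_mem' := ⟨C1.one_mem, fun i _ => D.b1 i⟩
      mul_mem' := by
        rintro c d ⟨hc, hc'⟩ ⟨hd, hd'⟩
        exact ⟨C1.mul_mem hc hd, fun i hi => by rw [D.bmul i c hc d hd, hc' i hi, hd' i hi, one_mul]⟩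
      inv_mem' := by
        rintro c ⟨hc, hc'⟩
        exact ⟨C1.inv_mem hc, fun i hi => by rw [D.binv hc, hc' i hi, inv_one]⟩ }
  have hJ : ∀ c, c ∈ J ↔ c ∈ C1 ∧ ∀ i ∈ E, b i c = 1 := fun c => Iff.rfl
  refine ⟨J, hJ, ?_⟩
  have hJc : IsClosed (J : Set (GL (Fin n) F)) := by
    have : (J : Set (GL (Fin n) F)) = (C1 : Set (GL (Fin n) F)) ∩ ⋂ i, ⋂ (_ : i ∈ E), {c | b i c = 1} := by
      ext c; simp [hJ]
    rw [this]
    exact D.hC.closed.inter (isClosed_iInter fun i => isClosed_iInter fun _ =>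
      isClosed_eq' (D.hb i) (Reg.const 1))
  obtain ⟨J1, hJ1⟩ := exists_idc hJc
  have hJ1t : ∀ c ∈ J1, c = 1 := by
    intro c hc
    have : mat c = mat 1 := by
      refine hX.ext D.irrK fun x hx => ?_
      refine ft (ι := E × Fin n) hX.closed hX.cone
        (fun i => (LinearMap.proj i.2).comp (Matrix.mulVecLin (p i.1))) ?_ hJ1.irr
        (σ := fun c : GL (Fin n) F => mat c *ᵥ x) (fun j => reg_mulVec x j)
        (fun c hc => hX.st c (D.hC.le ((hJ c).1 (hJ1.le hc)).1).1 x hx) ?_ c hc 1 J1.one_mem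
      · intro y hy h
        refine hE0 y hy fun i hi => ?_
        ext j
        simpa using h (⟨i, hi⟩, j)
      · have : ∀ a ∈ J1, ∀ i : E, p i *ᵥ (mat a *ᵥ x) = p i *ᵥ x := by
          intro a ha i
          obtain ⟨haC, ha1⟩ := (hJ a).1 (hJ1.le ha)
          rw [Matrix.mulVec_mulVec, ← D.comm haC, hE i i.2 a haC, ha1 i i.2, one_smul]
        intro a ha a' ha' i
        simp [-Matrix.mulVec_mulVec, this a ha, this a' ha']
    exact Units.ext this
  obtain ⟨R, hR, -, hR2⟩ := hJ1.fin
  refine hR.subset fun c hc => ?_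
  obtain ⟨x, hx, hxc⟩ := hR2 c hc
  have := inv_mul_eq_one.1 (hJ1t _ hxc)
  rwa [← this]

end Step8
end DPD

namespace DPD

universe u

section Step10
variable {F : Type u} [Field F] {n r : ℕ}
open Matrix Module
open scoped commutatorElement

variable {K C1 : Subgroup (GL (Fin n) F)} {p : Fin r → Matrix (Fin n) (Fin n) F}
    {b : Fin r → GL (Fin n) F → F}

theorem comm_conj {Γ : Type*} [Group Γ] {K : Subgroup Γ} {c h : Γ} (hc : c ∈ K) (hh : h ∈ ⁅K, K⁆) :
    c * h * c⁻¹ ∈ ⁅K, K⁆ := by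
  have h1 : h ∈ K := (Subgroup.commutator_le_self K) hh
  have h2 : c * h * c⁻¹ = ⁅c, h⁆ * h := by rw [commutatorElement_def]; group
  rw [h2]
  exact mul_mem (Subgroup.commutator_mem_commutator hc h1) hh

theorem comm_pow {Γ : Type*} [Group Γ] {K : Subgroup Γ} {c h : Γ} (hc : c ∈ K) (hh : h ∈ ⁅K, K⁆) (M : ℕ) :
    ∃ h' ∈ ⁅K, K⁆, (h * c) ^ M = h' * c ^ M := by
  induction M with
  | zero => exact ⟨1, one_mem _, by simp⟩
  | succ M ih =>
    obtain ⟨h', hh', e⟩ := ih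
    refine ⟨h * (c * h' * c⁻¹), mul_mem hh (comm_conj hc hh'), ?_⟩
    rw [pow_succ', e, pow_succ']; group

theorem comm_list {Γ : Type*} [Group Γ] {K : Subgroup Γ} {c : Γ} (hc : c ∈ K) (l : List Γ)
    (hl : ∀ x ∈ l, ∃ k ∈ K, x = k * c * k⁻¹) :
    ∃ h' ∈ ⁅K, K⁆, l.prod = h' * c ^ l.length := by
  induction l with
  | nil => exact ⟨1, one_mem _, by simp⟩
  | cons x l ih =>
    obtain ⟨h', hh', e⟩ := ih fun y hy => hl y (List.mem_cons_of_mem _ hy)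
    obtain ⟨k, hk, rfl⟩ := hl x List.mem_cons_self
    refine ⟨⁅k, c⁆ * (c * h' * c⁻¹), mul_mem (Subgroup.commutator_mem_commutator hk hc) (comm_conj hc hh'), ?_⟩
    rw [List.prod_cons, e, List.length_cons, pow_succ', commutatorElement_def]; group

def Dat.chi (D : Dat K C1 p b) (i : Fin r) : C1 →* F where
  toFun c := b i c
  map_one' := D.b1 i
  map_mul' c d := D.bmul i c c.2 d d.2

theorem Dat.scC (D : Dat K C1 p b) [Infinite F] : scal F n ≤ C1 := by
  refine D.hC.big _ (scal_irr D.hn) (scal F n).one_mem ?_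
  intro z hz
  refine mem_centr.2 ⟨D.sc hz, fun i => ?_⟩
  rw [cj_eq_self]
  obtain ⟨c, rfl⟩ := mem_scal.1 hz
  rw [scalarGL_val]; simp

theorem Dat.pow_mem [IsAlgClosed F] (D : Dat K C1 p b) {i0 : Fin r} {E : Set (Fin r)}
    (hE : ∀ i ∈ E, ∃ m ∈ normp K p, cj m (p i0) = p i) (hi0 : i0 ∈ E)
    (hEs : ∀ i ∈ E, ∀ c ∈ C1, mat c * p i = b i c • p i)
    {J : Subgroup (GL (Fin n) F)} (hJ : ∀ c, c ∈ J ↔ c ∈ C1 ∧ ∀ i ∈ E, b i c = 1)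
    (hJf : (J : Set (GL (Fin n) F)).Finite) :
    ∃ L : ℕ, 0 < L ∧ ∀ c ∈ C1, c ^ L ∈ ⁅K, K⁆ ⊔ scal F n := by
  classical
  haveI : Infinite F := inferInstance
  set N := normp K p with hN
  let N' := C1.subgroupOf N
  haveI : Finite (N ⧸ N') := by
    obtain ⟨R, hR, hRN, hR2⟩ := normp_fin D.hC
    haveI := hR.to_subtype
    refine Finite.of_surjective (fun x : R => (QuotientGroup.mk (⟨x, hRN x.2⟩ : N) : N ⧸ N')) ?_
    intro q
    obtain ⟨m, rfl⟩ := QuotientGroup.mk_surjective q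
    obtain ⟨x, hx, hxm⟩ := hR2 m m.2
    refine ⟨⟨x, hx⟩, ?_⟩
    rw [QuotientGroup.eq]
    exact hxm
  haveI := Fintype.ofFinite (N ⧸ N')
  haveI : Finite J := hJf
  refine ⟨Fintype.card (N ⧸ N') * Nat.card J, Nat.mul_pos Fintype.card_pos Nat.card_pos, fun c hc => ?_⟩
  have hK : ∀ {m : N}, (m : GL (Fin n) F) ∈ K := fun {m} => m.2.1
  have hcK : c ∈ K := (D.hC.le hc).1
  have hco : ∀ i, ∀ m : N, b i ((QuotientGroup.mk m : N ⧸ N').out * c * ((QuotientGroup.mk m : N ⧸ N').out : GL (Fin n) F)⁻¹)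
      = b i (m * c * (m : GL (Fin n) F)⁻¹) := by
    intro i m
    obtain ⟨d, hd⟩ := QuotientGroup.mk_out_eq_mul N' m
    have hdC : (d : N).1 ∈ C1 := d.2
    rw [hd]
    have : ((m * d : N) : GL (Fin n) F) * c * ((m * d : N) : GL (Fin n) F)⁻¹
        = ((m : GL (Fin n) F) * (d : N).1 * (m : GL (Fin n) F)⁻¹) * (m * c * (m : GL (Fin n) F)⁻¹) *
          ((m : GL (Fin n) F) * (d : N).1 * (m : GL (Fin n) F)⁻¹)⁻¹ := by
      rw [Subgroup.coe_mul]; group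
    have h1 := D.norm m.2 hdC
    have h2 := D.norm m.2 hc
    rw [this, D.bmul i _ (C1.mul_mem h1 h2) _ (C1.inv_mem h1), D.bmul i _ h1 _ h2, D.binv h1,
      mul_comm (b i _) (b i _), mul_assoc, mul_inv_cancel₀ (D.bne h1 i), mul_one]
  let g : N ⧸ N' → C1 := fun q => ⟨q.out * c * (q.out : GL (Fin n) F)⁻¹, D.norm q.out.2 hc⟩
  let y : C1 := ((Finset.univ : Finset (N ⧸ N')).toList.map g).prod
  have hby : ∀ i, b i y = ∏ q, b i (g q) := by
    intro i
    have : D.chi i y = ∏ q, D.chi i (g q) := by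
      rw [map_list_prod, List.map_map, ← Finset.prod_map_toList]; rfl
    exact this
  have hbe : ∀ i ∈ E, b i y = b i0 y := by
    intro i hi
    obtain ⟨m, hm, hmi⟩ := hE i hi
    have hbm : ∀ d ∈ C1, b i d = b i0 (m⁻¹ * d * m) := by
      intro d hd
      refine D.bval hd ?_
      have := congrArg (cj m) (hEs i0 hi0 _ (D.norm' hm hd))
      rw [cj_mul, cj_mat, cj_smul, hmi] at this
      have h2 : m * (m⁻¹ * d * m) * m⁻¹ = d := by group
      rwa [h2] at this
    rw [hby, hby, ← Equiv.prod_comp (MulAction.toPerm (⟨m, hm⟩⁻¹ : N) : Equiv.Perm (N ⧸ N')) (fun q => b i0 (g q))]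
    refine Finset.prod_congr rfl fun q _ => ?_
    rw [hbm _ (g q).2]
    have h1 : (MulAction.toPerm (⟨m, hm⟩⁻¹ : N) : Equiv.Perm (N ⧸ N')) q
        = QuotientGroup.mk ((⟨m, hm⟩⁻¹ : N) * q.out) := by
      conv_lhs => rw [← QuotientGroup.out_eq' q]
      rfl
    have h2 := hco i0 ((⟨m, hm⟩⁻¹ : N) * q.out)
    rw [h1]
    refine Eq.trans ?_ h2.symm
    congr 1
    simp only [g, Subgroup.coe_mul, Subgroup.coe_inv]
    group
  obtain ⟨h, hh, hy⟩ := comm_list hcK (((Finset.univ : Finset (N ⧸ N')).toList.map g).map (Subtype.val : C1 → GL (Fin n) F)) (by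
    intro x hx
    simp only [List.mem_map] at hx
    obtain ⟨_, ⟨q, -, rfl⟩, rfl⟩ := hx
    exact ⟨q.out, hK, rfl⟩)
  have hlen : (((Finset.univ : Finset (N ⧸ N')).toList.map g).map (Subtype.val : C1 → GL (Fin n) F)).length
      = Fintype.card (N ⧸ N') := by simp [Finset.card_univ]
  have hyp : (((Finset.univ : Finset (N ⧸ N')).toList.map g).map (Subtype.val : C1 → GL (Fin n) F)).prod
      = (y : GL (Fin n) F) := (map_list_prod C1.subtype _).symm
  rw [hlen, hyp] at hy
  let β : Fˣ := Units.mk0 (b i0 y) (D.bne y.2 i0)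
  have hz : scalarGL n β ∈ scal F n := mem_scal.2 ⟨β, rfl⟩
  have hzC := D.scC hz
  set z := scalarGL n β with hzd
  have hbz : ∀ i, b i z = β := fun i => D.bval hzC (by rw [hzd, scalarGL_val]; simp)
  have hzJ : z⁻¹ * y ∈ J := by
    refine (hJ _).2 ⟨C1.mul_mem (C1.inv_mem hzC) y.2, fun i hi => ?_⟩
    rw [D.bmul i _ (C1.inv_mem hzC) _ y.2, D.binv hzC, hbz, hbe i hi]
    exact inv_mul_cancel₀ (D.bne y.2 i0)
  have hpow : (z⁻¹ * y) ^ Nat.card J = 1 := by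
    have := pow_card_eq_one' (x := (⟨_, hzJ⟩ : J))
    exact congrArg Subtype.val this
  have hpy : (y : GL (Fin n) F) ^ Nat.card J = z ^ Nat.card J := by
    have hcm : Commute z⁻¹ (y : GL (Fin n) F) := scal_comm ((scal F n).inv_mem hz) _
    rw [hcm.mul_pow, inv_pow, inv_mul_eq_one] at hpow
    exact hpow.symm
  obtain ⟨h', hh', e⟩ := comm_pow (K.pow_mem hcK (Fintype.card (N ⧸ N'))) hh (Nat.card J)
  rw [← hy, hpy, ← pow_mul] at e
  have : c ^ (Fintype.card (N ⧸ N') * Nat.card J) = h'⁻¹ * z ^ Nat.card J := by rw [e]; group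
  rw [this]
  exact mul_mem (Subgroup.mem_sup_left (inv_mem hh')) (Subgroup.mem_sup_right ((scal F n).pow_mem hz _))

theorem regMap_pow (M : ℕ) : RegMap (fun x : GL (Fin n) F => x ^ M) := by
  induction M with
  | zero => simpa using RegMap.constGL (α := GL (Fin n) F) (1 : GL (Fin n) F)
  | succ M ih => simpa only [pow_succ] using RegMap.mul ih RegMap.id

theorem perfect [IsAlgClosed F] (hn : 0 < n) (Kc : IsClosed (K : Set (GL (Fin n) F)))
    (Ki : IsIrreducible (K : Set (GL (Fin n) F))) (sc : scal F n ≤ K)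
    (irrK : ∀ W : Submodule F (Fin n → F), (∀ g ∈ K, ∀ v ∈ W, mat g *ᵥ v ∈ W) → W = ⊥ ∨ W = ⊤) :
    K ≤ ⁅K, K⁆ ⊔ scal F n := by
  classical
  obtain ⟨r, C1, p, b, D⟩ := exists_dat hn Kc Ki sc irrK
  obtain ⟨X, hX⟩ := exists_minCone K hn
  obtain ⟨i0, E, hi0, -, hE, hEs, hE0⟩ := D.ex hX
  obtain ⟨J, hJ, hJf⟩ := D.fin hX hEs hE0
  obtain ⟨M, hM, hpow⟩ := D.pow_mem hE hi0 hEs hJ hJf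
  have hbpow : ∀ i, ∀ c ∈ C1, ∀ k : ℕ, b i (c ^ k) = b i c ^ k := fun i c hc k =>
    map_pow (D.chi i) ⟨c, hc⟩ k
  have hfin : ∀ z, {s ∈ (C1 : Set (GL (Fin n) F)) | s ^ M = z}.Finite := by
    intro z
    refine Set.Finite.of_finite_fibers (fun (s : GL (Fin n) F) (i : Fin r) => b i s) ?_ ?_
    · refine Set.Finite.subset (Set.Finite.pi (t := fun i => {x : F | x ^ M = b i z}) fun i => ?_) ?_
      · refine (Polynomial.nthRoots M (b i z)).toFinset.finite_toSet.subset fun x hx => ?_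
        simpa [Polynomial.mem_nthRoots hM] using hx
      · rintro _ ⟨s, ⟨hs, rfl⟩, rfl⟩ i -
        exact (hbpow i s hs M).symm
    · rintro _ ⟨s, ⟨hs, -⟩, rfl⟩
      refine (hJf.image (fun j => s * j)).subset ?_
      rintro t ⟨⟨ht, -⟩, htb⟩
      refine ⟨s⁻¹ * t, (hJ _).2 ⟨C1.mul_mem (C1.inv_mem hs) ht, fun i _ => ?_⟩, by simp⟩
      have hti : b i t = b i s := congrFun htb i
      rw [D.bmul i _ (C1.inv_mem hs) _ ht, D.binv hs, hti, inv_mul_cancel₀ (D.bne hs i)]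
  have hC1 : C1 ≤ ⁅K, K⁆ ⊔ scal F n := by
    have hreg := (regMap_pow (F := F) (n := n) M).regOn (C1 : Set (GL (Fin n) F))
    have hdim := dim_finite_fibres D.hC.closed D.hC.irr hreg hfin
    have hcl := eq_of_dim (hreg.irr_image D.hC.irr) D.hC.irr
      (by rintro _ ⟨s, hs, rfl⟩; exact C1.pow_mem hs M) hdim.le
    obtain ⟨g, hg, ⟨x, hx, hgx⟩, hgz⟩ := open_image D.hC.closed D.hC.irr hreg
    refine open_gen D.hC.irr hg ⟨x ^ M, C1.pow_mem hx M, hgx⟩ fun z hz hgz' => ?_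
    obtain ⟨s, hs, rfl⟩ := hgz z (hcl hz) hgz'
    exact hpow s hs
  obtain ⟨g, hg, hgn, hgz⟩ := domReg Kc Ki D.hp D.hC (centr K p).one_mem D.hb
    (fun c hc i => by rw [one_mul]; exact D.bs c hc i) D.reg
  refine open_gen Ki hg hgn fun z hz hz0 => ?_
  obtain ⟨k, hk, c, hc, -, rfl⟩ := hgz z hz hz0
  have : k * (1 * c) * k⁻¹ = ⁅k, c⁆ * c := by rw [commutatorElement_def]; group
  rw [this]
  exact mul_mem (Subgroup.mem_sup_left (Subgroup.commutator_mem_commutator hk (D.hC.le hc).1)) (hC1 hc)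

end Step10
end DPD

namespace DPD

universe u

section Final
variable {F : Type u} [Field F] {n : ℕ}
open Matrix Module
open scoped commutatorElement

theorem scal_closed (hn : 0 < n) : IsClosed (scal F n : Set (GL (Fin n) F)) := by
  have : (scal F n : Set (GL (Fin n) F)) = ⋂ i, ⋂ j,
      {g | mat g i j = mat g ⟨0, hn⟩ ⟨0, hn⟩ * (1 : Matrix (Fin n) (Fin n) F) i j} := by
    ext g
    simp only [Set.mem_iInter, Set.mem_setOf_eq, SetLike.mem_coe]
    constructor
    · intro h i j
      obtain ⟨c, rfl⟩ := mem_scal.1 h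
      rw [scalarGL_val]
      simp
    · intro h
      refine mem_scal_of_comm (c := mat g ⟨0, hn⟩ ⟨0, hn⟩) hn ?_
      ext i j
      rw [h i j]; simp
  rw [this]
  exact isClosed_iInter fun i => isClosed_iInter fun j =>
    isClosed_eq' (reg_entry i j) ((reg_entry _ _).mul (Reg.const _))

/-- The closure of a subgroup. -/
def clSub (K : Subgroup (GL (Fin n) F)) : Subgroup (GL (Fin n) F) where
  carrier := closure (K : Set (GL (Fin n) F))
  one_mem' := subset_closure K.one_mem
  mul_mem' := by
    have h1 : ∀ a ∈ K, ∀ x ∈ closure (K : Set (GL (Fin n) F)), a * x ∈ closure (K : Set (GL (Fin n) F)) := by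
      intro a ha
      have : closure (K : Set (GL (Fin n) F)) ⊆ (fun x => a * x) ⁻¹' closure (K : Set (GL (Fin n) F)) :=
        closure_minimal (fun x hx => subset_closure (K.mul_mem ha hx))
          (isClosed_closure.preimage (regMap_lmul a).continuous)
      exact this
    intro x y hx hy
    have : closure (K : Set (GL (Fin n) F)) ⊆ (fun x => x * y) ⁻¹' closure (K : Set (GL (Fin n) F)) :=
      closure_minimal (fun x hx => h1 x hx y hy)
        (isClosed_closure.preimage (regMap_rmul y).continuous)
    exact this hx
  inv_mem' := by
    intro x hx
    have : closure (K : Set (GL (Fin n) F)) ⊆ (fun x => x⁻¹) ⁻¹' closure (K : Set (GL (Fin n) F)) :=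
      closure_minimal (fun x hx => subset_closure (K.inv_mem hx))
        (isClosed_closure.preimage regMap_inv.continuous)
    exact this hx

/-- The product of the scalars with a subgroup. -/
def sprod (G1 : Subgroup (GL (Fin n) F)) : Subgroup (GL (Fin n) F) where
  carrier := {x | ∃ s ∈ (scal F n : Set (GL (Fin n) F)), ∃ t ∈ (G1 : Set (GL (Fin n) F)), x = s * t}
  one_mem' := ⟨1, (scal F n).one_mem, 1, G1.one_mem, by simp⟩
  mul_mem' := by
    rintro _ _ ⟨s, hs, t, ht, rfl⟩ ⟨s', hs', t', ht', rfl⟩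
    refine ⟨s * s', (scal F n).mul_mem hs hs', t * t', G1.mul_mem ht ht', ?_⟩
    rw [mul_assoc, ← mul_assoc t, ← scal_comm hs' t]; group
  inv_mem' := by
    rintro _ ⟨s, hs, t, ht, rfl⟩
    refine ⟨s⁻¹, (scal F n).inv_mem hs, t⁻¹, G1.inv_mem ht, ?_⟩
    rw [_root_.mul_inv_rev, scal_comm ((scal F n).inv_mem hs)]

theorem sprod_closed [IsAlgClosed F] (hn : 0 < n) {G1 : Subgroup (GL (Fin n) F)}
    (hc : IsClosed (G1 : Set (GL (Fin n) F))) (hi : IsIrreducible (G1 : Set (GL (Fin n) F))) :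
    IsClosed (sprod G1 : Set (GL (Fin n) F)) := by
  have him : (fun x : ZProd (GL (Fin n) F) (GL (Fin n) F) => x.fst * x.snd) ''
      (zprod (scal F n : Set (GL (Fin n) F)) (G1 : Set (GL (Fin n) F))) = (sprod G1 : Set (GL (Fin n) F)) := by
    ext x
    constructor
    · rintro ⟨y, hy, rfl⟩
      exact ⟨y.fst, hy.1, y.snd, hy.2, rfl⟩
    · rintro ⟨s, hs, t, ht, rfl⟩
      exact ⟨⟨s, t⟩, ⟨hs, ht⟩, rfl⟩
  obtain ⟨g, hg, ⟨x, hx, hgx⟩, hgz⟩ := open_image (zprod_closed (scal_closed hn) hc)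
    (zprod_irr (scal_irr hn) hi) (regMap_pmul.regOn _)
  rw [him] at hgz
  have hirr : IsIrreducible (clSub (sprod G1) : Set (GL (Fin n) F)) := (irr_mul (scal_irr hn) hi).closure
  have : clSub (sprod G1) ≤ sprod G1 :=
    open_gen hirr hg ⟨_, subset_closure (him ▸ ⟨x, hx, rfl⟩), hgx⟩ fun z hz h => hgz z hz h
  exact isClosed_of_closure_subset this

theorem le_sprod [IsAlgClosed F] {G G1 : Subgroup (GL (Fin n) F)} (hn : 0 < n) (h : IsIdc G G1)
    (hconn : GLZConnected (scalarSaturation (G : Set (GL (Fin n) F)))) : G ≤ sprod G1 := by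
  have hKc := sprod_closed hn h.closed h.irr
  obtain ⟨R, hR, hRG, hR2⟩ := h.fin
  set K := sprod G1 with hK
  have hG1K : G1 ≤ K := fun t ht => ⟨1, (scal F n).one_mem, t, ht, by simp⟩
  have hsK : scal F n ≤ K := fun s hs => ⟨s, hs, 1, G1.one_mem, by simp⟩
  set V : Set (GL (Fin n) F) := ⋃ r ∈ R \ K, (fun x => r⁻¹ * x) ⁻¹' (K : Set (GL (Fin n) F)) with hV
  have hVc : IsClosed V := by
    refine Set.Finite.isClosed_biUnion (hR.subset Set.diff_subset) fun r _ => ?_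
    exact hKc.preimage (regMap_lmul r⁻¹).continuous
  have hcov : scalarSaturation (G : Set (GL (Fin n) F)) ⊆ (K : Set (GL (Fin n) F)) ∪ V := by
    rintro x ⟨g, hg, c, rfl⟩
    obtain ⟨r, hr, hrg⟩ := hR2 g hg
    have hs : scalarGL n c ∈ scal F n := mem_scal.2 ⟨c, rfl⟩
    have hx : r⁻¹ * (scalarGL n c * g) ∈ K := by
      rw [← mul_assoc, ← scal_comm hs, mul_assoc]
      exact K.mul_mem (hsK hs) (hG1K hrg)
    by_cases hrK : r ∈ K
    · left
      have := K.mul_mem hrK hx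
      rwa [mul_inv_cancel_left] at this
    · right
      exact Set.mem_biUnion (show r ∈ R \ (K : Set (GL (Fin n) F)) from ⟨hr, hrK⟩) hx
  have hsat : ∀ g ∈ G, g ∈ scalarSaturation (G : Set (GL (Fin n) F)) := fun g hg => ⟨g, hg, 1, by simp [scalarGL]⟩
  intro g hg
  rcases hcov (hsat g hg) with h1 | h1
  · exact h1
  · obtain ⟨x, -, hxK, hxV⟩ := hconn.2 K V (glz_iff.2 hKc) (glz_iff.2 hVc) hcov
      ⟨1, hsat 1 G.one_mem, K.one_mem⟩ ⟨g, hsat g hg, h1⟩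
    simp only [hV, Set.mem_iUnion] at hxV
    obtain ⟨r, ⟨-, hrK⟩, hrx⟩ := hxV
    refine absurd ?_ hrK
    have := K.mul_mem hxK (K.inv_mem hrx)
    simpa using this

theorem scal_comm_elt {s s' t t' : GL (Fin n) F} (hs : s ∈ scal F n) (hs' : s' ∈ scal F n) :
    ⁅s * t, s' * t'⁆ = ⁅t, t'⁆ := by
  have i1 : (s * t)⁻¹ = s⁻¹ * t⁻¹ := by rw [scal_comm hs t]; group
  have i2 : (s' * t')⁻¹ = s'⁻¹ * t'⁻¹ := by rw [scal_comm hs' t']; group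
  have e1 : s * t * (s' * t') * (s * t)⁻¹ = s' * (t * t' * t⁻¹) := by
    have h1 : t * (s' * t') = s' * (t * t') := by rw [← mul_assoc, ← scal_comm hs' t, mul_assoc]
    rw [mul_assoc s, h1, scal_comm hs, i1]; group
  rw [commutatorElement_def, commutatorElement_def, e1, scal_comm hs', i2]
  group

theorem main_le [IsAlgClosed F] {G : Subgroup (GL (Fin n) F)}
    (hclosed : GLZClosed (G : Set (GL (Fin n) F))) (hirr : IrredOn G)
    (hconn : GLZConnected (scalarSaturation (G : Set (GL (Fin n) F)))) :
    G ≤ derSubgroup G ⊔ scal F n := by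
  obtain ⟨G1, h⟩ := exists_idc (glz_iff.1 hclosed)
  have hn := hirr.1
  have hGK := le_sprod hn h hconn
  have hsK : scal F n ≤ sprod G1 := fun s hs => ⟨s, hs, 1, G1.one_mem, by simp⟩
  have hp := perfect hn (sprod_closed hn h.closed h.irr) (irr_mul (scal_irr hn) h.irr) hsK
    (fun W hW => hirr.2 W fun g hg v hv => hW g (hGK hg) v hv)
  have hG1 : G1 ≤ idCompSubgroup G := fun x hx =>
    Subgroup.subset_closure ⟨G1, ⟨h.le, irr_connected h.irr, G1.one_mem⟩, hx⟩
  have hcomm : ⁅sprod G1, sprod G1⁆ ≤ derSubgroup G := by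
    rw [Subgroup.commutator_le]
    rintro _ ⟨s, hs, t, ht, rfl⟩ _ ⟨s', hs', t', ht', rfl⟩
    rw [scal_comm_elt hs hs']
    exact Subgroup.commutator_mem_commutator (hG1 ht) (hG1 ht')
  exact hGK.trans (hp.trans (sup_le_sup_right hcomm _))

theorem der_le (G : Subgroup (GL (Fin n) F)) : derSubgroup G ≤ G := by
  have h : idCompSubgroup G ≤ G := by
    refine (Subgroup.closure_le _).2 ?_
    rintro x ⟨S, ⟨hS, -⟩, hx⟩
    exact hS hx
  exact (Subgroup.commutator_le_self _).trans h

instance scal_normal : (scal F n).Normal := ⟨fun s hs g => by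
  rw [← scal_comm hs g, mul_inv_cancel_right]; exact hs⟩

end Final
end DPD

open Matrix in
/-- Let `F` be algebraically closed and `G ⊆ GL_n(F)` a closed subgroup
acting irreducibly on `F^n` with `G/Z(G)` connected (encoded via the scalar saturation).
If the weight zero occurs in the restriction of the tautological representation to
`G^der` (encoded: every element of `G^der` fixes a nonzero vector, i.e. has `1` as an
eigenvalue), then `G^der ∩ 𝔾_m = {1}` and `G` is the internal direct product
`G = G^der × (G ∩ 𝔾_m)`. -/
theorem direct_product_decomposition {F : Type*} [Field F] [IsAlgClosed F]
    {n : ℕ} (G : Subgroup (GL (Fin n) F))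
    (hclosed : GLZClosed (G : Set (GL (Fin n) F)))
    (hirr : IrredOn G)
    (hconn : GLZConnected (scalarSaturation (G : Set (GL (Fin n) F))))
    (hwt0 : ∀ g ∈ derSubgroup G, ∃ v : Fin n → F, v ≠ 0 ∧
      Matrix.mulVec (g : Matrix (Fin n) (Fin n) F) v = v) :
    ((derSubgroup G : Set (GL (Fin n) F)) ⊆ (G : Set (GL (Fin n) F))) ∧
    (∀ g ∈ derSubgroup G, IsScalarGL g → g = 1) ∧
    (∀ z ∈ G, ∃! p : GL (Fin n) F × GL (Fin n) F,
      p.1 ∈ derSubgroup G ∧ p.2 ∈ G ∧ IsScalarGL p.2 ∧ z = p.1 * p.2) := by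
  have hsc : ∀ g ∈ derSubgroup G, IsScalarGL g → g = 1 := by
    rintro g hg ⟨c, rfl⟩
    obtain ⟨v, hv, hgv⟩ := hwt0 _ hg
    have h1 : (c : F) • v = v := by
      have h2 := DPD.scalarGL_val (n := n) c
      rw [DPD.mat] at h2
      rwa [h2, Matrix.smul_mulVec, Matrix.one_mulVec] at hgv
    have h3 : ((c : F) - 1) • v = 0 := by rw [sub_smul, one_smul, h1, sub_self]
    have h4 : (c : F) = 1 := sub_eq_zero.1 ((smul_eq_zero.1 h3).resolve_right hv)
    have h5 : c = 1 := Units.ext h4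
    rw [h5, scalarGL, map_one]
  refine ⟨DPD.der_le G, hsc, fun z hz => ?_⟩
  obtain ⟨d, hd, c, hc, rfl⟩ := Subgroup.mem_sup_of_normal_right.1 (DPD.main_le hclosed hirr hconn hz)
  refine ⟨(d, c), ⟨hd, ?_, DPD.mem_scal.1 hc, rfl⟩, ?_⟩
  · have h1 := G.mul_mem (G.inv_mem (DPD.der_le G hd)) hz
    rwa [inv_mul_cancel_left] at h1
  · rintro ⟨d', c'⟩ ⟨hd', -, hc', e⟩
    simp only at e hd' hc'
    have hcm : d'⁻¹ * d = c' * c⁻¹ := by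
      rw [inv_mul_eq_iff_eq_mul, ← mul_assoc, ← e, mul_inv_cancel_right]
    have h1 : d'⁻¹ * d = 1 := by
      refine hsc _ (mul_mem (inv_mem hd') hd) ?_
      rw [hcm]
      exact DPD.mem_scal.1 ((DPD.scal F n).mul_mem (DPD.mem_scal.2 hc') ((DPD.scal F n).inv_mem hc))
    have h2 : d' = d := inv_mul_eq_one.1 h1
    subst h2
    rw [mul_right_inj] at e
    rw [e]
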